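/- Let n ≥ 2 be an integer, let Ω ⊆ ℝ² be open, and let u : Ω → (0,∞) be C² in y and C¹ in τ satisfying the rescaled equation ∂_τ u = u_yy/(1+u_y²) - (y/2)·u_y - (n-1)/u + u/2 on Ω. Let α, β, γ ∈ ℝ and define u^{αβγ}(y,τ) := √(1+βe^τ) · u((y - α·e^{τ/2})/√(1+βe^τ), τ + γ - log(1+βe^τ)) at every (y,τ) with 1+βe^τ > 0 and ((y - α·e^{τ/2})/√(1+βe^τ), τ + γ - log(1+βe^τ)) ∈ Ω. Then u^{αβγ} satisfies the rescaled equation ∂_τ u^{αβγ} = (u^{αβγ})_yy/(1+(u^{αβγ})_y²) - (y/2)·(u^{αβγ})_y - (n-1)/u^{αβγ} + u^{αβγ}/2 at every such point. -/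

import Mathlib

/-- The rescaled MCF profile equation
`∂_τ u = u_yy/(1+u_y²) - (y/2)u_y - (n-1)/u + u/2` at the point `(y,τ)`. -/
def SatisfiesRescaledMCF (n : ℕ) (u : ℝ → ℝ → ℝ) (y τ : ℝ) : Prop :=
  deriv (fun τ' => u y τ') τ =
    deriv (deriv (fun y' => u y' τ)) y / (1 + (deriv (fun y' => u y' τ) y) ^ 2)
      - y / 2 * deriv (fun y' => u y' τ) y
      - ((n : ℝ) - 1) / u y τ
      + u y τ / 2

/-- The effect on rescaled profiles of translating the flow along its axis by
`α`, in time by `β`, and parabolically dilating by `e^{γ/2}`. -/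
noncomputable def uabg (α β γ : ℝ) (u : ℝ → ℝ → ℝ) (y τ : ℝ) : ℝ :=
  Real.sqrt (1 + β * Real.exp τ) *
    u ((y - α * Real.exp (τ / 2)) / Real.sqrt (1 + β * Real.exp τ))
      (τ + γ - Real.log (1 + β * Real.exp τ))

namespace RescaledMCF

open Set Filter Topology

/-! ### One-variable calculus -/

theorem deriv_nonneg_of_le_left {f : ℝ → ℝ} {d x y : ℝ} (h : HasDerivAt f d x) (hy : y < x)
    (hf : ∀ z ∈ Ioo y x, f z ≤ f x) : 0 ≤ d := by
  have h1 : Tendsto (slope f x) (𝓝[<] x) (𝓝 d) :=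
    (hasDerivAt_iff_tendsto_slope.1 h).mono_left (nhdsWithin_mono _ fun z hz => ne_of_lt hz)
  refine ge_of_tendsto h1 ?_
  filter_upwards [Ioo_mem_nhdsLT hy] with z hz
  rw [slope_def_field]
  exact div_nonneg_of_nonpos (by linarith [hf z hz]) (by linarith [hz.2])

theorem deriv_nonpos_of_le_right {f : ℝ → ℝ} {d x y : ℝ} (h : HasDerivAt f d x) (hy : x < y)
    (hf : ∀ z ∈ Ioo x y, f z ≤ f x) : d ≤ 0 := by
  have h1 : Tendsto (slope f x) (𝓝[>] x) (𝓝 d) :=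
    (hasDerivAt_iff_tendsto_slope.1 h).mono_left (nhdsWithin_mono _ fun z hz => ne_of_gt hz)
  refine le_of_tendsto h1 ?_
  filter_upwards [Ioo_mem_nhdsGT hy] with z hz
  rw [slope_def_field]
  exact div_nonpos_of_nonpos_of_nonneg (by linarith [hf z hz]) (by linarith [hz.1])

theorem snd_deriv_nonpos {f f' : ℝ → ℝ} {d x : ℝ} (hf : ∀ᶠ y in 𝓝 x, HasDerivAt f (f' y) y)
    (hf' : HasDerivAt f' d x) (hmax : IsLocalMax f x) : d ≤ 0 := by
  by_contra! hd
  have h0 : f' x = 0 := hmax.hasDerivAt_eq_zero hf.self_of_nhds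
  have hsl := (hasDerivAt_iff_tendsto_slope.1 hf').eventually (lt_mem_nhds hd)
  rw [eventually_nhdsWithin_iff] at hsl
  obtain ⟨ε, hε, hb⟩ := Metric.eventually_nhds_iff.1 (hf.and (hsl.and hmax))
  have hm : StrictMonoOn f (Icc x (x + ε / 2)) := by
    refine strictMonoOn_of_hasDerivWithinAt_pos (f' := f') (convex_Icc _ _) ?_ ?_ ?_
    · intro y hy
      refine (hb (y := y) ?_).1.continuousAt.continuousWithinAt
      rw [Real.dist_eq, abs_lt]; constructor <;> linarith [hy.1, hy.2]
    · intro y hy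
      rw [interior_Icc] at hy
      refine (hb (y := y) ?_).1.hasDerivWithinAt
      rw [Real.dist_eq, abs_lt]; constructor <;> linarith [hy.1, hy.2]
    · intro y hy
      rw [interior_Icc] at hy
      have hs := (hb (y := y) (by rw [Real.dist_eq, abs_lt]; constructor <;>
        linarith [hy.1, hy.2])).2.1 (ne_of_gt hy.1)
      rw [slope_def_field, h0, sub_zero] at hs
      have : 0 < y - x := by linarith [hy.1]
      exact (div_pos_iff_of_pos_right this).1 hs
  have h1 := hm (left_mem_Icc.2 (by linarith)) (right_mem_Icc.2 (by linarith))
    (by linarith : x < x + ε / 2)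
  have h2 := (hb (y := x + ε / 2) (by
    rw [Real.dist_eq, abs_lt]; constructor <;> linarith)).2.2
  linarith

theorem snd_deriv_nonneg {f f' : ℝ → ℝ} {d x : ℝ} (hf : ∀ᶠ y in 𝓝 x, HasDerivAt f (f' y) y)
    (hf' : HasDerivAt f' d x) (hmin : IsLocalMin f x) : 0 ≤ d := by
  have := snd_deriv_nonpos (f := fun y => -f y) (f' := fun y => -f' y) (d := -d)
    (hf.mono fun y hy => hy.neg) hf'.neg hmin.neg
  linarith

/-! ### Time-differentiable families with locally bounded time derivative -/

structure TStrip (a b c T : ℝ) (u g : ℝ → ℝ → ℝ) : Prop where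
  deriv_t : ∀ y ∈ Icc a b, ∀ t ∈ Ioo c T, HasDerivAt (fun s => u y s) (g y t) t
  cont : ∀ t ∈ Ioo c T, ContinuousOn (fun y => u y t) (Icc a b)
  cont_g : ∀ t ∈ Ioo c T, ContinuousOn (fun y => g y t) (Icc a b)
  bdd : ∀ t ∈ Ioo c T, ∃ ε > 0, ∃ K, ∀ s ∈ Ioo c T, |s - t| < ε → ∀ y ∈ Icc a b, |g y s| ≤ K

namespace TStrip

variable {a b c T : ℝ} {u g U G : ℝ → ℝ → ℝ}

theorem mono (h : TStrip a b c T u g) {a' b' c' T' : ℝ} (ha : a ≤ a') (hb : b' ≤ b)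
    (hc : c ≤ c') (hT : T' ≤ T) : TStrip a' b' c' T' u g where
  deriv_t y hy t ht := h.deriv_t y ⟨ha.trans hy.1, hy.2.trans hb⟩ t
    ⟨hc.trans_lt ht.1, ht.2.trans_le hT⟩
  cont t ht := (h.cont t ⟨hc.trans_lt ht.1, ht.2.trans_le hT⟩).mono (Icc_subset_Icc ha hb)
  cont_g t ht := (h.cont_g t ⟨hc.trans_lt ht.1, ht.2.trans_le hT⟩).mono (Icc_subset_Icc ha hb)
  bdd t ht := by
    obtain ⟨ε, hε, K, hK⟩ := h.bdd t ⟨hc.trans_lt ht.1, ht.2.trans_le hT⟩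
    exact ⟨ε, hε, K, fun s hs hst y hy => hK s ⟨hc.trans_lt hs.1, hs.2.trans_le hT⟩ hst y
      ⟨ha.trans hy.1, hy.2.trans hb⟩⟩

theorem sub (h : TStrip a b c T u g) (H : TStrip a b c T U G) :
    TStrip a b c T (fun y t => u y t - U y t) (fun y t => g y t - G y t) where
  deriv_t y hy t ht := (h.deriv_t y hy t ht).sub (H.deriv_t y hy t ht)
  cont t ht := (h.cont t ht).sub (H.cont t ht)
  cont_g t ht := (h.cont_g t ht).sub (H.cont_g t ht)
  bdd t ht := by
    obtain ⟨ε, hε, K, hK⟩ := h.bdd t ht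
    obtain ⟨ε', hε', K', hK'⟩ := H.bdd t ht
    refine ⟨min ε ε', lt_min hε hε', K + K', fun s hs hst y hy => ?_⟩
    exact (abs_sub _ _).trans (add_le_add (hK s hs (hst.trans_le (min_le_left _ _)) y hy)
      (hK' s hs (hst.trans_le (min_le_right _ _)) y hy))

theorem continuousOn (h : TStrip a b c T u g) :
    ContinuousOn (fun p : ℝ × ℝ => u p.1 p.2) (Icc a b ×ˢ Ioo c T) := by
  rintro ⟨y, t⟩ ⟨hy, ht⟩
  simp only at hy ht
  obtain ⟨ε, hε, K, hK⟩ := h.bdd t ht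
  have hlip : ∀ z ∈ Icc a b, ∀ s ∈ Ioo c T, |s - t| < ε → |u z s - u z t| ≤ K * |s - t| := by
    intro z hz s hs hst
    have hconv : Convex ℝ (Ioo c T ∩ Metric.ball t ε) := (convex_Ioo _ _).inter (convex_ball _ _)
    have := hconv.norm_image_sub_le_of_norm_hasDerivWithin_le (f := fun s => u z s)
      (f' := fun s => g z s) (C := K) (x := t) (y := s)
      (fun r hr => (h.deriv_t z hz r hr.1).hasDerivWithinAt)
      (fun r hr => hK r hr.1 (by simpa [Real.dist_eq] using hr.2) z hz)
      ⟨ht, Metric.mem_ball_self hε⟩ ⟨hs, by simpa [Real.dist_eq] using hst⟩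
    simpa [Real.norm_eq_abs] using this
  have h1 : Tendsto (fun p : ℝ × ℝ => u p.1 p.2 - u p.1 t) (𝓝[Icc a b ×ˢ Ioo c T] (y, t))
      (𝓝 0) := by
    have h3 : Tendsto (fun p : ℝ × ℝ => K * |p.2 - t|) (𝓝[Icc a b ×ˢ Ioo c T] (y, t)) (𝓝 0) := by
      have : Continuous fun p : ℝ × ℝ => K * |p.2 - t| := by fun_prop
      have h4 := this.tendsto (y, t)
      simp only [sub_self, abs_zero, mul_zero] at h4
      exact h4.mono_left nhdsWithin_le_nhds
    refine squeeze_zero_norm' ?_ h3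
    have h5 : ∀ᶠ p : ℝ × ℝ in 𝓝 (y, t), |p.2 - t| < ε := by
      have : Continuous fun p : ℝ × ℝ => |p.2 - t| := by fun_prop
      exact this.continuousAt.eventually (gt_mem_nhds (by simpa using hε))
    filter_upwards [self_mem_nhdsWithin, nhdsWithin_le_nhds h5] with p hp hp'
    exact hlip p.1 hp.1 p.2 hp.2 hp'
  have h2 : Tendsto (fun p : ℝ × ℝ => u p.1 t) (𝓝[Icc a b ×ˢ Ioo c T] (y, t)) (𝓝 (u y t)) := by
    refine (h.cont t ht y hy).tendsto.comp ?_
    refine tendsto_nhdsWithin_iff.2 ⟨continuous_fst.continuousWithinAt, ?_⟩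
    filter_upwards [self_mem_nhdsWithin] with p hp using hp.1
  have := h1.add h2
  simpa [ContinuousWithinAt] using this

theorem hasDerivAt_integral (h : TStrip a b c T u g) {x y t : ℝ} (hx : x ∈ Icc a b)
    (hy : y ∈ Icc a b) (ht : t ∈ Ioo c T) :
    HasDerivAt (fun s => ∫ z in x..y, u z s) (∫ z in x..y, g z t) t := by
  obtain ⟨ε, hε, K, hK⟩ := h.bdd t ht
  have hsub : uIcc x y ⊆ Icc a b := uIcc_subset_Icc hx hy
  have hnb : Ioo c T ∩ Metric.ball t ε ∈ 𝓝 t :=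
    inter_mem (Ioo_mem_nhds ht.1 ht.2) (Metric.ball_mem_nhds t hε)
  refine (intervalIntegral.hasDerivAt_integral_of_dominated_loc_of_deriv_le
    (F := fun s z => u z s) (F' := fun s z => g z s) (bound := fun _ => K) hnb ?_ ?_ ?_ ?_ ?_ ?_).2
  · filter_upwards [Ioo_mem_nhds ht.1 ht.2] with s hs
    exact (intervalIntegrable_iff.1
      ((h.cont s hs).mono hsub).intervalIntegrable).aestronglyMeasurable
  · exact ((h.cont t ht).mono hsub).intervalIntegrable
  · exact (intervalIntegrable_iff.1
      ((h.cont_g t ht).mono hsub).intervalIntegrable).aestronglyMeasurable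
  · refine MeasureTheory.ae_of_all _ fun z hz s hs => ?_
    exact hK s hs.1 (by simpa [Real.dist_eq] using hs.2) z (hsub (uIoc_subset_uIcc hz))
  · exact intervalIntegrable_const
  · refine MeasureTheory.ae_of_all _ fun z hz s hs => ?_
    exact h.deriv_t z (hsub (uIoc_subset_uIcc hz)) s hs.1

theorem continuousOn_integral (h : TStrip a b c T u g) (hab : a ≤ b) {s₀ s₁ : ℝ} (h0 : c < s₀)
    (h01 : s₀ ≤ s₁) (h1 : s₁ < T) :
    ContinuousOn (fun p : ℝ × ℝ => ∫ z in a..p.1, u z p.2) (Icc a b ×ˢ Icc s₀ s₁) := by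
  set U : ℝ → ℝ → ℝ := fun s y => u (max a (min b y)) (max s₀ (min s₁ s)) with hU
  have hUc : Continuous (Function.uncurry U) := by
    have := h.continuousOn
    rw [← continuousOn_univ]
    refine this.comp (f := fun p : ℝ × ℝ => (max a (min b p.2), max s₀ (min s₁ p.1)))
      (by fun_prop) ?_
    intro p _
    refine ⟨⟨le_max_left _ _, max_le hab (min_le_left _ _)⟩, ?_, ?_⟩
    · exact h0.trans_le (le_max_left _ _)
    · exact (max_le h01 (min_le_left _ _)).trans_lt h1
  have hc : Continuous fun p : ℝ × ℝ => ∫ z in a..p.1, U p.2 z := by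
    have := intervalIntegral.continuous_parametric_primitive_of_continuous
      (μ := MeasureTheory.volume) (f := U) (a₀ := a) hUc
    exact this.comp continuous_swap
  refine hc.continuousOn.congr ?_
  rintro ⟨x, s⟩ ⟨hx, hs⟩
  simp only at hx hs ⊢
  refine intervalIntegral.integral_congr fun z hz => ?_
  rw [uIcc_of_le hx.1] at hz
  simp only [hU]
  rw [min_eq_right (hz.2.trans hx.2), max_eq_right hz.1, min_eq_right hs.2, max_eq_right hs.1]

theorem hasDerivAt_primitive (h : TStrip a b c T u g) {x t : ℝ} (hx : x ∈ Ioo a b)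
    (ht : t ∈ Ioo c T) : HasDerivAt (fun x => ∫ z in a..x, u z t) (u x t) x := by
  have hc := h.cont t ht
  refine intervalIntegral.integral_hasDerivAt_right ?_ ?_ ?_
  · refine (hc.mono ?_).intervalIntegrable
    rw [uIcc_of_le hx.1.le]
    exact Icc_subset_Icc_right hx.2.le
  · refine ContinuousOn.stronglyMeasurableAtFilter isOpen_Ioo
      (hc.mono Ioo_subset_Icc_self) x hx
  · exact hc.continuousAt (Icc_mem_nhds hx.1 hx.2)

end TStrip

structure Strip (a b c T : ℝ) (u v w g : ℝ → ℝ → ℝ) : Prop extends TStrip a b c T u g where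
  hv : ∀ y ∈ Icc a b, ∀ t ∈ Ioo c T, HasDerivAt (fun x => u x t) (v y t) y
  hw : ∀ y ∈ Icc a b, ∀ t ∈ Ioo c T, HasDerivAt (fun x => v x t) (w y t) y
  cont_w : ∀ t ∈ Ioo c T, ContinuousOn (fun y => w y t) (Icc a b)

namespace Strip

variable {a b c T : ℝ} {u v w g U V W G : ℝ → ℝ → ℝ}

theorem mono (h : Strip a b c T u v w g) {a' b' c' T' : ℝ} (ha : a ≤ a') (hb : b' ≤ b)
    (hc : c ≤ c') (hT : T' ≤ T) : Strip a' b' c' T' u v w g where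
  toTStrip := h.toTStrip.mono ha hb hc hT
  hv y hy t ht := h.hv y ⟨ha.trans hy.1, hy.2.trans hb⟩ t ⟨hc.trans_lt ht.1, ht.2.trans_le hT⟩
  hw y hy t ht := h.hw y ⟨ha.trans hy.1, hy.2.trans hb⟩ t ⟨hc.trans_lt ht.1, ht.2.trans_le hT⟩
  cont_w t ht := (h.cont_w t ⟨hc.trans_lt ht.1, ht.2.trans_le hT⟩).mono (Icc_subset_Icc ha hb)

theorem cont_v (h : Strip a b c T u v w g) {t : ℝ} (ht : t ∈ Ioo c T) :
    ContinuousOn (fun y => v y t) (Icc a b) :=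
  fun y hy => (h.hw y hy t ht).continuousAt.continuousWithinAt

/-- Integral of the divergence part of the equation. -/
theorem integral_flux (h : Strip a b c T u v w g) {y₁ y₂ t : ℝ} (h1 : y₁ ∈ Icc a b)
    (h2 : y₂ ∈ Icc a b) (ht : t ∈ Ioo c T) :
    ∫ y in y₁..y₂, (w y t / (1 + v y t ^ 2) - y / 2 * v y t + u y t / 2) =
      (Real.arctan (v y₂ t) - y₂ / 2 * u y₂ t) - (Real.arctan (v y₁ t) - y₁ / 2 * u y₁ t)
        + ∫ y in y₁..y₂, u y t := by
  have hsub : uIcc y₁ y₂ ⊆ Icc a b := uIcc_subset_Icc h1 h2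
  have cv := (h.cont_v ht).mono hsub
  have cw := (h.cont_w t ht).mono hsub
  have cu := (h.cont t ht).mono hsub
  have cd : ContinuousOn (fun y => w y t / (1 + v y t ^ 2) - (1 / 2 * u y t + y / 2 * v y t))
      (uIcc y₁ y₂) := by
    refine (cw.div (by fun_prop) fun y _ => by positivity).sub (by fun_prop)
  rw [← intervalIntegral.integral_eq_sub_of_hasDerivAt
    (f := fun y => Real.arctan (v y t) - y / 2 * u y t) (f' := fun y => w y t / (1 + v y t ^ 2)
      - (1 / 2 * u y t + y / 2 * v y t)) ?_ cd.intervalIntegrable,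
    ← intervalIntegral.integral_add cd.intervalIntegrable cu.intervalIntegrable]
  · exact intervalIntegral.integral_congr fun y _ => by ring
  · intro y hy
    exact ((h.hw y (hsub hy) t ht).arctan.sub
      (((hasDerivAt_id y).div_const 2).mul (h.hv y (hsub hy) t ht))).congr_deriv
        (by simp only [id_eq]; ring)

theorem cont_flux (h : Strip a b c T u v w g) {t : ℝ} (ht : t ∈ Ioo c T) :
    ContinuousOn (fun y => w y t / (1 + v y t ^ 2) - y / 2 * v y t + u y t / 2) (Icc a b) := by
  have cv := h.cont_v ht
  have cw := h.cont_w t ht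
  have cu := h.cont t ht
  exact ((cw.div (by fun_prop) fun y _ => by positivity).sub (by fun_prop)).add (by fun_prop)

end Strip

/-- A continuous function positive somewhere on `[a, b]` has a subinterval of positive integral. -/
theorem exists_integral_pos {a b : ℝ} (hab : a < b) {f : ℝ → ℝ} (hf : ContinuousOn f (Icc a b))
    {y : ℝ} (hy : y ∈ Icc a b) (hpos : 0 < f y) :
    ∃ y₁ y₂, a ≤ y₁ ∧ y₁ ≤ y₂ ∧ y₂ ≤ b ∧ 0 < ∫ x in y₁..y₂, f x := by
  obtain ⟨ε, hε, hb⟩ := Metric.continuousOn_iff.1 hf y hy (f y) hpos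
  have hp : ∀ x ∈ Icc a b, |x - y| < ε → 0 < f x := fun x hx hxy => by
    have := hb x hx hxy
    rw [Real.dist_eq, abs_lt] at this; linarith
  have key : ∀ y₁ y₂, a ≤ y₁ → y₁ < y₂ → y₂ ≤ b → y - ε < y₁ → y₂ < y + ε →
      0 < ∫ x in y₁..y₂, f x := by
    intro y₁ y₂ h1 h2 h3 h4 h5
    refine intervalIntegral.intervalIntegral_pos_of_pos_on
      ((hf.mono ?_).intervalIntegrable) ?_ h2
    · rw [uIcc_of_le h2.le]; exact Icc_subset_Icc h1 h3
    · intro x hx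
      refine hp x ⟨h1.trans hx.1.le, hx.2.le.trans h3⟩ ?_
      rw [abs_lt]; constructor <;> linarith [hx.1, hx.2]
  rcases hy.2.lt_or_eq with h | h
  · refine ⟨y, min b (y + ε / 2), hy.1, le_min h.le (by linarith), min_le_left _ _,
      key _ _ hy.1 (lt_min h (by linarith)) (min_le_left _ _) (by linarith)
        ((min_le_right _ _).trans_lt (by linarith))⟩
  · have hay : a < y := h ▸ hab
    refine ⟨max a (y - ε / 2), y, le_max_left _ _, max_le hay.le (by linarith), hy.2,
      key _ _ (le_max_left _ _) (max_lt hay (by linarith)) hy.2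
        ((by linarith : y - ε < y - ε / 2).trans_le (le_max_right _ _)) (by linarith)⟩

/-- Interior conditions at the endpoints of an interval maximizing the integral of `z`. -/
theorem integral_max_right {a b : ℝ} {z : ℝ → ℝ} {z' y₁ y₂ : ℝ} (hz : ContinuousOn z (Icc a b))
    (h1 : a ≤ y₁) (h12 : y₁ < y₂) (h2 : y₂ ≤ b) (hb : z b < 0) (hd : HasDerivAt z z' y₂)
    (hmax : ∀ x, y₁ ≤ x → x ≤ b → ∫ y in y₁..x, z y ≤ ∫ y in y₁..y₂, z y) :
    y₂ < b ∧ z y₂ = 0 ∧ z' ≤ 0 := by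
  have hInt : ∀ x ∈ Icc y₁ b, ∀ x' ∈ Icc y₁ b, IntervalIntegrable z MeasureTheory.volume x x' :=
    fun x hx x' hx' => (hz.mono ((uIcc_subset_Icc hx hx').trans
      (Icc_subset_Icc_left h1))).intervalIntegrable
  have m1 : y₁ ∈ Icc y₁ b := ⟨le_rfl, h12.le.trans h2⟩
  have m2 : y₂ ∈ Icc y₁ b := ⟨h12.le, h2⟩
  have hle : ∀ x ∈ Icc y₁ b, ∫ y in y₂..x, z y ≤ 0 := by
    intro x hx
    have := intervalIntegral.integral_add_adjacent_intervals (hInt _ m1 _ m2) (hInt _ m2 _ hx)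
    linarith [hmax x hx.1 hx.2]
  have hc : ContinuousAt z y₂ := hd.continuousAt
  obtain ⟨ε, hε, hb'⟩ : ∃ ε > 0, ∀ x, |x - y₂| < ε → z y₂ < 0 → z x < 0 := by
    by_cases h0 : z y₂ < 0
    · obtain ⟨ε, hε, H⟩ := Metric.eventually_nhds_iff.1 (hc.eventually (gt_mem_nhds h0))
      exact ⟨ε, hε, fun x hx _ => H (by simpa [Real.dist_eq] using hx)⟩
    · exact ⟨1, one_pos, fun x _ h => absurd h h0⟩
  have hnn : 0 ≤ z y₂ := by
    by_contra! h0
    set x := max y₁ (y₂ - ε / 2)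
    have hx : x < y₂ := max_lt h12 (by linarith)
    have hxm : x ∈ Icc y₁ b := ⟨le_max_left _ _, hx.le.trans h2⟩
    have h3 : 0 < ∫ y in x..y₂, -z y := by
      refine intervalIntegral.intervalIntegral_pos_of_pos_on (hInt _ hxm _ m2).neg ?_ hx
      intro y hy
      have : y₂ - ε / 2 ≤ x := le_max_right _ _
      have := hb' y (by rw [abs_lt]; constructor <;> linarith [hy.1, hy.2]) h0
      linarith
    rw [intervalIntegral.integral_neg, ← intervalIntegral.integral_symm] at h3
    linarith [hle x hxm]
  have hlt : y₂ < b := by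
    rcases h2.lt_or_eq with h | h
    · exact h
    · rw [h] at hnn; linarith
  have hev : ∀ᶠ x in 𝓝 y₂, x ∈ Ioo y₁ b := Ioo_mem_nhds h12 hlt
  have hder : ∀ x ∈ Ioo y₁ b, HasDerivAt (fun x => ∫ y in y₂..x, z y) (z x) x := by
    intro x hx
    refine intervalIntegral.integral_hasDerivAt_right (hInt _ m2 _ ⟨hx.1.le, hx.2.le⟩)
      (ContinuousOn.stronglyMeasurableAtFilter isOpen_Ioo
        (hz.mono ((Ioo_subset_Ioo_left h1).trans Ioo_subset_Icc_self)) x hx) ?_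
    exact hz.continuousAt (Icc_mem_nhds (h1.trans_lt hx.1) hx.2)
  have hlm : IsLocalMax (fun x => ∫ y in y₂..x, z y) y₂ := by
    filter_upwards [hev] with x hx
    simpa using hle x ⟨hx.1.le, hx.2.le⟩
  exact ⟨hlt, hlm.hasDerivAt_eq_zero (hder y₂ ⟨h12, hlt⟩),
    snd_deriv_nonpos (hev.mono hder) hd hlm⟩

theorem integral_max_left {a b : ℝ} {z : ℝ → ℝ} {z' y₁ y₂ : ℝ} (hz : ContinuousOn z (Icc a b))
    (h1 : a ≤ y₁) (h12 : y₁ < y₂) (h2 : y₂ ≤ b) (ha : z a < 0) (hd : HasDerivAt z z' y₁)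
    (hmax : ∀ x, a ≤ x → x ≤ y₂ → ∫ y in x..y₂, z y ≤ ∫ y in y₁..y₂, z y) :
    a < y₁ ∧ z y₁ = 0 ∧ 0 ≤ z' := by
  have key := integral_max_right (a := -b) (b := -a) (z := fun x => z (-x)) (z' := -z')
    (y₁ := -y₂) (y₂ := -y₁) (hz.comp continuousOn_neg fun x hx => ⟨by linarith [hx.2],
      by linarith [hx.1]⟩) (by linarith) (by linarith) (by linarith) (by simpa using ha)
    (by
      have : HasDerivAt z z' (- -y₁) := by simpa using hd
      exact (this.comp (-y₁) (hasDerivAt_neg (-y₁))).congr_deriv (by ring)) (by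
      intro x hx hx'
      rw [intervalIntegral.integral_comp_neg (fun y => z y),
        intervalIntegral.integral_comp_neg (fun y => z y), neg_neg, neg_neg]
      exact hmax (-x) (by linarith) (by linarith))
  simp only [neg_neg, neg_nonpos] at key
  exact ⟨by linarith [key.1], key.2⟩

theorem area_comparison {a b c T : ℝ} {u v w g U V W G : ℝ → ℝ → ℝ} (hab : a < b)
    (hu : Strip a b c T u v w g) (hU : Strip a b c T U V W G)
    (hineq : ∀ y ∈ Icc a b, ∀ t ∈ Ioo c T, g y t - G y t ≤
      (w y t / (1 + v y t ^ 2) - y / 2 * v y t + u y t / 2) -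
      (W y t / (1 + V y t ^ 2) - y / 2 * V y t + U y t / 2))
    (ha : ∀ t ∈ Ioo c T, u a t < U a t) (hb : ∀ t ∈ Ioo c T, u b t < U b t)
    (H : ∀ ε > 0, ∀ δ > 0, ∃ s ∈ Ioo c T, s < c + δ ∧ ∀ y₁ y₂, a ≤ y₁ → y₁ ≤ y₂ → y₂ ≤ b →
      ∫ y in y₁..y₂, (u y s - U y s) ≤ ε) :
    ∀ y ∈ Icc a b, ∀ t ∈ Ioo c T, u y t ≤ U y t := by
  intro y hy t ht
  by_contra! hlt
  have hz := hu.toTStrip.sub hU.toTStrip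
  obtain ⟨p₁, p₂, hp1, hp12, hp2, hpos⟩ := exists_integral_pos hab (hz.cont t ht) hy
    (by linarith : 0 < u y t - U y t)
  set κ := ∫ x in p₁..p₂, (u x t - U x t) with hκ
  obtain ⟨s₀, hs0, hs0t, hs0H⟩ := H (κ * Real.exp (-2 * (t - c)) / 2) (by positivity) (t - c)
    (by linarith [ht.1])
  have hst : s₀ < t := by linarith
  set A : ℝ × ℝ → ℝ := fun p => ∫ x in a..p.1, (u x p.2 - U x p.2) with hA
  have hAc : ContinuousOn A (Icc a b ×ˢ Icc s₀ t) :=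
    hz.continuousOn_integral hab.le hs0.1 hst.le ht.2
  set D : Set (ℝ × ℝ × ℝ) := (Icc a b ×ˢ Icc a b ×ˢ Icc s₀ t) ∩ {p | p.1 ≤ p.2.1} with hD
  have hDc : IsCompact D :=
    (isCompact_Icc.prod (isCompact_Icc.prod isCompact_Icc)).inter_right
      (isClosed_le (by fun_prop) (by fun_prop))
  set F : ℝ × ℝ × ℝ → ℝ := fun p => (A (p.2.1, p.2.2) - A (p.1, p.2.2)) *
    Real.exp (-2 * p.2.2) with hF
  have hFc : ContinuousOn F D := by
    refine ContinuousOn.mul (ContinuousOn.sub ?_ ?_) (by fun_prop)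
    · exact hAc.comp (by fun_prop) fun p hp => ⟨hp.1.2.1, hp.1.2.2⟩
    · exact hAc.comp (by fun_prop) fun p hp => ⟨hp.1.1, hp.1.2.2⟩
  have hAd : ∀ x₁ ∈ Icc a b, ∀ x₂ ∈ Icc a b, ∀ s ∈ Ioo c T,
      A (x₂, s) - A (x₁, s) = ∫ x in x₁..x₂, (u x s - U x s) := by
    intro x₁ h1 x₂ h2 s hs
    have hInt : ∀ x ∈ Icc a b, IntervalIntegrable (fun x => u x s - U x s)
        MeasureTheory.volume a x := fun x hx =>
      ((hz.cont s hs).mono (uIcc_subset_Icc (left_mem_Icc.2 hab.le) hx)).intervalIntegrable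
    exact intervalIntegral.integral_interval_sub_left (hInt _ h2) (hInt _ h1)
  have hm0 : (p₁, p₂, t) ∈ D :=
    ⟨⟨⟨hp1, hp12.trans hp2⟩, ⟨hp1.trans hp12, hp2⟩, ⟨hst.le, le_rfl⟩⟩, hp12⟩
  obtain ⟨⟨y₁, y₂, s⟩, ⟨⟨hy1, hy2, hs⟩, hy12⟩, hmax⟩ := hDc.exists_isMaxOn ⟨_, hm0⟩ hFc
  replace hmax : ∀ p ∈ D, F p ≤ F (y₁, y₂, s) := fun p hp => hmax hp
  simp only at hy1 hy2 hs
  simp only [mem_ofPred_eq] at hy12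
  have hsT : s ∈ Ioo c T := ⟨hs0.1.trans_le hs.1, hs.2.trans_lt ht.2⟩
  set K := ∫ x in y₁..y₂, (u x s - U x s) with hK
  have hFm : κ * Real.exp (-2 * t) ≤ K * Real.exp (-2 * s) := by
    have := hmax _ hm0
    simp only [hF] at this
    rwa [hAd p₁ hm0.1.1 p₂ hm0.1.2.1 t ht, hAd y₁ hy1 y₂ hy2 s hsT] at this
  have hKpos : 0 < K := by
    have : 0 < κ * Real.exp (-2 * t) := by positivity
    exact pos_of_mul_pos_left (this.trans_le hFm) (Real.exp_pos _).le
  have hy12' : y₁ < y₂ := by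
    refine lt_of_le_of_ne hy12 fun h => ?_
    rw [hK, h, intervalIntegral.integral_same] at hKpos
    exact lt_irrefl _ hKpos
  have hs0s : s₀ < s := by
    refine lt_of_le_of_ne hs.1 fun h => ?_
    have h1 := hs0H y₁ y₂ hy1.1 hy12 hy2.2
    rw [h, ← hK] at h1
    have h2 : K * Real.exp (-2 * s) ≤ κ * Real.exp (-2 * (t - c)) / 2 * Real.exp (-2 * c) :=
      mul_le_mul h1 (Real.exp_le_exp.2 (by linarith [hsT.1])) (Real.exp_pos _).le (by positivity)
    have h3 : κ * Real.exp (-2 * (t - c)) / 2 * Real.exp (-2 * c) =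
        κ * Real.exp (-2 * t) / 2 := by
      rw [show -2 * t = -2 * (t - c) + -2 * c by ring, Real.exp_add]; ring
    have : 0 < κ * Real.exp (-2 * t) := by positivity
    linarith
  have hmaxy : ∀ x₁ ∈ Icc a b, ∀ x₂ ∈ Icc a b, x₁ ≤ x₂ →
      ∫ x in x₁..x₂, (u x s - U x s) ≤ K := by
    intro x₁ h1 x₂ h2 h12
    have := hmax _ (show (x₁, x₂, s) ∈ D from ⟨⟨h1, h2, hs⟩, h12⟩)
    simp only [hF] at this
    rw [hAd x₁ h1 x₂ h2 s hsT, hAd y₁ hy1 y₂ hy2 s hsT] at this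
    exact le_of_mul_le_mul_right this (Real.exp_pos _)
  obtain ⟨-, hz2, hz2'⟩ := integral_max_right (hz.cont s hsT) hy1.1 hy12' hy2.2
    (by linarith [hb s hsT]) ((hu.hv y₂ hy2 s hsT).sub (hU.hv y₂ hy2 s hsT))
    (fun x h1 h2 => hmaxy y₁ hy1 x ⟨hy1.1.trans h1, h2⟩ h1)
  obtain ⟨-, hz1, hz1'⟩ := integral_max_left (hz.cont s hsT) hy1.1 hy12' hy2.2
    (by linarith [ha s hsT]) ((hu.hv y₁ hy1 s hsT).sub (hU.hv y₁ hy1 s hsT))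
    (fun x h1 h2 => hmaxy x ⟨h1, h2.trans hy2.2⟩ y₂ hy2 h2)
  have hdK := hz.hasDerivAt_integral hy1 hy2 hsT
  have hsub : uIcc y₁ y₂ ⊆ Icc a b := uIcc_subset_Icc hy1 hy2
  have hbound : ∫ x in y₁..y₂, (g x s - G x s) ≤ K := by
    have hi1 := ((hu.cont_flux hsT).mono hsub).intervalIntegrable (μ := MeasureTheory.volume)
    have hi2 := ((hU.cont_flux hsT).mono hsub).intervalIntegrable (μ := MeasureTheory.volume)
    have h1 := intervalIntegral.integral_mono_on hy12
      ((hz.cont_g s hsT).mono hsub).intervalIntegrable (hi1.sub hi2) fun x hx =>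
        hineq x ⟨hy1.1.trans hx.1, hx.2.trans hy2.2⟩ s hsT
    rw [intervalIntegral.integral_sub hi1 hi2, hu.integral_flux hy1 hy2 hsT,
      hU.integral_flux hy1 hy2 hsT] at h1
    have h2 : K = (∫ x in y₁..y₂, u x s) - ∫ x in y₁..y₂, U x s :=
      intervalIntegral.integral_sub ((hu.cont s hsT).mono hsub).intervalIntegrable
        ((hU.cont s hsT).mono hsub).intervalIntegrable
    have h3 : Real.arctan (v y₂ s) ≤ Real.arctan (V y₂ s) :=
      Real.arctan_strictMono.monotone (by linarith)
    have h4 : Real.arctan (V y₁ s) ≤ Real.arctan (v y₁ s) :=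
      Real.arctan_strictMono.monotone (by linarith)
    have h5 : u y₁ s = U y₁ s := by linarith
    have h6 : u y₂ s = U y₂ s := by linarith
    rw [h5, h6] at h1
    linarith
  have hdE : HasDerivAt (fun r => (∫ x in y₁..y₂, (u x r - U x r)) * Real.exp (-2 * r))
      ((∫ x in y₁..y₂, (g x s - G x s)) * Real.exp (-2 * s) +
        K * (Real.exp (-2 * s) * (-2 * 1))) s :=
    hdK.mul (((hasDerivAt_id s).const_mul (-2)).exp)
  have := deriv_nonneg_of_le_left hdE hs0s fun r hr => by
    have hr' : r ∈ Ioo c T := ⟨hs0.1.trans hr.1, hr.2.trans hsT.2⟩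
    have := hmax _ (show (y₁, y₂, r) ∈ D from ⟨⟨hy1, hy2, ⟨hr.1.le, hr.2.le.trans hs.2⟩⟩, hy12⟩)
    simp only [hF] at this
    rwa [hAd y₁ hy1 y₂ hy2 r hr', hAd y₁ hy1 y₂ hy2 s hsT] at this
  nlinarith [Real.exp_pos (-2 * s), mul_pos hKpos (Real.exp_pos (-2 * s)),
    mul_le_mul_of_nonneg_right hbound (Real.exp_pos (-2 * s)).le]

/-- A positive solution of the rescaled equation, with its derivatives `v = u_y`, `w = u_yy`,
`g = u_τ`, regular on horizontal and vertical slices only. -/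
structure Sol (κ : ℝ) (Ω : Set (ℝ × ℝ)) (u v w g : ℝ → ℝ → ℝ) : Prop where
  isOpen : IsOpen Ω
  κ_nonneg : 0 ≤ κ
  pos : ∀ y t, (y, t) ∈ Ω → 0 < u y t
  hv : ∀ y t, (y, t) ∈ Ω → HasDerivAt (fun x => u x t) (v y t) y
  hw : ∀ y t, (y, t) ∈ Ω → HasDerivAt (fun x => v x t) (w y t) y
  hg : ∀ y t, (y, t) ∈ Ω → HasDerivAt (fun s => u y s) (g y t) t
  cont_w : ∀ y t, (y, t) ∈ Ω → ContinuousAt (fun x => w x t) y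
  cont_g : ∀ y t, (y, t) ∈ Ω → ContinuousAt (fun s => g y s) t
  pde : ∀ y t, (y, t) ∈ Ω →
    g y t = w y t / (1 + v y t ^ 2) - y / 2 * v y t - κ / u y t + u y t / 2

/-- `Ω` contains a neighbourhood of `p` on which `g` is bounded. -/
def LocBdd (Ω : Set (ℝ × ℝ)) (g : ℝ → ℝ → ℝ) (p : ℝ × ℝ) : Prop :=
  ∃ ε > 0, ∃ K, ∀ y t, |y - p.1| < ε → |t - p.2| < ε → (y, t) ∈ Ω ∧ |g y t| ≤ K

theorem LocBdd.mem {Ω : Set (ℝ × ℝ)} {g : ℝ → ℝ → ℝ} {p : ℝ × ℝ} (h : LocBdd Ω g p) : p ∈ Ω := by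
  obtain ⟨ε, hε, K, hK⟩ := h
  exact (hK p.1 p.2 (by simpa using hε) (by simpa using hε)).1

theorem isOpen_locBdd (Ω : Set (ℝ × ℝ)) (g : ℝ → ℝ → ℝ) : IsOpen {p | LocBdd Ω g p} := by
  rw [Metric.isOpen_iff]
  rintro p ⟨ε, hε, K, hK⟩
  refine ⟨ε / 2, by positivity, fun q hq => ⟨ε / 2, by positivity, K, fun y t hy ht => ?_⟩⟩
  rw [Metric.mem_ball, Prod.dist_eq, max_lt_iff, Real.dist_eq, Real.dist_eq] at hq
  refine hK y t ?_ ?_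
  · calc |y - p.1| ≤ |y - q.1| + |q.1 - p.1| := abs_sub_le _ _ _
      _ < ε := by linarith [hq.1]
  · calc |t - p.2| ≤ |t - q.2| + |q.2 - p.2| := abs_sub_le _ _ _
      _ < ε := by linarith [hq.2]

theorem exists_tube {Ω : Set (ℝ × ℝ)} {g : ℝ → ℝ → ℝ} {a b t : ℝ}
    (h : ∀ y ∈ Icc a b, LocBdd Ω g (y, t)) :
    ∃ ε > 0, ∃ K, ∀ y ∈ Icc a b, ∀ s, |s - t| < ε → LocBdd Ω g (y, s) ∧ |g y s| ≤ K := by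
  refine isCompact_Icc.induction_on (p := fun S => ∃ ε > 0, ∃ K, ∀ y ∈ S, ∀ s, |s - t| < ε →
    LocBdd Ω g (y, s) ∧ |g y s| ≤ K) ?_ ?_ ?_ ?_
  · exact ⟨1, one_pos, 0, fun y hy => absurd hy (notMem_empty y)⟩
  · rintro S S' hSS ⟨ε, hε, K, hK⟩
    exact ⟨ε, hε, K, fun y hy => hK y (hSS hy)⟩
  · rintro S S' ⟨ε, hε, K, hK⟩ ⟨ε', hε', K', hK'⟩
    refine ⟨min ε ε', lt_min hε hε', max K K', ?_⟩
    rintro y (hy | hy) s hs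
    · have := hK y hy s (hs.trans_le (min_le_left _ _))
      exact ⟨this.1, this.2.trans (le_max_left _ _)⟩
    · have := hK' y hy s (hs.trans_le (min_le_right _ _))
      exact ⟨this.1, this.2.trans (le_max_right _ _)⟩
  · intro y hy
    obtain ⟨ε, hε, K, hK⟩ := h y hy
    refine ⟨Metric.ball y (ε / 2), mem_nhdsWithin_of_mem_nhds
      (Metric.ball_mem_nhds y (by positivity)), ε / 2, by positivity, K, fun x hx s hs => ?_⟩
    rw [Metric.mem_ball, Real.dist_eq] at hx
    refine ⟨⟨ε / 2, by positivity, K, fun x' s' hx' hs' => hK x' s' ?_ ?_⟩,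
      (hK x s (by simp only; linarith) (by simp only; linarith)).2⟩
    · calc |x' - y| ≤ |x' - x| + |x - y| := abs_sub_le _ _ _
        _ < ε := by simp only at hx'; linarith
    · calc |s' - t| ≤ |s' - s| + |s - t| := abs_sub_le _ _ _
        _ < ε := by simp only at hs'; linarith

namespace Sol

variable {κ : ℝ} {Ω : Set (ℝ × ℝ)} {u v w g : ℝ → ℝ → ℝ}

theorem mem_nhds_y (h : Sol κ Ω u v w g) {y t : ℝ} (hp : (y, t) ∈ Ω) :
    ∀ᶠ x in 𝓝 y, (x, t) ∈ Ω :=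
  (Continuous.prodMk_left t).continuousAt.eventually_mem (h.isOpen.mem_nhds hp)

theorem cont_g_y (h : Sol κ Ω u v w g) {y t : ℝ} (hp : (y, t) ∈ Ω) :
    ContinuousAt (fun x => g x t) y := by
  have cu := (h.hv y t hp).continuousAt
  have cv := (h.hw y t hp).continuousAt
  have cw := h.cont_w y t hp
  have hc : ContinuousAt (fun x => w x t / (1 + v x t ^ 2) - x / 2 * v x t - κ / u x t + u x t / 2)
      y := by
    refine ContinuousAt.add (ContinuousAt.sub (ContinuousAt.sub (ContinuousAt.div cw ?_ ?_) ?_)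
      (ContinuousAt.div continuousAt_const cu (h.pos y t hp).ne')) ?_
    · fun_prop
    · positivity
    · fun_prop
    · fun_prop
  refine hc.congr ?_
  filter_upwards [h.mem_nhds_y hp] with x hx
  exact (h.pde x t hx).symm

theorem strip (h : Sol κ Ω u v w g) {a b c T : ℝ}
    (hb : ∀ y ∈ Icc a b, ∀ t ∈ Ioo c T, LocBdd Ω g (y, t)) : Strip a b c T u v w g where
  deriv_t y hy t ht := h.hg y t (hb y hy t ht).mem
  cont t ht y hy := (h.hv y t (hb y hy t ht).mem).continuousAt.continuousWithinAt
  cont_g t ht y hy := (h.cont_g_y (hb y hy t ht).mem).continuousWithinAt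
  bdd t ht := by
    obtain ⟨ε, hε, K, hK⟩ := exists_tube (t := t) fun y hy => hb y hy t ht
    exact ⟨ε, hε, K, fun s _ hst y hy => (hK y hy s hst).2⟩
  hv y hy t ht := h.hv y t (hb y hy t ht).mem
  hw y hy t ht := h.hw y t (hb y hy t ht).mem
  cont_w t ht y hy := (h.cont_w y t (hb y hy t ht).mem).continuousWithinAt

theorem continuousAt (h : Sol κ Ω u v w g) {y t : ℝ} (hp : LocBdd Ω g (y, t)) :
    ContinuousAt (fun p : ℝ × ℝ => u p.1 p.2) (y, t) := by
  obtain ⟨ε, hε, hb⟩ := Metric.isOpen_iff.1 (isOpen_locBdd Ω g) (y, t) hp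
  have hs := h.strip (a := y - ε / 2) (b := y + ε / 2) (c := t - ε / 2) (T := t + ε / 2)
    fun x hx s hs => hb (by
      rw [Metric.mem_ball, Prod.dist_eq, max_lt_iff, Real.dist_eq, Real.dist_eq, abs_lt, abs_lt]
      constructor <;> constructor <;> linarith [hx.1, hx.2, hs.1, hs.2])
  exact hs.continuousOn.continuousAt (prod_mem_nhds (Icc_mem_nhds (by linarith) (by linarith))
    (Ioo_mem_nhds (by linarith) (by linarith)))

theorem refl (h : Sol κ Ω u v w g) :
    Sol κ {p | (-p.1, p.2) ∈ Ω} (fun y t => u (-y) t) (fun y t => -v (-y) t)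
      (fun y t => w (-y) t) (fun y t => g (-y) t) where
  isOpen := h.isOpen.preimage (by fun_prop : Continuous fun p : ℝ × ℝ => (-p.1, p.2))
  κ_nonneg := h.κ_nonneg
  pos y t hp := h.pos (-y) t hp
  hv y t hp := ((h.hv (-y) t hp).comp y (hasDerivAt_neg y)).congr_deriv (by ring)
  hw y t hp := ((h.hw (-y) t hp).comp y (hasDerivAt_neg y)).neg.congr_deriv (by ring)
  hg y t hp := h.hg (-y) t hp
  cont_w y t hp := ContinuousAt.comp (g := fun x => w x t) (h.cont_w (-y) t hp)
    continuous_neg.continuousAt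
  cont_g y t hp := h.cont_g (-y) t hp
  pde y t hp := by rw [h.pde (-y) t hp]; ring

end Sol

variable {κ : ℝ} {Ω : Set (ℝ × ℝ)} {u v w g : ℝ → ℝ → ℝ}

theorem LocBdd.refl {Ω : Set (ℝ × ℝ)} {g : ℝ → ℝ → ℝ} {y t : ℝ} (h : LocBdd Ω g (-y, t)) :
    LocBdd {p | (-p.1, p.2) ∈ Ω} (fun y t => g (-y) t) (y, t) := by
  obtain ⟨ε, hε, K, hK⟩ := h
  refine ⟨ε, hε, K, fun x s hx hs => hK (-x) s ?_ hs⟩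
  simp only at hx ⊢
  rwa [← abs_neg, show -(-x - -y) = x - y by ring]

/-! ### Gaps of closed sets -/

theorem exists_gap {P : Set ℝ} (hP : IsClosed P) {α β y : ℝ} (hα : α ∈ P) (hβ : β ∈ P)
    (hαy : α ≤ y) (hyβ : y ≤ β) (hy : y ∉ P) :
    ∃ a ∈ P, ∃ b ∈ P, α ≤ a ∧ a < y ∧ y < b ∧ b ≤ β ∧ ∀ x ∈ Ioo a b, x ∉ P := by
  have hb1 : BddAbove (P ∩ Iic y) := ⟨y, fun x hx => hx.2⟩
  have hb2 : BddBelow (P ∩ Ici y) := ⟨y, fun x hx => hx.2⟩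
  have h1 := (hP.inter isClosed_Iic).csSup_mem ⟨α, hα, hαy⟩ hb1
  have h2 := (hP.inter isClosed_Ici).csInf_mem ⟨β, hβ, hyβ⟩ hb2
  refine ⟨_, h1.1, _, h2.1, le_csSup hb1 ⟨hα, hαy⟩, lt_of_le_of_ne h1.2 fun h => hy (h ▸ h1.1),
    lt_of_le_of_ne h2.2 fun h => hy (h ▸ h2.1), csInf_le hb2 ⟨hβ, hyβ⟩, fun x hx hxP => ?_⟩
  rcases le_total x y with h | h
  · exact (hx.1.trans_le (le_csSup hb1 ⟨hxP, h⟩)).false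
  · exact (hx.2.trans_le (csInf_le hb2 ⟨hxP, h⟩)).false

/-- Comparison with a grim reaper with a vertical asymptote at `X = a + s ε`, where
`X = y e^{-(t-c)/2}` and `s = ±1`. -/
theorem Sol.le_grim_aux (h : Sol κ Ω u v w g) {a m c T L s ε y t : ℝ} (hs : s * s = 1)
    (hε : 0 < ε) (hL : 0 ≤ L)
    (hgood : ∀ y ∈ Icc a m, ∀ t ∈ Ioo c T, LocBdd Ω g (y, t))
    (hbot : ∀ y ∈ Ioc a m, LocBdd Ω g (y, c) ∧ u y c ≤ L)
    (hlat : ∀ t ∈ Ioo c T, u a t ≤ L ∧ u m t ≤ L)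
    (hone : ∀ y ∈ Icc a m, ∀ t ∈ Ico c T, s * (y * Real.exp (-((t - c) / 2)) - a) - ε ≤ 1)
    (hy : y ∈ Icc a m) (ht : t ∈ Ioo c T)
    (hρ : 0 < s * (y * Real.exp (-((t - c) / 2)) - a) - ε) :
    u y t ≤ Real.exp ((t - c) / 2) *
      (L + (t - c) - Real.log (s * (y * Real.exp (-((t - c) / 2)) - a) - ε)) := by
  by_contra! hlt
  set ρ : ℝ → ℝ → ℝ := fun y t => s * (y * Real.exp (-((t - c) / 2)) - a) - ε with hρdef
  set V : ℝ → ℝ → ℝ := fun y t => Real.exp ((t - c) / 2) * (L + (t - c) - Real.log (ρ y t)) with hV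
  have hρc : Continuous fun p : ℝ × ℝ => ρ p.1 p.2 := by simp only [hρdef]; fun_prop
  set D : ℝ → Set (ℝ × ℝ) := fun r => (Icc a m ×ˢ Icc c t) ∩ {p | r ≤ ρ p.1 p.2} with hD
  have hDc : ∀ r, IsCompact (D r) := fun r =>
    (isCompact_Icc.prod isCompact_Icc).inter_right (isClosed_le (by fun_prop) hρc)
  have hDgood : ∀ r, 0 ≤ r → ∀ p ∈ D r, LocBdd Ω g p := by
    rintro r hr ⟨y', t'⟩ ⟨⟨hy', ht'⟩, hp⟩
    simp only [mem_ofPred_eq] at hy' ht' hp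
    rcases ht'.1.lt_or_eq with h1 | h1
    · exact hgood y' hy' t' ⟨h1, ht'.2.trans_lt ht.2⟩
    · rw [← h1]
      refine (hbot y' ⟨lt_of_le_of_ne hy'.1 fun h2 => ?_, hy'.2⟩).1
      simp only [hρdef, ← h1, ← h2, sub_self, zero_div, neg_zero, Real.exp_zero, mul_one,
        mul_zero] at hp
      linarith
  have hDu : ∀ r, 0 ≤ r → ContinuousOn (fun p : ℝ × ℝ => u p.1 p.2) (D r) :=
    fun r hr p hp => (h.continuousAt (hDgood r hr p hp)).continuousWithinAt
  obtain ⟨B, hB⟩ := (hDc 0).bddAbove_image (hDu 0 le_rfl)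
  have hB' : ∀ y' t', (y', t') ∈ D 0 → u y' t' ≤ |B| := fun y' t' hp =>
    (hB (mem_image_of_mem (fun p : ℝ × ℝ => u p.1 p.2) hp)).trans (le_abs_self B)
  set r := min (ρ y t) (Real.exp (-|B|)) with hr
  have hr0 : 0 < r := lt_min hρ (Real.exp_pos _)
  have hm0 : (y, t) ∈ D r := ⟨⟨hy, ht.1.le, le_rfl⟩, show r ≤ ρ y t from min_le_left _ _⟩
  set F : ℝ × ℝ → ℝ := fun p => (u p.1 p.2 - V p.1 p.2) * Real.exp (-p.2) with hF
  have hFc : ContinuousOn F (D r) := by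
    refine ContinuousOn.mul (ContinuousOn.sub (hDu r hr0.le) (ContinuousOn.mul (by fun_prop)
      (ContinuousOn.sub (by fun_prop) (ContinuousOn.log hρc.continuousOn fun p hp => ?_))))
      (by fun_prop)
    exact (hr0.trans_le hp.2).ne'
  obtain ⟨⟨y₁, t₁⟩, hm1, hmax⟩ := (hDc r).exists_isMaxOn ⟨_, hm0⟩ hFc
  replace hmax : ∀ p ∈ D r, F p ≤ F (y₁, t₁) := fun p hp => hmax hp
  obtain ⟨⟨hy1, ht1⟩, hρ1⟩ := hm1
  simp only [mem_ofPred_eq] at hy1 ht1 hρ1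
  have hmem1 : (y₁, t₁) ∈ D 0 := ⟨⟨hy1, ht1⟩, hr0.le.trans hρ1⟩
  have hρ1pos : 0 < ρ y₁ t₁ := hr0.trans_le hρ1
  have hpos : 0 < u y₁ t₁ - V y₁ t₁ := by
    have h1 : 0 < F (y, t) := mul_pos (by simp only [hV]; linarith) (Real.exp_pos _)
    exact pos_of_mul_pos_left (h1.trans_le (hmax _ hm0)) (Real.exp_pos _).le
  have hE : 1 ≤ Real.exp ((t₁ - c) / 2) := Real.one_le_exp (by linarith [ht1.1])
  have hlog : Real.log (ρ y₁ t₁) ≤ 0 :=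
    Real.log_nonpos hρ1pos.le (hone y₁ hy1 t₁ ⟨ht1.1, ht1.2.trans_lt ht.2⟩)
  have hVL : L ≤ V y₁ t₁ := by
    simp only [hV]; nlinarith [ht1.1]
  have hLlt : L < u y₁ t₁ := by linarith
  have hct : c < t₁ := by
    refine lt_of_le_of_ne ht1.1 fun h2 => ?_
    have hne : y₁ ≠ a := by
      intro h3
      simp only [hρdef, ← h2, h3, sub_self, zero_div, neg_zero, Real.exp_zero, mul_one,
        mul_zero] at hρ1pos
      linarith
    have := (hbot y₁ ⟨lt_of_le_of_ne hy1.1 hne.symm, hy1.2⟩).2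
    rw [h2] at this; linarith
  have htT : t₁ ∈ Ioo c T := ⟨hct, ht1.2.trans_lt ht.2⟩
  have hay : a < y₁ := lt_of_le_of_ne hy1.1 fun h2 => by
    have := (hlat t₁ htT).1; rw [h2] at this; linarith
  have hym : y₁ < m := lt_of_le_of_ne hy1.2 fun h2 => by
    have := (hlat t₁ htT).2; rw [← h2] at this; linarith
  have hρlt : r < ρ y₁ t₁ := by
    refine lt_of_le_of_ne hρ1 fun h2 => ?_
    have h3 : Real.log (ρ y₁ t₁) ≤ -|B| := by
      rw [← Real.log_exp (-|B|), ← h2]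
      exact Real.log_le_log hr0 (min_le_right _ _)
    have h4 := hB' y₁ t₁ hmem1
    have : |B| ≤ V y₁ t₁ := by simp only [hV]; nlinarith [ht1.1, abs_nonneg B]
    linarith
  have hΩ := (hDgood 0 le_rfl _ hmem1).mem
  -- spatial derivatives of the barrier
  have hρy : ∀ x, HasDerivAt (fun x => ρ x t₁) (s * Real.exp (-((t₁ - c) / 2))) x := fun x =>
    ((((hasDerivAt_id x).mul_const _).sub_const a).const_mul s).sub_const ε |>.congr_deriv (by
      simp)
  have hexp : Real.exp ((t₁ - c) / 2) * Real.exp (-((t₁ - c) / 2)) = 1 := by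
    rw [← Real.exp_add]; simp
  have hVy : ∀ x, 0 < ρ x t₁ → HasDerivAt (fun x => V x t₁) (-s / ρ x t₁) x := fun x hx =>
    ((((hρy x).log hx.ne').const_sub (L + (t₁ - c))).const_mul _).congr_deriv (by
      field_simp; linear_combination (-s) * hexp)
  have hVyy : HasDerivAt (fun x => -s / ρ x t₁)
      (Real.exp (-((t₁ - c) / 2)) / ρ y₁ t₁ ^ 2) y₁ :=
    ((hasDerivAt_const y₁ (-s)).div (hρy y₁) hρ1pos.ne').congr_deriv (by
      field_simp; linear_combination Real.exp (-((t₁ - c) / 2)) * hs)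
  have hev : ∀ᶠ x in 𝓝 y₁, x ∈ Ioo a m ∧ r < ρ x t₁ ∧ (x, t₁) ∈ Ω :=
    Filter.Eventually.and (p := fun x => x ∈ Ioo a m) (Ioo_mem_nhds hay hym)
      (((hρy y₁).continuousAt.eventually (lt_mem_nhds hρlt)).and (h.mem_nhds_y hΩ))
  have hlm : IsLocalMax (fun x => u x t₁ - V x t₁) y₁ := by
    filter_upwards [hev] with x hx
    exact le_of_mul_le_mul_right (hmax (x, t₁) ⟨⟨⟨hx.1.1.le, hx.1.2.le⟩, ht1⟩, hx.2.1.le⟩)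
      (Real.exp_pos _)
  have hd1 : ∀ᶠ x in 𝓝 y₁, HasDerivAt (fun x => u x t₁ - V x t₁) (v x t₁ - -s / ρ x t₁) x := by
    filter_upwards [hev] with x hx
    exact (h.hv x t₁ hx.2.2).sub (hVy x (hr0.trans hx.2.1))
  have hv0 := hlm.hasDerivAt_eq_zero hd1.self_of_nhds
  have hw0 := snd_deriv_nonpos hd1 ((h.hw y₁ t₁ hΩ).sub hVyy) hlm
  -- time derivative
  have hρt : HasDerivAt (fun r => ρ y₁ r)
      (-(s * y₁ * Real.exp (-((t₁ - c) / 2)) / 2)) t₁ :=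
    ((((((hasDerivAt_id t₁).sub_const c).div_const 2).neg.exp.const_mul y₁).sub_const
      a).const_mul s).sub_const ε |>.congr_deriv (by
      simp only [id_eq, Pi.neg_apply]; ring)
  have hVt : HasDerivAt (fun r => V y₁ r) (V y₁ t₁ / 2 + Real.exp ((t₁ - c) / 2) +
      y₁ / 2 * (s / ρ y₁ t₁)) t₁ :=
    ((((hasDerivAt_id t₁).sub_const c).div_const 2).exp.mul
      ((((hasDerivAt_id t₁).sub_const c).const_add L).sub (hρt.log hρ1pos.ne'))).congr_deriv (by
        simp only [hV, id_eq, Pi.sub_apply]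
        generalize Real.log (ρ y₁ t₁) = l
        generalize ρ y₁ t₁ = q at hρ1pos ⊢
        field_simp
        linear_combination y₁ * s * hexp)
  have hFt : HasDerivAt (fun r => (u y₁ r - V y₁ r) * Real.exp (-r))
      ((g y₁ t₁ - (V y₁ t₁ / 2 + Real.exp ((t₁ - c) / 2) + y₁ / 2 * (s / ρ y₁ t₁))) *
        Real.exp (-t₁) + (u y₁ t₁ - V y₁ t₁) * (-Real.exp (-t₁))) t₁ :=
    (((h.hg y₁ t₁ hΩ).sub hVt).mul ((hasDerivAt_id t₁).neg.exp)).congr_deriv (by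
      simp only [id_eq, Pi.neg_apply, Pi.sub_apply]; ring)
  have hevt : ∀ᶠ r' in 𝓝 t₁, r < ρ y₁ r' := hρt.continuousAt.eventually (lt_mem_nhds hρlt)
  obtain ⟨δ, hδ, hδ'⟩ := Metric.eventually_nhds_iff.1 hevt
  have hnn := deriv_nonneg_of_le_left hFt (y := max c (t₁ - δ)) (max_lt hct (by linarith))
    fun z hz => by
      have h1 := (le_max_left _ _).trans_lt hz.1
      have h2 := (le_max_right _ _).trans_lt hz.1
      exact hmax (y₁, z) ⟨⟨hy1, h1.le, hz.2.le.trans ht1.2⟩, (hδ' (by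
        rw [Real.dist_eq, abs_lt]; constructor <;> linarith [hz.2])).le⟩
  have hnn' : 0 ≤ g y₁ t₁ - (V y₁ t₁ / 2 + Real.exp ((t₁ - c) / 2) + y₁ / 2 * (s / ρ y₁ t₁))
      - (u y₁ t₁ - V y₁ t₁) := by
    refine nonneg_of_mul_nonneg_left (b := Real.exp (-t₁)) ?_ (Real.exp_pos _)
    linarith
  have hvv : v y₁ t₁ = -s / ρ y₁ t₁ := by linarith
  have hww : w y₁ t₁ / (1 + v y₁ t₁ ^ 2) ≤ 1 := by
    rw [div_le_one (by positivity), hvv]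
    have h1 : (-s / ρ y₁ t₁) ^ 2 = 1 / ρ y₁ t₁ ^ 2 := by
      rw [div_pow]; congr 1; linear_combination hs
    rw [h1]
    have h2 : Real.exp (-((t₁ - c) / 2)) ≤ 1 := Real.exp_le_one_iff.2 (by linarith)
    have h3 : Real.exp (-((t₁ - c) / 2)) / ρ y₁ t₁ ^ 2 ≤ 1 / ρ y₁ t₁ ^ 2 :=
      div_le_div_of_nonneg_right h2 (by positivity)
    linarith
  have hκ : 0 ≤ κ / u y₁ t₁ := div_nonneg h.κ_nonneg (h.pos _ _ hΩ).le
  rw [h.pde y₁ t₁ hΩ] at hnn'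
  have : y₁ / 2 * v y₁ t₁ = -(y₁ / 2 * (s / ρ y₁ t₁)) := by rw [hvv]; ring
  linarith

theorem Sol.le_grim (h : Sol κ Ω u v w g) {a m c T L y t : ℝ} (hL : 0 ≤ L)
    (hgood : ∀ y ∈ Icc a m, ∀ t ∈ Ioo c T, LocBdd Ω g (y, t))
    (hbot : ∀ y ∈ Ioc a m, LocBdd Ω g (y, c) ∧ u y c ≤ L)
    (hlat : ∀ t ∈ Ioo c T, u a t ≤ L ∧ u m t ≤ L)
    (hone : ∀ y ∈ Icc a m, ∀ t ∈ Ico c T, |y * Real.exp (-((t - c) / 2)) - a| ≤ 1)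
    (hy : y ∈ Icc a m) (ht : t ∈ Ioo c T) (hne : y * Real.exp (-((t - c) / 2)) - a ≠ 0) :
    u y t ≤ Real.exp ((t - c) / 2) *
      (L + (t - c) - Real.log (y * Real.exp (-((t - c) / 2)) - a)) := by
  obtain ⟨s, hs, hsX⟩ : ∃ s : ℝ, s * s = 1 ∧ ∀ x, s * x ≤ |x| ∧
      (x = y * Real.exp (-((t - c) / 2)) - a → s * x = |x|) := by
    rcases le_total 0 (y * Real.exp (-((t - c) / 2)) - a) with h0 | h0
    · exact ⟨1, by norm_num, fun x => ⟨by rw [one_mul]; exact le_abs_self x,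
        fun hx => by rw [one_mul, hx, abs_of_nonneg h0]⟩⟩
    · exact ⟨-1, by norm_num, fun x => ⟨by rw [neg_one_mul]; exact neg_le_abs x,
        fun hx => by rw [neg_one_mul, hx, abs_of_nonpos h0]⟩⟩
  have hX := (hsX _).2 rfl
  rw [← Real.log_abs, ← hX]
  set X := y * Real.exp (-((t - c) / 2)) - a
  have hpos : 0 < s * X := by rw [hX]; exact abs_pos.2 hne
  have hlim : Tendsto (fun ε => Real.exp ((t - c) / 2) * (L + (t - c) - Real.log (s * X - ε)))
      (𝓝[>] 0) (𝓝 (Real.exp ((t - c) / 2) * (L + (t - c) - Real.log (s * X - 0)))) := by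
    have : ContinuousAt (fun ε : ℝ =>
        Real.exp ((t - c) / 2) * (L + (t - c) - Real.log (s * X - ε))) 0 := by
      refine continuousAt_const.mul (continuousAt_const.sub (ContinuousAt.log (by fun_prop) ?_))
      simpa using hpos.ne'
    exact this.tendsto.mono_left nhdsWithin_le_nhds
  rw [sub_zero] at hlim
  refine ge_of_tendsto hlim ?_
  filter_upwards [Ioo_mem_nhdsGT hpos] with ε hε
  exact h.le_grim_aux hs hε.1 hL hgood hbot hlat (fun y' hy' t' ht' => by
    linarith [(hsX (y' * Real.exp (-((t' - c) / 2)) - a)).1, hone y' hy' t' ht', hε.1]) hy ht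
    (by linarith [hε.2])

/-! ### Positive parts of integrals -/

theorem integral_le_integral_max {a b y₁ y₂ : ℝ} {z : ℝ → ℝ} (hz : ContinuousOn z (Icc a b))
    (h1 : a ≤ y₁) (h12 : y₁ ≤ y₂) (h2 : y₂ ≤ b) :
    ∫ y in y₁..y₂, z y ≤ ∫ y in a..b, max (z y) 0 := by
  have hzm : ContinuousOn (fun y => max (z y) 0) (Icc a b) := hz.sup continuousOn_const
  have hab : a ≤ b := h1.trans (h12.trans h2)
  have hsub : Icc y₁ y₂ ⊆ Icc a b := Icc_subset_Icc h1 h2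
  calc ∫ y in y₁..y₂, z y ≤ ∫ y in y₁..y₂, max (z y) 0 :=
        intervalIntegral.integral_mono_on h12 ((hz.mono hsub).intervalIntegrable_of_Icc h12)
          ((hzm.mono hsub).intervalIntegrable_of_Icc h12) fun y _ => le_max_left _ _
    _ ≤ ∫ y in a..b, max (z y) 0 :=
        intervalIntegral.integral_mono_interval h1 h12 h2
          (Eventually.of_forall fun y => le_max_right _ _)
          (hzm.intervalIntegrable_of_Icc hab)

theorem tendsto_integral_max {a b M : ℝ} {z : ℝ → ℝ → ℝ} {l : Filter ℝ} [l.IsCountablyGenerated]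
    (hab : a ≤ b) (hz : ∀ᶠ s in l, ContinuousOn (fun y => z y s) (Icc a b))
    (hM : ∀ᶠ s in l, ∀ y ∈ Ioo a b, z y s ≤ M)
    (hlim : ∀ y ∈ Ioo a b, Tendsto (fun s => max (z y s) 0) l (𝓝 0)) :
    Tendsto (fun s => ∫ y in a..b, max (z y s) 0) l (𝓝 0) := by
  have hmem : ∀ᵐ y : ℝ, y ∈ uIoc a b → y ∈ Ioo a b := by
    have : ∀ᵐ y : ℝ, y ≠ b := by
      simpa using (Set.countable_singleton b).ae_notMem MeasureTheory.volume
    filter_upwards [this] with y hy hyb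
    rw [uIoc_of_le hab] at hyb
    exact ⟨hyb.1, lt_of_le_of_ne hyb.2 hy⟩
  have := intervalIntegral.tendsto_integral_filter_of_dominated_convergence (a := a) (b := b)
    (μ := MeasureTheory.volume) (l := l) (F := fun s y => max (z y s) 0) (f := fun _ => 0)
    (fun _ => |M|) ?_ ?_ ?_ ?_
  · simpa using this
  · filter_upwards [hz] with s hs
    exact (intervalIntegrable_iff.1
      ((hs.sup continuousOn_const).intervalIntegrable_of_Icc hab)).aestronglyMeasurable
  · filter_upwards [hM] with s hs
    filter_upwards [hmem] with y hy hyb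
    rw [Real.norm_eq_abs, abs_of_nonneg (le_max_right _ _)]
    exact max_le ((hs y (hy hyb)).trans (le_abs_self M)) (abs_nonneg M)
  · exact intervalIntegrable_const
  · filter_upwards [hmem] with y hy hyb
    exact hlim y (hy hyb)


/-- Near a corner `(a, c)` at which the solution may be unbounded, it has little area. -/
theorem Sol.corner_small (h : Sol κ Ω u v w g) {a m c T L : ℝ} (hL : 0 ≤ L)
    (hgood : ∀ y ∈ Icc a m, ∀ t ∈ Ioo c T, LocBdd Ω g (y, t))
    (hbot : ∀ y ∈ Ioc a m, LocBdd Ω g (y, c) ∧ u y c ≤ L)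
    (hlat : ∀ t ∈ Ioo c T, u a t ≤ L ∧ u m t ≤ L)
    (hone : ∀ y ∈ Icc a m, ∀ t ∈ Ico c T, |y * Real.exp (-((t - c) / 2)) - a| ≤ 1)
    {ε : ℝ} (hε : 0 < ε) :
    ∃ δ > 0, ∀ ε' ∈ Ioo 0 δ, a + ε' ≤ m → ∀ s ∈ Ioo c T, s < c + δ →
      ∫ y in a..(a + ε'), u y s ≤ ε := by
  set F : ℝ → ℝ := fun x => x * Real.log x - x with hF
  have hFc : Continuous F := Real.continuous_mul_log.sub continuous_id
  set R : ℝ × ℝ → ℝ := fun p => Real.exp ((p.2 - c) / 2) * ((L + (p.2 - c)) * p.1 -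
    (Real.exp (-((p.2 - c) / 2)))⁻¹ * (F (Real.exp (-((p.2 - c) / 2)) * (a + p.1) - a) -
      F (Real.exp (-((p.2 - c) / 2)) * a - a))) with hR
  have hRc : Continuous R := by
    simp only [hR]
    refine Continuous.mul (by fun_prop) (Continuous.sub (by fun_prop)
      (Continuous.mul ?_ (by fun_prop)))
    exact Continuous.inv₀ (by fun_prop) fun p => (Real.exp_pos _).ne'
  have hR0 : R (0, c) = 0 := by simp [hR]
  obtain ⟨δ, hδ, hb⟩ := Metric.continuous_iff.1 hRc (0, c) ε hε
  refine ⟨δ, hδ, fun ε' hε' hm s hs hsδ => ?_⟩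
  have hRs := hb (ε', s) (by
    rw [Prod.dist_eq, max_lt_iff, Real.dist_eq, Real.dist_eq, abs_lt, abs_lt]
    simp only [mem_Ioo] at hε' hs ⊢
    constructor <;> constructor <;> linarith [hε'.1, hε'.2, hs.1])
  rw [hR0, Real.dist_eq, sub_zero] at hRs
  refine le_trans ?_ ((le_abs_self _).trans hRs.le)
  set e := Real.exp (-((s - c) / 2)) with he
  have he0 : 0 < e := Real.exp_pos _
  have hle : a ≤ a + ε' := by linarith [hε'.1]
  have hu : IntervalIntegrable (fun y => u y s) MeasureTheory.volume a (a + ε') :=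
    ContinuousOn.intervalIntegrable_of_Icc hle fun y hy =>
      (h.hv y s (hgood y ⟨hy.1, hy.2.trans hm⟩ s hs).mem).continuousAt.continuousWithinAt
  have hli : IntervalIntegrable (fun y => Real.log (e * y - a)) MeasureTheory.volume
      a (a + ε') := by
    have := ((intervalIntegral.intervalIntegrable_log' (a := e * a - a)
      (b := e * (a + ε') - a)).comp_sub_right a).comp_mul_left (c := e)
    simpa [he0.ne'] using this
  have hInt : ∫ y in a..(a + ε'), Real.exp ((s - c) / 2) * (L + (s - c) - Real.log (e * y - a))
      = R (ε', s) := by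
    rw [intervalIntegral.integral_const_mul, intervalIntegral.integral_sub
      intervalIntegrable_const hli, intervalIntegral.integral_comp_mul_sub _ he0.ne', integral_log,
      intervalIntegral.integral_const]
    simp only [hR, hF, smul_eq_mul, ← he]
    ring
  rw [← hInt]
  refine intervalIntegral.integral_mono_ae_restrict hle hu
    ((intervalIntegrable_const.sub hli).const_mul _) ?_
  have hne : ∀ᵐ y ∂MeasureTheory.volume.restrict (Icc a (a + ε')), y ≠ a / e :=
    MeasureTheory.ae_restrict_of_ae (by
      simpa using (Set.countable_singleton (a / e)).ae_notMem MeasureTheory.volume)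
  filter_upwards [hne, MeasureTheory.ae_restrict_mem measurableSet_Icc] with y hy hym
  have := h.le_grim hL hgood hbot hlat hone (y := y) (t := s) ⟨hym.1, hym.2.trans hm⟩ hs
    (fun h0 => hy (by rw [eq_div_iff he0.ne']; linarith))
  rwa [mul_comm y, ← he] at this

/-- Simple bounds at a point. -/
def Tame (Ω : Set (ℝ × ℝ)) (u g : ℝ → ℝ → ℝ) (K y t : ℝ) : Prop :=
  (y, t) ∈ Ω ∧ |g y t| ≤ K ∧ K⁻¹ ≤ u y t ∧ u y t ≤ K

theorem Sol.abs_sub_le_of_tame (h : Sol κ Ω u v w g) {K y c T t : ℝ}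
    (ht : ∀ t ∈ Ico c T, Tame Ω u g K y t) (hT : t ∈ Ico c T) :
    |u y t - u y c| ≤ K * (t - c) := by
  have := (convex_Ico c T).norm_image_sub_le_of_norm_hasDerivWithin_le (f := fun s => u y s)
    (f' := fun s => g y s) (C := K) (x := c) (y := t)
    (fun s hs => (h.hg y s (ht s hs).1).hasDerivWithinAt) (fun s hs => (ht s hs).2.1)
    ⟨le_rfl, hT.1.trans_lt hT.2⟩ hT
  simpa [Real.norm_eq_abs, abs_of_nonneg (sub_nonneg.2 hT.1)] using this

theorem Sol.corner_small_of_tame (h : Sol κ Ω u v w g) {a b c T K : ℝ} (hab : a < b) (hcT : c < T)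
    (hgood : ∀ y ∈ Ico a b, ∀ t ∈ Ioo c T, LocBdd Ω g (y, t))
    (hbot : ∀ y ∈ Ioo a b, LocBdd Ω g (y, c)) (htame : ∀ y ∈ Ioo a b, Tame Ω u g K y c)
    (hlat : ∀ t ∈ Ioo c T, u a t ≤ K) {ε : ℝ} (hε : 0 < ε) :
    ∃ δ > 0, a + δ < b ∧ c + δ < T ∧ ∀ ε' ∈ Ioo 0 δ, ∀ s ∈ Ioo c (c + δ),
      ∫ y in a..(a + ε'), u y s ≤ ε := by
  set m := min ((a + b) / 2) (a + 1 / 4) with hm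
  have ham : a < m := lt_min (by linarith) (by linarith)
  have hmb : m < b := (min_le_left _ _).trans_lt (by linarith)
  have hm4 : m ≤ a + 1 / 4 := min_le_right _ _
  have hcont := (h.hg m c (hbot m ⟨ham, hmb⟩).mem).continuousAt
  obtain ⟨η, hη, hηb⟩ := Metric.continuousAt_iff.1 hcont 1 one_pos
  set T' := min T (c + min η (1 / (|a| + 1))) with hT'
  have hη' : 0 < min η (1 / (|a| + 1)) := lt_min hη (by positivity)
  have hT'T : T' ≤ T := min_le_left _ _
  have hT'c : c < T' := lt_min hcT (by linarith)
  have hK := (htame m ⟨ham, hmb⟩)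
  have hK0 : 0 ≤ K := (abs_nonneg _).trans hK.2.1
  obtain ⟨δ, hδ, hδb⟩ := h.corner_small (a := a) (m := m) (c := c) (T := T') (L := K + 1)
    (by linarith)
    (fun y hy t ht => hgood y ⟨hy.1, hy.2.trans_lt hmb⟩ t ⟨ht.1, ht.2.trans_le hT'T⟩)
    (fun y hy => ⟨hbot y ⟨hy.1, hy.2.trans_lt hmb⟩,
      (htame y ⟨hy.1, hy.2.trans_lt hmb⟩).2.2.2.trans (by linarith)⟩)
    (fun t ht => ⟨(hlat t ⟨ht.1, ht.2.trans_le hT'T⟩).trans (by linarith), by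
      have h1 : t < c + η := (ht.2.trans_le (min_le_right _ _)).trans_le
        (by linarith [min_le_left η (1 / (|a| + 1))])
      have := hηb (x := t) (by rw [Real.dist_eq, abs_lt]; constructor <;> linarith [ht.1])
      rw [Real.dist_eq, abs_lt] at this
      linarith [hK.2.2.2]⟩)
    (fun y hy t ht => by
      set σ := (t - c) / 2 with hσ
      have h1 : t < c + 1 / (|a| + 1) := (ht.2.trans_le (min_le_right _ _)).trans_le
        (by linarith [min_le_right η (1 / (|a| + 1))])
      have hσ0 : 0 ≤ σ := by linarith [ht.1]
      have h2 : (|a| + 1) * (t - c) ≤ 1 := by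
        rw [← le_div_iff₀' (by positivity)]; linarith
      have h3 : Real.exp (-σ) ≤ 1 := Real.exp_le_one_iff.2 (by linarith)
      have h4 : 1 - σ ≤ Real.exp (-σ) := by linarith [Real.add_one_le_exp (-σ)]
      have h5 := Real.exp_pos (-σ)
      have h6 : |y * Real.exp (-σ) - a| ≤
          |(y - a) * Real.exp (-σ)| + |a * (1 - Real.exp (-σ))| := by
        rw [show y * Real.exp (-σ) - a = (y - a) * Real.exp (-σ) - a * (1 - Real.exp (-σ)) by ring]
        exact abs_sub _ _
      rw [abs_of_nonneg (mul_nonneg (by linarith [hy.1]) h5.le), abs_mul,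
        abs_of_nonneg (by linarith : 0 ≤ 1 - Real.exp (-σ))] at h6
      have h7 : (y - a) * Real.exp (-σ) ≤ 1 / 4 := by nlinarith [hy.1, hy.2]
      have h8 : |a| * (1 - Real.exp (-σ)) ≤ |a| * σ :=
        mul_le_mul_of_nonneg_left (by linarith) (abs_nonneg a)
      have h9 : |a| * σ ≤ 1 / 2 := by
        rw [hσ]; nlinarith [abs_nonneg a, ht.1]
      linarith) hε
  refine ⟨min δ (min (m - a) (T' - c)) / 2, ?_, ?_, ?_, fun ε' hε' s hs => ?_⟩
  · exact half_pos (lt_min hδ (lt_min (by linarith) (by linarith)))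
  · have := (min_le_right δ (min (m - a) (T' - c))).trans (min_le_left _ _)
    linarith
  · have := (min_le_right δ (min (m - a) (T' - c))).trans (min_le_right _ _)
    linarith
  · have h0 : 0 < min δ (min (m - a) (T' - c)) := by linarith [hε'.1, hε'.2]
    have h1 := min_le_left δ (min (m - a) (T' - c))
    have h2 := (min_le_right δ (min (m - a) (T' - c))).trans (min_le_left _ _)
    have h3 := (min_le_right δ (min (m - a) (T' - c))).trans (min_le_right _ _)
    exact hδb ε' ⟨hε'.1, by linarith [hε'.2]⟩ (by linarith [hε'.2]) s
      ⟨hs.1, by linarith [hs.2]⟩ (by linarith [hs.2])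

/-- Upper bound for a solution on a rectangle all of whose possible singularities are the two
bottom corners. -/
theorem Sol.gap_upper (h : Sol κ Ω u v w g) {a b c T K : ℝ} (hab : a < b) (hK : 1 ≤ K)
    (hT1 : T - c ≤ 1)
    (hgood : ∀ y ∈ Icc a b, ∀ t ∈ Ioo c T, LocBdd Ω g (y, t))
    (hbot : ∀ y ∈ Ioo a b, LocBdd Ω g (y, c)) (htame : ∀ y ∈ Icc a b, Tame Ω u g K y c)
    (hlat : ∀ t ∈ Ioo c T, u a t ≤ u a c + K * (t - c) ∧ u b t ≤ u b c + K * (t - c))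
    {y t : ℝ} (hy : y ∈ Icc a b) (ht : t ∈ Ioo c T) :
    u y t ≤ u y c + 2 * (K + κ * K + 1) * (t - c) := by
  have hcT : c < T := ht.1.trans ht.2
  set C₁ := 2 * (K + κ * K + 1) with hC₁
  have hκK : 0 ≤ κ * K := mul_nonneg h.κ_nonneg (by linarith)
  have hma : a ∈ Icc a b := ⟨le_rfl, hab.le⟩
  have hmb : b ∈ Icc a b := ⟨hab.le, le_rfl⟩
  refine le_of_forall_pos_le_add fun ε₁' hε₁' => ?_
  set ε₁ := min ε₁' 1 with hε₁d
  have hε₁ : 0 < ε₁ := lt_min hε₁' one_pos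
  suffices u y t ≤ u y c + C₁ * (t - c) + ε₁ by linarith [min_le_left ε₁' 1]
  have hs := h.strip hgood
  have hU : Strip a b c T (fun y t => u y c + C₁ * (t - c) + ε₁) (fun y _ => v y c)
      (fun y _ => w y c) (fun _ _ => C₁) :=
    { deriv_t := fun y _ t _ => ((((hasDerivAt_id t).sub_const c).const_mul C₁).const_add
        (u y c)).add_const ε₁ |>.congr_deriv (by simp)
      cont := fun t _ => ContinuousOn.add (ContinuousOn.add (fun y hy =>
        (h.hv y c (htame y hy).1).continuousAt.continuousWithinAt) continuousOn_const)
          continuousOn_const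
      cont_g := fun t _ => continuousOn_const
      bdd := fun t _ => ⟨1, one_pos, |C₁|, fun _ _ _ _ _ => le_rfl⟩
      hv := fun y hy t _ => ((h.hv y c (htame y hy).1).add_const _).add_const _
      hw := fun y hy t _ => h.hw y c (htame y hy).1
      cont_w := fun t _ y hy => (h.cont_w y c (htame y hy).1).continuousWithinAt }
  have hCK : K ≤ C₁ := by rw [hC₁]; linarith
  refine area_comparison hab hs hU ?_ ?_ ?_ ?_ y hy t ht
  · intro y hy t ht
    have h1 := h.pde y t (hgood y hy t ht).mem
    have h2 := h.pde y c (htame y hy).1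
    have h3 : 0 ≤ κ / u y t := div_nonneg h.κ_nonneg (h.pos _ _ (hgood y hy t ht).mem).le
    have h4 : κ / u y c ≤ κ * K := by
      have hp := h.pos y c (htame y hy).1
      rw [div_eq_mul_inv]
      refine mul_le_mul_of_nonneg_left ?_ h.κ_nonneg
      exact inv_le_of_inv_le₀ (by linarith) (htame y hy).2.2.1
    have h5 := (abs_le.1 (htame y hy).2.1).2
    have h6 : C₁ * (t - c) ≤ C₁ * 1 :=
      mul_le_mul_of_nonneg_left (by linarith [ht.2]) (by linarith)
    have h7 : ε₁ ≤ 1 := min_le_right _ _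
    linarith
  · intro t ht
    have : K * (t - c) ≤ C₁ * (t - c) := mul_le_mul_of_nonneg_right hCK (by linarith [ht.1])
    linarith [(hlat t ht).1]
  · intro t ht
    have : K * (t - c) ≤ C₁ * (t - c) := mul_le_mul_of_nonneg_right hCK (by linarith [ht.1])
    linarith [(hlat t ht).2]
  intro ε hε δ hδ
  have hlatK : ∀ y ∈ Icc a b, ∀ t ∈ Ioo c T, u y t ≤ u y c + K * (t - c) → u y t ≤ 2 * K := by
    intro y hy t ht hle
    have : K * (t - c) ≤ K * 1 := mul_le_mul_of_nonneg_left (by linarith [ht.2]) (by linarith)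
    linarith [(htame y hy).2.2.2]
  have htame2 : ∀ y ∈ Icc a b, Tame Ω u g (2 * K) y c := fun y hy => by
    obtain ⟨h1, h2, h3, h4⟩ := htame y hy
    refine ⟨h1, h2.trans (by linarith), le_trans ?_ h3, h4.trans (by linarith)⟩
    exact inv_anti₀ (by linarith) (by linarith)
  obtain ⟨δ₁, hδ₁, hδb₁, hδT₁, hI₁⟩ := h.corner_small_of_tame hab hcT
    (fun y hy t ht => hgood y ⟨hy.1, hy.2.le⟩ t ht) hbot
    (fun y hy => htame2 y ⟨hy.1.le, hy.2.le⟩)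
    (fun t ht => hlatK a hma t ht (hlat t ht).1) (half_pos hε)
  obtain ⟨δ₂, hδ₂, hδb₂, hδT₂, hI₂⟩ := h.refl.corner_small_of_tame (a := -b) (b := -a) (K := 2 * K)
    (by linarith) hcT
    (fun y hy t ht => (hgood (-y) ⟨by linarith [hy.2], by linarith [hy.1]⟩ t ht).refl)
    (fun y hy => (hbot (-y) ⟨by linarith [hy.2], by linarith [hy.1]⟩).refl)
    (fun y hy => htame2 (-y) ⟨by linarith [hy.2], by linarith [hy.1]⟩)
    (fun t ht => by simpa using hlatK b hmb t ht (hlat t ht).2) (half_pos hε)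
  set ε' := min (min δ₁ δ₂) (b - a) / 2 with hε'd
  have hε'1 := (min_le_left (min δ₁ δ₂) (b - a)).trans (min_le_left _ _)
  have hε'2 := (min_le_left (min δ₁ δ₂) (b - a)).trans (min_le_right _ _)
  have hε'3 := min_le_right (min δ₁ δ₂) (b - a)
  have hε'0 : 0 < min (min δ₁ δ₂) (b - a) := lt_min (lt_min hδ₁ hδ₂) (by linarith)
  obtain ⟨η, hη, M, hM⟩ := exists_tube (Ω := Ω) (g := g) (a := a + ε') (b := b - ε') (t := c)
    fun y hy => hbot y ⟨by linarith [hy.1], by linarith [hy.2]⟩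
  set s := c + min (min (min δ δ₁) δ₂) (min η (ε₁ / (|M| + 1))) / 2 with hsd
  set μ := min (min (min δ δ₁) δ₂) (min η (ε₁ / (|M| + 1))) with hμ
  have hμ0 : 0 < μ := lt_min (lt_min (lt_min hδ hδ₁) hδ₂) (lt_min hη (by positivity))
  have hμ1 : μ ≤ δ := (min_le_left _ _).trans ((min_le_left _ _).trans (min_le_left _ _))
  have hμ2 : μ ≤ δ₁ := (min_le_left _ _).trans ((min_le_left _ _).trans (min_le_right _ _))
  have hμ3 : μ ≤ δ₂ := (min_le_left _ _).trans (min_le_right _ _)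
  have hμ4 : μ ≤ η := (min_le_right _ _).trans (min_le_left _ _)
  have hμ5 : μ ≤ ε₁ / (|M| + 1) := (min_le_right _ _).trans (min_le_right _ _)
  have hsT : s ∈ Ioo c T := ⟨by linarith, by linarith⟩
  refine ⟨s, hsT, by linarith, fun y₁ y₂ h1 h12 h2 => ?_⟩
  have hz := (hs.toTStrip.sub hU.toTStrip).cont s hsT
  refine (integral_le_integral_max hz h1 h12 h2).trans ?_
  set f : ℝ → ℝ := fun y => max (u y s - (u y c + C₁ * (s - c) + ε₁)) 0 with hf
  have hfc : ContinuousOn f (Icc a b) := hz.sup continuousOn_const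
  have hfi : ∀ p q, a ≤ p → p ≤ q → q ≤ b → IntervalIntegrable f MeasureTheory.volume p q :=
    fun p q hp hpq hq => (hfc.mono (Icc_subset_Icc hp hq)).intervalIntegrable_of_Icc hpq
  have hui : ∀ p q, a ≤ p → p ≤ q → q ≤ b →
      IntervalIntegrable (fun y => u y s) MeasureTheory.volume p q :=
    fun p q hp hpq hq => ((hs.cont s hsT).mono (Icc_subset_Icc hp hq)).intervalIntegrable_of_Icc hpq
  have hfu : ∀ y ∈ Icc a b, f y ≤ u y s := fun y hy => by
    have hp := h.pos y c (htame y hy).1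
    have hp' := h.pos y s (hgood y hy s hsT).mem
    refine max_le ?_ hp'.le
    have : 0 ≤ C₁ * (s - c) := mul_nonneg (by linarith) (by linarith [hsT.1])
    linarith
  have e1 : ∫ y in a..(a + ε'), f y ≤ ε / 2 :=
    (intervalIntegral.integral_mono_on (by linarith) (hfi _ _ le_rfl (by linarith) (by linarith))
      (hui _ _ le_rfl (by linarith) (by linarith))
      fun y hy => hfu y ⟨hy.1, by linarith [hy.2]⟩).trans
      (hI₁ ε' ⟨by linarith, by linarith⟩ s ⟨hsT.1, by linarith⟩)
  have e3 : ∫ y in (b - ε')..b, f y ≤ ε / 2 := by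
    refine (intervalIntegral.integral_mono_on (by linarith)
      (hfi _ _ (by linarith) (by linarith) le_rfl)
      (hui _ _ (by linarith) (by linarith) le_rfl)
      fun y hy => hfu y ⟨by linarith [hy.1], hy.2⟩).trans ?_
    have := hI₂ ε' ⟨by linarith, by linarith⟩ s ⟨hsT.1, by linarith⟩
    rw [intervalIntegral.integral_comp_neg (fun y => u y s), neg_neg, neg_add, neg_neg] at this
    exact this
  have e2 : ∫ y in (a + ε')..(b - ε'), f y = 0 := by
    rw [← intervalIntegral.integral_zero (a := a + ε') (b := b - ε') (μ := MeasureTheory.volume)]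
    refine intervalIntegral.integral_congr fun y hy => ?_
    rw [uIcc_of_le (by linarith)] at hy
    refine max_eq_right ?_
    have hb := hM y hy
    have := (convex_Icc c s).norm_image_sub_le_of_norm_hasDerivWithin_le (f := fun s => u y s)
      (f' := fun s => g y s) (C := M) (x := c) (y := s)
      (fun r hr => (h.hg y r (hb r (by rw [abs_lt]; constructor <;>
        linarith [hr.1, hr.2])).1.mem).hasDerivWithinAt)
      (fun r hr => (hb r (by rw [abs_lt]; constructor <;> linarith [hr.1, hr.2])).2)
      ⟨le_rfl, hsT.1.le⟩ ⟨hsT.1.le, le_rfl⟩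
    simp only [Real.norm_eq_abs] at this
    have h3 : M * |s - c| ≤ ε₁ := by
      rw [abs_of_pos (by linarith [hsT.1])]
      have : (|M| + 1) * (s - c) ≤ ε₁ := by
        rw [← le_div_iff₀' (by positivity)]; linarith
      nlinarith [le_abs_self M, hsT.1]
    have h4 := (abs_le.1 this).2
    have : 0 ≤ C₁ * (s - c) := mul_nonneg (by linarith) (by linarith [hsT.1])
    linarith
  rw [← intervalIntegral.integral_add_adjacent_intervals
    (hfi a (a + ε') le_rfl (by linarith) (by linarith))
    (hfi (a + ε') b (by linarith) (by linarith) le_rfl),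
    ← intervalIntegral.integral_add_adjacent_intervals
    (hfi (a + ε') (b - ε') (by linarith) (by linarith) (by linarith))
    (hfi (b - ε') b (by linarith) (by linarith) le_rfl), e2]
  linarith

theorem isClosed_bad (Ω : Set (ℝ × ℝ)) (g : ℝ → ℝ → ℝ) (α β c : ℝ) :
    IsClosed ({y | y ∈ Icc α β ∧ ¬ LocBdd Ω g (y, c)} ∪ {α, β}) := by
  refine IsClosed.union (isClosed_Icc.inter ?_) (Set.toFinite _).isClosed
  exact ((isOpen_locBdd Ω g).preimage (Continuous.prodMk_left c)).isClosed_compl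

/-- Upper bound on a strip. -/
theorem Sol.upper (h : Sol κ Ω u v w g) {α β c T K : ℝ} (hK : 1 ≤ K)
    (hT1 : T - c ≤ 1)
    (hgood : ∀ y ∈ Icc α β, ∀ t ∈ Ioo c T, LocBdd Ω g (y, t))
    (htame : ∀ y ∈ Icc α β, Tame Ω u g K y c)
    (hlat : ∀ t ∈ Ico c T, Tame Ω u g K α t ∧ Tame Ω u g K β t)
    (hbad : ∀ y ∈ Icc α β, ¬ LocBdd Ω g (y, c) → ∀ t ∈ Ico c T, Tame Ω u g K y t)
    {y t : ℝ} (hy : y ∈ Icc α β) (ht : t ∈ Ioo c T) :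
    u y t ≤ u y c + 2 * (K + κ * K + 1) * (t - c) := by
  have hκK : 0 ≤ κ * K := mul_nonneg h.κ_nonneg (by linarith)
  set P := {y | y ∈ Icc α β ∧ ¬ LocBdd Ω g (y, c)} ∪ {α, β} with hP
  have hPt : ∀ y ∈ P, ∀ t ∈ Ico c T, Tame Ω u g K y t := by
    rintro y (hy | hy | hy) t ht
    · exact hbad y hy.1 hy.2 t ht
    · rw [hy]; exact (hlat t ht).1
    · rw [hy]; exact (hlat t ht).2
  have hPu : ∀ y ∈ P, ∀ t ∈ Ioo c T, u y t ≤ u y c + K * (t - c) := fun y hy t ht => by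
    have := h.abs_sub_le_of_tame (hPt y hy) ⟨ht.1.le, ht.2⟩
    linarith [(abs_le.1 this).2]
  by_cases hyP : y ∈ P
  · have := hPu y hyP t ht
    have h2 : K * (t - c) ≤ 2 * (K + κ * K + 1) * (t - c) :=
      mul_le_mul_of_nonneg_right (by linarith) (by linarith [ht.1])
    linarith
  · obtain ⟨a, ha, b, hb, h1, h2, h3, h4, h5⟩ := exists_gap (isClosed_bad Ω g α β c)
      (Or.inr (Or.inl rfl)) (Or.inr (Or.inr rfl)) hy.1 hy.2 hyP
    refine h.gap_upper (a := a) (b := b) (T := T) (h2.trans h3) hK hT1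
      (fun x hx => hgood x ⟨h1.trans hx.1, hx.2.trans h4⟩) (fun x hx => ?_)
      (fun x hx => htame x ⟨h1.trans hx.1, hx.2.trans h4⟩)
      (fun s hs => ⟨hPu a ha s hs, hPu b hb s hs⟩) ⟨h2.le, h3.le⟩ ht
    by_contra hn
    exact h5 x hx (Or.inl ⟨⟨h1.trans hx.1.le, hx.2.le.trans h4⟩, hn⟩)

theorem integral_nonpos_of_forall_Icc {a b : ℝ} {f : ℝ → ℝ} (hab : a ≤ b)
    (hf : ∀ y ∈ Icc a b, f y ≤ 0) :
    ∫ y in a..b, f y ≤ 0 := by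
  have := intervalIntegral.integral_nonneg (f := fun y => -f y) (μ := MeasureTheory.volume) hab
    fun y hy => neg_nonneg.2 (hf y hy)
  rw [intervalIntegral.integral_neg] at this
  linarith

/-- One-sided slope bound at a tame vertical line above a possibly singular point. -/
theorem Sol.slope_bound (h : Sol κ Ω u v w g) {α a c T K C₁ : ℝ} (hαa : α < a) (hcT : c < T)
    (hC₁ : 0 ≤ C₁) (hK : 0 ≤ K)
    (hgood : ∀ y ∈ Icc α a, ∀ t ∈ Ioo c T, LocBdd Ω g (y, t))
    (hup : ∀ y ∈ Icc α a, ∀ t ∈ Ioo c T, u y t ≤ u y c + C₁ * (t - c))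
    (hside : ∀ t ∈ Ico c T, Tame Ω u g K a t) :
    ∃ K' > 0, ∃ T' ∈ Ioc c T, ∀ t ∈ Ioo c T', -K' ≤ v a t := by
  have hac := hside c ⟨le_rfl, hcT⟩
  obtain ⟨k₀, hk₀⟩ : ∃ k₀, k₀ = |v a c| + 1 := ⟨_, rfl⟩
  have hk₀1 : 1 ≤ k₀ := by linarith [abs_nonneg (v a c)]
  obtain ⟨K', hK'⟩ : ∃ K', K' = 2 * k₀ + 2 := ⟨_, rfl⟩
  obtain ⟨N, hN⟩ : ∃ N, N = (1 + K' ^ 2) * (K + (|a| + 1) * K' / 2 + (K + 1 + K') / 2) + K' :=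
    ⟨_, rfl⟩
  have hK'0 : 0 < K' := by linarith
  have hN0 : K' ≤ N := by
    have : 0 ≤ (1 + K' ^ 2) * (K + (|a| + 1) * K' / 2 + (K + 1 + K') / 2) := by positivity
    linarith
  have hNpos : 0 < N := by linarith
  -- the initial slope
  obtain ⟨η₀, hη₀, hsl⟩ : ∃ η₀ > 0, ∀ y, |y - a| < η₀ → y ≤ a → u y c ≤ u a c + k₀ * (a - y) := by
    have h1 := (hasDerivAt_iff_tendsto_slope.1 (h.hv a c hac.1)).eventually
      (lt_mem_nhds (show -k₀ < v a c by linarith [neg_abs_le (v a c)]))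
    rw [eventually_nhdsWithin_iff] at h1
    obtain ⟨η₀, hη₀, hb⟩ := Metric.eventually_nhds_iff.1 h1
    refine ⟨η₀, hη₀, fun y hy hya => ?_⟩
    rcases hya.eq_or_lt with rfl | hlt
    · simp
    · have := hb (y := y) hy (ne_of_lt hlt)
      rw [slope_def_field, lt_div_iff_of_neg (by linarith)] at this
      linarith
  obtain ⟨η, hη⟩ : ∃ η, η = min (min (a - α) (η₀ / 2)) (K' / (2 * N)) := ⟨_, rfl⟩
  have hη0 : 0 < η := hη ▸ lt_min (lt_min (by linarith) (by linarith)) (by positivity)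
  have hη1 : η ≤ a - α := hη ▸ (min_le_left _ _).trans (min_le_left _ _)
  have hη2 : η ≤ η₀ / 2 := hη ▸ (min_le_left _ _).trans (min_le_right _ _)
  have hη3 : N * η ≤ K' / 2 := by
    have : η ≤ K' / (2 * N) := hη ▸ min_le_right _ _
    rw [le_div_iff₀ (by positivity)] at this; linarith
  have hη4 : η ≤ 1 := by nlinarith
  have hsl' : ∀ y ∈ Icc (a - η) a, u y c ≤ u a c + k₀ * (a - y) := fun y hy =>
    hsl y (by rw [abs_lt]; constructor <;> linarith [hy.1, hy.2]) hy.2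
  obtain ⟨T', hT'⟩ : ∃ T', T' = min T (c + η / (C₁ + K + 1)) := ⟨_, rfl⟩
  have hTT : T' ≤ T := hT' ▸ min_le_left _ _
  have hcT' : c < T' := hT' ▸ lt_min hcT (by linarith [show 0 < η / (C₁ + K + 1) by positivity])
  have hT'1 : ∀ t < T', (C₁ + K + 1) * (t - c) < η := fun t ht => by
    rw [← lt_div_iff₀' (by positivity)]
    linarith [hT' ▸ min_le_right T (c + η / (C₁ + K + 1))]
  have ham : ∀ t ∈ Ioo c T', |u a t - u a c| ≤ K * (t - c) := fun t ht =>
    h.abs_sub_le_of_tame hside ⟨ht.1.le, ht.2.trans_le hTT⟩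
  have key : ∀ ε > 0, ε ≤ 1 → ∀ y ∈ Icc (a - η) a, ∀ t ∈ Ioo c T',
      u y t ≤ u a t + ε + K' * (a - y) - N * (a - y) ^ 2 := by
    intro ε hε hε1
    have hs := (h.strip hgood).mono (a' := a - η) (b' := a) (T' := T') (by linarith) le_rfl
      le_rfl hTT
    have hma : a ∈ Icc α a := ⟨hαa.le, le_rfl⟩
    have hU : Strip (a - η) a c T' (fun y t => u a t + ε + K' * (a - y) - N * (a - y) ^ 2)
        (fun y _ => -K' + 2 * N * (a - y)) (fun _ _ => -(2 * N)) (fun _ t => g a t) :=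
      { deriv_t := fun y _ t ht => (((h.hg a t
          (hgood a hma t ⟨ht.1, ht.2.trans_le hTT⟩).mem).add_const
          ε).add_const _).sub_const _
        cont := fun t _ => by fun_prop
        cont_g := fun t _ => continuousOn_const
        bdd := fun t _ => ⟨1, one_pos, K, fun s hs _ _ _ =>
          (hside s ⟨hs.1.le, hs.2.trans_le hTT⟩).2.1⟩
        hv := fun y hy t _ => ((((hasDerivAt_id y).const_sub a).const_mul K').const_add
          (u a t + ε)).sub ((((hasDerivAt_id y).const_sub a).pow 2).const_mul N) |>.congr_deriv (by
            simp only [id_eq]; push_cast; ring)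
        hw := fun y hy t _ => (((hasDerivAt_id y).const_sub a).const_mul (2 * N)).const_add
          (-K') |>.congr_deriv (by ring)
        cont_w := fun t _ => continuousOn_const }
    refine area_comparison (by linarith) hs hU ?_ ?_ ?_ ?_
    · intro y hy t ht
      have ht' : t ∈ Ioo c T := ⟨ht.1, ht.2.trans_le hTT⟩
      have hyα : y ∈ Icc α a := ⟨by linarith [hy.1], hy.2⟩
      have h1 := h.pde y t (hgood y hyα t ht').mem
      have h3 : 0 ≤ κ / u y t := div_nonneg h.κ_nonneg (h.pos _ _ (hgood y hyα t ht').mem).le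
      have hta := hside t ⟨ht'.1.le, ht'.2⟩
      have hd0 : 0 ≤ a - y := by linarith [hy.2]
      have hd1 : a - y ≤ η := by linarith [hy.1]
      obtain ⟨V, hV⟩ : ∃ V, V = -K' + 2 * N * (a - y) := ⟨_, rfl⟩
      have hV1 : |V| ≤ K' := by rw [abs_le]; constructor <;> nlinarith
      have hVV : 1 + V ^ 2 ≤ 1 + K' ^ 2 := by
        have := sq_abs V; nlinarith [abs_nonneg V]
      have h4 : -(2 * N) / (1 + V ^ 2) ≤ -(K + (|a| + 1) * K' / 2 + (K + 1 + K') / 2) := by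
        rw [div_le_iff₀ (by positivity)]
        have : (1 + V ^ 2) * (K + (|a| + 1) * K' / 2 + (K + 1 + K') / 2) ≤ N := by
          have := mul_le_mul_of_nonneg_right hVV
            (show 0 ≤ K + (|a| + 1) * K' / 2 + (K + 1 + K') / 2 by positivity)
          linarith
        linarith
      have hya : |y| ≤ |a| + 1 := by
        have := abs_sub_abs_le_abs_sub y a
        have h' : |y - a| ≤ 1 := by rw [abs_le]; constructor <;> linarith
        linarith
      have h5 : -(y / 2 * V) ≤ (|a| + 1) * K' / 2 := by
        have h6 := neg_abs_le (y * V)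
        rw [abs_mul] at h6
        have := mul_le_mul hya hV1 (abs_nonneg _) (by positivity)
        linarith
      have h7 : u a t + ε + K' * (a - y) - N * (a - y) ^ 2 ≤ K + 1 + K' := by
        have h8 := hta.2.2.2
        have h9 : K' * (a - y) ≤ K' * 1 := mul_le_mul_of_nonneg_left (by linarith) (by linarith)
        have h10 : 0 ≤ N * (a - y) ^ 2 := by positivity
        linarith
      have h11 := (abs_le.1 hta.2.1).1
      simp only [← hV]
      linarith
    · intro t ht
      have h1 := hup (a - η) ⟨by linarith, by linarith⟩ t ⟨ht.1, ht.2.trans_le hTT⟩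
      have h2 := hsl' (a - η) ⟨le_rfl, by linarith⟩
      have h3 := (abs_le.1 (ham t ht)).1
      have h4 := hT'1 t ht.2
      rw [show a - (a - η) = η by ring] at h2 ⊢
      have h5 : N * η ^ 2 ≤ K' / 2 * η := by
        rw [pow_two, ← mul_assoc]; exact mul_le_mul_of_nonneg_right hη3 hη0.le
      have h6 : K' / 2 * η = k₀ * η + η := by rw [hK']; ring
      linarith [ht.1]
    · intro t ht
      simp only [sub_self]; linarith
    · intro ε₂ hε₂ δ hδ
      obtain ⟨μ, hμ⟩ : ∃ μ, μ = min (min δ (T' - c)) (ε / (C₁ + K + 1)) := ⟨_, rfl⟩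
      have hμ0 : 0 < μ := hμ ▸ lt_min (lt_min hδ (by linarith)) (by positivity)
      have hμ1 : μ ≤ δ := hμ ▸ (min_le_left _ _).trans (min_le_left _ _)
      have hμ2 : μ ≤ T' - c := hμ ▸ (min_le_left _ _).trans (min_le_right _ _)
      have hμ3 : (C₁ + K + 1) * μ ≤ ε := by
        rw [← le_div_iff₀' (by positivity)]; exact hμ ▸ min_le_right _ _
      have hsm : c + μ / 2 ∈ Ioo c T' := ⟨by linarith, by linarith⟩
      refine ⟨c + μ / 2, hsm, by linarith, fun y₁ y₂ h1 h12 h2 => le_trans ?_ hε₂.le⟩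
      refine integral_nonpos_of_forall_Icc h12 fun y hy => ?_
      have hyη : y ∈ Icc (a - η) a := ⟨h1.trans hy.1, hy.2.trans h2⟩
      have e1 := hup y ⟨by linarith [hyη.1], hyη.2⟩ _ ⟨hsm.1, hsm.2.trans_le hTT⟩
      have e2 := hsl' y hyη
      have e3 := (abs_le.1 (ham _ hsm)).1
      have hd0 : 0 ≤ a - y := by linarith [hyη.2]
      have hd1 : a - y ≤ η := by linarith [hyη.1]
      have e4 : N * (a - y) ^ 2 ≤ K' / 2 * (a - y) := by
        rw [pow_two, ← mul_assoc]
        exact mul_le_mul_of_nonneg_right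
          ((mul_le_mul_of_nonneg_left hd1 hNpos.le).trans hη3) hd0
      have e5 : k₀ * (a - y) ≤ K' / 2 * (a - y) := mul_le_mul_of_nonneg_right (by linarith) hd0
      have e6 : C₁ * (c + μ / 2 - c) + K * (c + μ / 2 - c) ≤ ε := by linarith
      linarith
  refine ⟨K', by linarith, T', ⟨hcT', hTT⟩, fun t ht => ?_⟩
  have hle : ∀ y ∈ Icc (a - η) a, u y t ≤ u a t + K' * (a - y) := by
    intro y hy
    refine le_of_forall_pos_le_add fun ε hε => ?_
    have := key (min ε 1) (lt_min hε one_pos) (min_le_right _ _) y hy t ht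
    have h2 : 0 ≤ N * (a - y) ^ 2 := by positivity
    linarith [min_le_left ε 1]
  have hd := ((h.hv a t (hside t ⟨ht.1.le, ht.2.trans_le hTT⟩).1).add
    ((hasDerivAt_id a).const_mul K'))
  have := deriv_nonneg_of_le_left hd (y := a - η) (by linarith) fun y hy => by
    have := hle y ⟨hy.1.le, hy.2.le⟩
    simp only [Pi.add_apply, id_eq]; linarith
  linarith

theorem exists_lt_left {f : ℝ → ℝ} {d x : ℝ} (h : HasDerivAt f d x) (hd : 0 < d) :
    ∃ η > 0, ∀ y ∈ Ioo (x - η) x, f y < f x := by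
  have h1 := (hasDerivAt_iff_tendsto_slope.1 h).eventually (lt_mem_nhds hd)
  rw [eventually_nhdsWithin_iff] at h1
  obtain ⟨η, hη, hb⟩ := Metric.eventually_nhds_iff.1 h1
  refine ⟨η, hη, fun y hy => ?_⟩
  have := hb (y := y) (by rw [Real.dist_eq, abs_lt]; constructor <;> linarith [hy.1, hy.2])
    (ne_of_lt hy.2)
  rw [slope_def_field, lt_div_iff_of_neg (by linarith [hy.2])] at this
  linarith

/-- At a spatial minimum, `u²` decreases at a rate less than `2(κ+1)`. -/
theorem Sol.deriv_sq_at_min (h : Sol κ Ω u v w g) {q s : ℝ} (hΩ : (q, s) ∈ Ω)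
    (hmin : IsLocalMin (fun y => u y s) q) : 0 < 2 * u q s * g q s + 2 * (κ + 1) := by
  have hev : ∀ᶠ y in 𝓝 q, HasDerivAt (fun y => u y s) (v y s) y := by
    filter_upwards [h.mem_nhds_y hΩ] with y hy using h.hv y s hy
  have hv0 := hmin.hasDerivAt_eq_zero hev.self_of_nhds
  have hw0 := snd_deriv_nonneg hev (h.hw q s hΩ) hmin
  have hp := h.pos q s hΩ
  rw [h.pde q s hΩ, hv0]
  have : 2 * u q s * (w q s / (1 + 0 ^ 2) - q / 2 * 0 - κ / u q s + u q s / 2) + 2 * (κ + 1)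
      = 2 * (u q s * w q s) + u q s ^ 2 + 2 := by
    field_simp; ring
  rw [this]
  have := mul_nonneg hp.le hw0
  positivity

theorem Sol.hasDerivAt_sq_sub (h : Sol κ Ω u v w g) {q s c r : ℝ} (hΩ : (q, s) ∈ Ω) :
    HasDerivAt (fun t => u q t ^ 2 - (r ^ 2 - 2 * (κ + 1) * (t - c)))
      (2 * u q s * g q s + 2 * (κ + 1)) s :=
  ((h.hg q s hΩ).pow 2).sub ((((hasDerivAt_id s).sub_const c).const_mul
    (2 * (κ + 1))).const_sub (r ^ 2)) |>.congr_deriv (by push_cast; ring)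

/-- The lower bound for `u²` persists. -/
theorem Sol.sq_lower_persist (h : Sol κ Ω u v w g) {a b c s r y t : ℝ} (hcs : c ≤ s) (hst : s ≤ t)
    (hr : 0 ≤ r) (hgood : ∀ y ∈ Icc a b, ∀ t' ∈ Icc s t, LocBdd Ω g (y, t'))
    (hside : ∀ t' ∈ Icc s t, r < u a t' ∧ r < u b t')
    (hinit : ∀ y ∈ Icc a b, r ^ 2 - 2 * (κ + 1) * (s - c) ≤ u y s ^ 2) (hy : y ∈ Icc a b) :
    r ^ 2 - 2 * (κ + 1) * (t - c) ≤ u y t ^ 2 := by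
  by_contra! hlt
  have hκ := h.κ_nonneg
  obtain ⟨⟨q, s'⟩, ⟨hq, hs'⟩, hmin⟩ := (isCompact_Icc.prod isCompact_Icc :
      IsCompact (Icc a b ×ˢ Icc s t)).exists_isMinOn ⟨(y, t), hy, hst, le_rfl⟩
    (f := fun p : ℝ × ℝ => u p.1 p.2 ^ 2 - (r ^ 2 - 2 * (κ + 1) * (p.2 - c)))
    (ContinuousOn.sub (ContinuousOn.pow (fun p hp =>
      (h.continuousAt (hgood p.1 hp.1 p.2 hp.2)).continuousWithinAt) 2) (by fun_prop))
  simp only at hq hs'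
  replace hmin : ∀ p ∈ Icc a b ×ˢ Icc s t, u q s' ^ 2 - (r ^ 2 - 2 * (κ + 1) * (s' - c)) ≤
    u p.1 p.2 ^ 2 - (r ^ 2 - 2 * (κ + 1) * (p.2 - c)) := fun p hp => hmin hp
  have h0 : u q s' ^ 2 - (r ^ 2 - 2 * (κ + 1) * (s' - c)) < 0 :=
    (hmin (y, t) ⟨hy, hst, le_rfl⟩).trans_lt (by simp only; linarith)
  have hss : s < s' := lt_of_le_of_ne hs'.1 fun he => by
    have := hinit q hq; rw [he] at this; linarith
  have hΩ := (hgood q hq s' hs').mem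
  have hlt : u q s' ^ 2 < r ^ 2 := by
    have : 0 ≤ 2 * (κ + 1) * (s' - c) := mul_nonneg (by linarith) (by linarith)
    linarith
  have hur : u q s' < r := lt_of_pow_lt_pow_left₀ 2 hr hlt
  have hqa : a < q := lt_of_le_of_ne hq.1 fun he => by
    have := (hside s' hs').1; rw [he] at this; linarith
  have hqb : q < b := lt_of_le_of_ne hq.2 fun he => by
    have := (hside s' hs').2; rw [← he] at this; linarith
  have hlm : IsLocalMin (fun y => u y s') q := by
    filter_upwards [Icc_mem_nhds hqa hqb] with x hx
    have h1 := hmin (x, s') ⟨hx, hs'⟩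
    refine le_of_sq_le_sq (by simp only at h1; linarith) (h.pos _ _ (hgood x hx s' hs').mem).le
  obtain ⟨η, hη, hb⟩ := exists_lt_left (h.hasDerivAt_sq_sub (c := c) (r := r) hΩ)
    (h.deriv_sq_at_min hΩ hlm)
  have hm : (max s (s' - η) + s') / 2 ∈ Ioo (s' - η) s' ∧ s ≤ (max s (s' - η) + s') / 2 := by
    have h1 := le_max_left s (s' - η)
    have h2 := le_max_right s (s' - η)
    have h3 : max s (s' - η) < s' := max_lt hss (by linarith)
    exact ⟨⟨by linarith, by linarith⟩, by linarith⟩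
  have h1 := hb _ hm.1
  have h2 := hmin (q, (max s (s' - η) + s') / 2) ⟨hq, hm.2, hm.1.2.le.trans hs'.2⟩
  simp only at h1 h2
  linarith

/-- A spike pointing at the axis cannot emanate from a corner next to which the solution has
bounded slope. -/
theorem Sol.corner_no_slit (h : Sol κ Ω u v w g) {a m c T K' L ε₁ r : ℝ} (ham : a < m)
    (hr : 0 ≤ r) (hε₁ : 0 < ε₁)
    (hgood : ∀ y ∈ Icc a m, ∀ t ∈ Ioo c T, LocBdd Ω g (y, t))
    (hbot : ∀ y ∈ Ioc a m, LocBdd Ω g (y, c) ∧ r < u y c)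
    (hlat : ∀ t ∈ Ioo c T, |u a t - u a c| < ε₁) (hm : ∀ t ∈ Ioo c T, r < u m t)
    (hslope : ∀ t ∈ Ioo c T, -K' ≤ v a t) (hup : ∀ y ∈ Icc a m, ∀ t ∈ Ioo c T, u y t ≤ L)
    (hrc : r < u a c - 2 * ε₁) (hN : (K' + 1) * (m - a) ≤ ε₁) (hK' : 0 ≤ K')
    (hθ : 3 / 2 * (|a| * ε₁) + L * (m - a) < Real.arctan (K' + 1) - Real.arctan K') :
    ∀ y ∈ Icc a m, ∀ t ∈ Ioo c T, r ^ 2 - 2 * (κ + 1) * (t - c) ≤ u y t ^ 2 := by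
  intro y₁ hy₁ s₁ hs₁
  by_contra! hlt
  have hκ := h.κ_nonneg
  have hs := h.strip hgood
  set l : ℝ → ℝ := fun y => u a c - ε₁ - (K' + 1) * (y - a) with hl
  have hlr : ∀ y ∈ Icc a m, r < l y := fun y hy => by
    have : (K' + 1) * (y - a) ≤ (K' + 1) * (m - a) :=
      mul_le_mul_of_nonneg_left (by linarith [hy.2]) (by linarith)
    simp only [hl]; linarith
  have hL0 : 0 < L := (h.pos a s₁ (hgood a ⟨le_rfl, ham.le⟩ s₁ hs₁).mem).trans_le
    (hup a ⟨le_rfl, ham.le⟩ s₁ hs₁)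
  have hslit : ∀ y s, c ≤ s → u y s ^ 2 ≤ r ^ 2 - 2 * (κ + 1) * (s - c) → u y s ≤ r := by
    intro y s hs hle
    refine le_of_sq_le_sq (hle.trans ?_) hr
    have : 0 ≤ 2 * (κ + 1) * (s - c) := mul_nonneg (by linarith) (by linarith)
    linarith
  have hls : Strip a m c T (fun y _ => l y) (fun _ _ => -(K' + 1)) (fun _ _ => 0) (fun _ _ => 0) :=
    { deriv_t := fun y _ t _ => hasDerivAt_const t (l y)
      cont := fun t _ => by simp only [hl]; fun_prop
      cont_g := fun t _ => continuousOn_const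
      bdd := fun t _ => ⟨1, one_pos, 0, fun _ _ _ _ _ => by simp⟩
      hv := fun y _ t _ => (((hasDerivAt_id y).sub_const a).const_mul (K' + 1)).const_sub
        (u a c - ε₁) |>.congr_deriv (by ring)
      hw := fun y _ t _ => hasDerivAt_const y _
      cont_w := fun t _ => continuousOn_const }
  have hz := hs.toTStrip.sub hls.toTStrip
  simp only [sub_zero] at hz
  set A : ℝ → ℝ → ℝ := fun z s => ∫ y in a..z, (u y s - l y) with hA
  have hya : a < y₁ := lt_of_le_of_ne hy₁.1 fun he => by
    have h1 := hslit y₁ s₁ hs₁.1.le hlt.le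
    have h2 := (abs_lt.1 (hlat s₁ hs₁)).1
    rw [← he] at h1; linarith
  -- positive area at time `s₁`
  obtain ⟨z₁, hz₁, hA₁⟩ : ∃ z₁ ∈ Icc a y₁, 0 < A z₁ s₁ := by
    have hpos : 0 < u a s₁ - l a := by
      have h2 := (abs_lt.1 (hlat s₁ hs₁)).1
      simp only [hl, sub_self, mul_zero]; linarith
    obtain ⟨η, hη, hb⟩ := Metric.continuousOn_iff.1 (hz.cont s₁ hs₁) a ⟨le_rfl, ham.le⟩ _ hpos
    refine ⟨min y₁ (a + η / 2), ⟨le_min hya.le (by linarith), min_le_left _ _⟩, ?_⟩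
    have hlt1 : a < min y₁ (a + η / 2) := lt_min hya (by linarith)
    refine intervalIntegral.intervalIntegral_pos_of_pos_on
      (((hz.cont s₁ hs₁).mono ?_).intervalIntegrable) ?_ hlt1
    · rw [uIcc_of_le hlt1.le]
      exact Icc_subset_Icc le_rfl ((min_le_left _ _).trans hy₁.2)
    · intro x hx
      have hxy := hx.2.trans_le (min_le_left _ _)
      have hxη := hx.2.trans_le (min_le_right _ _)
      have := hb x ⟨hx.1.le, hxy.le.trans hy₁.2⟩ (by
        rw [Real.dist_eq, abs_lt]; constructor <;> linarith [hx.1])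
      rw [Real.dist_eq, abs_lt] at this; linarith
  -- a time `s₀` with very small area
  set ε' := min (m - a) (A z₁ s₁ / (2 * L)) with hε'
  have hε'0 : 0 < ε' := lt_min (by linarith) (by positivity)
  have hε'm : a + ε' ≤ m := by linarith [min_le_left (m - a) (A z₁ s₁ / (2 * L))]
  have hε'A : L * ε' < A z₁ s₁ := by
    have : ε' ≤ A z₁ s₁ / (2 * L) := min_le_right _ _
    rw [le_div_iff₀ (by positivity)] at this; linarith
  obtain ⟨s₀, hs₀, hs₀₁, hno⟩ : ∃ s₀ ∈ Ioo c T, s₀ < s₁ ∧ ∀ y ∈ Icc (a + ε') m, r < u y s₀ := by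
    have hev : ∀ᶠ s in 𝓝 c, ∀ y ∈ Icc (a + ε') m, r < u y s := by
      refine isCompact_Icc.eventually_forall_of_forall_eventually fun y hy => ?_
      have hb := hbot y ⟨by linarith [hy.1], hy.2⟩
      have := (h.continuousAt hb.1).eventually (lt_mem_nhds hb.2)
      exact (continuous_swap.tendsto (c, y)).eventually this
    obtain ⟨η, hη, hb⟩ := Metric.eventually_nhds_iff.1 hev
    have h1 : c < min s₁ (c + η) := lt_min hs₁.1 (by linarith)
    refine ⟨(c + min s₁ (c + η)) / 2, ⟨by linarith, ?_⟩, ?_, hb ?_⟩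
    · linarith [min_le_left s₁ (c + η), hs₁.2]
    · linarith [min_le_left s₁ (c + η)]
    · rw [Real.dist_eq, abs_lt]; constructor <;> linarith [min_le_right s₁ (c + η)]
  -- maximize the area
  set D : Set (ℝ × ℝ × ℝ) := (Icc a m ×ˢ Icc a m ×ˢ Icc s₀ s₁) ∩ {p | p.1 ≤ p.2.1 ∧
    u p.2.1 p.2.2 ^ 2 ≤ r ^ 2 - 2 * (κ + 1) * (p.2.2 - c)} with hD
  have hcu : ContinuousOn (fun p : ℝ × ℝ × ℝ => u p.2.1 p.2.2 ^ 2)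
      (Icc a m ×ˢ Icc a m ×ˢ Icc s₀ s₁) := by
    refine ContinuousOn.pow ?_ 2
    refine hs.toTStrip.continuousOn.comp (f := fun p : ℝ × ℝ × ℝ => p.2) (by fun_prop) ?_
    rintro ⟨z, z₂, s⟩ ⟨-, h2, h3⟩
    exact ⟨h2, hs₀.1.trans_le h3.1, h3.2.trans_lt hs₁.2⟩
  have hDc : IsCompact D := by
    have hcl : IsClosed ((Icc a m ×ˢ Icc a m ×ˢ Icc s₀ s₁) ∩ {p : ℝ × ℝ × ℝ |
        u p.2.1 p.2.2 ^ 2 ≤ r ^ 2 - 2 * (κ + 1) * (p.2.2 - c)}) :=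
      (isClosed_Icc.prod (isClosed_Icc.prod isClosed_Icc)).isClosed_le hcu (by fun_prop)
    have : D = ((Icc a m ×ˢ Icc a m ×ˢ Icc s₀ s₁) ∩ ((Icc a m ×ˢ Icc a m ×ˢ Icc s₀ s₁) ∩
        {p : ℝ × ℝ × ℝ | u p.2.1 p.2.2 ^ 2 ≤ r ^ 2 - 2 * (κ + 1) * (p.2.2 - c)})) ∩
        {p | p.1 ≤ p.2.1} := by
      ext p; simp only [hD, mem_inter_iff, mem_ofPred_eq]; tauto
    rw [this]
    exact ((isCompact_Icc.prod (isCompact_Icc.prod isCompact_Icc)).inter_right hcl).inter_right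
      (isClosed_le (by fun_prop) (by fun_prop))
  have hAc : ContinuousOn (fun p : ℝ × ℝ × ℝ => A p.1 p.2.2) D := by
    refine (hz.continuousOn_integral ham.le hs₀.1 hs₀₁.le hs₁.2).comp
      (f := fun p : ℝ × ℝ × ℝ => (p.1, p.2.2)) (by fun_prop) ?_
    rintro ⟨z, z₂, s⟩ ⟨⟨h1, h2, h3⟩, -⟩
    exact ⟨h1, h3⟩
  have hm1 : (z₁, y₁, s₁) ∈ D :=
    ⟨⟨⟨hz₁.1, hz₁.2.trans hy₁.2⟩, hy₁, hs₀₁.le, le_rfl⟩, hz₁.2, hlt.le⟩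
  obtain ⟨⟨z, z₂, s⟩, hmem, hmax⟩ := hDc.exists_isMaxOn ⟨_, hm1⟩ hAc
  replace hmax : ∀ p ∈ D, A p.1 p.2.2 ≤ A z s := fun p hp => hmax hp
  obtain ⟨⟨hz', hz₂, hss⟩, hzz, hsl⟩ := hmem
  simp only at hz' hz₂ hss hzz hsl
  have hsT : s ∈ Ioo c T := ⟨hs₀.1.trans_le hss.1, hss.2.trans_lt hs₁.2⟩
  have hAp : A z₁ s₁ ≤ A z s := hmax _ hm1
  have hz₂r := hslit z₂ s hsT.1.le hsl
  have hss' : s₀ < s := by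
    refine lt_of_le_of_ne hss.1 fun he => ?_
    have hz₂ε : z₂ < a + ε' := by
      by_contra! hge
      have := hno z₂ ⟨hge, hz₂.2⟩
      rw [he] at this; linarith
    have h1 : A z s ≤ ∫ _ in a..z, L := by
      refine intervalIntegral.integral_mono_on hz'.1 (((hz.cont s hsT).mono
        (Icc_subset_Icc le_rfl hz'.2)).intervalIntegrable_of_Icc hz'.1)
        intervalIntegrable_const fun y hy => ?_
      have hym : y ∈ Icc a m := ⟨hy.1, hy.2.trans hz'.2⟩
      linarith [hup y hym s hsT, hlr y hym]
    rw [intervalIntegral.integral_const, smul_eq_mul] at h1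
    nlinarith
  have haz : a < z := lt_of_le_of_ne hz'.1 fun he => by
    have : A z s = 0 := by simp only [hA, ← he, intervalIntegral.integral_same]
    linarith
  have hΩz := (hgood z hz' s hsT).mem
  obtain ⟨hz1, hz2, hz3⟩ := integral_max_right (z := fun y => u y s - l y) (a := a) (b := z₂)
    (y₁ := a) (y₂ := z) ((hz.cont s hsT).mono (Icc_subset_Icc le_rfl hz₂.2)) le_rfl haz hzz
    (by linarith [hlr z₂ hz₂])
    ((hs.hv z hz' s hsT).sub (hls.hv z hz' s hsT))
    (fun x hx hx' => hmax (x, z₂, s) ⟨⟨⟨hx, hx'.trans hz₂.2⟩, hz₂, hss⟩, hx', hsl⟩)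
  -- a slit to the right of `z` at earlier times
  obtain ⟨q, hq, hqmin⟩ := isCompact_Icc.exists_isMinOn (nonempty_Icc.2 hz'.2)
    ((hs.cont s hsT).mono (Icc_subset_Icc hz'.1 le_rfl))
  replace hqmin : ∀ x ∈ Icc z m, u q s ≤ u x s := fun x hx => hqmin hx
  have hqm : q ∈ Icc a m := ⟨hz'.1.trans hq.1, hq.2⟩
  have hq2 : u q s ≤ u z₂ s := hqmin z₂ ⟨hzz, hz₂.2⟩
  have hqz : z < q := lt_of_le_of_ne hq.1 fun he => by
    have := hlr z hz'; rw [← he] at hq2; linarith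
  have hqm' : q < m := lt_of_le_of_ne hq.2 fun he => by
    have := hm s hsT; rw [← he] at this; linarith
  have hΩq := (hgood q hqm s hsT).mem
  have hqsl : u q s ^ 2 ≤ r ^ 2 - 2 * (κ + 1) * (s - c) :=
    (pow_le_pow_left₀ (h.pos q s hΩq).le hq2 2).trans hsl
  have hlm : IsLocalMin (fun y => u y s) q := by
    filter_upwards [Icc_mem_nhds hqz hqm'] with x hx using hqmin x hx
  obtain ⟨η, hη, hb⟩ := exists_lt_left (h.hasDerivAt_sq_sub (c := c) (r := r) hΩq)
    (h.deriv_sq_at_min hΩq hlm)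
  have hdA := hz.hasDerivAt_integral (x := a) (y := z) ⟨le_rfl, ham.le⟩ hz' hsT
  have hd0 := deriv_nonneg_of_le_left hdA (y := max s₀ (s - η)) (max_lt hss' (by linarith))
    fun s' hs' => by
      have h1 := (le_max_left _ _).trans_lt hs'.1
      have h2 := (le_max_right _ _).trans_lt hs'.1
      refine hmax (z, q, s') ⟨⟨hz', hqm, h1.le, hs'.2.le.trans hss.2⟩, hqz.le, ?_⟩
      have := hb s' ⟨h2, hs'.2⟩
      simp only at this ⊢
      linarith
  -- but the area decreases
  have hle : ∫ y in a..z, g y s ≤ ∫ y in a..z, (w y s / (1 + v y s ^ 2) - y / 2 * v y s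
      + u y s / 2) := by
    have hsub : Icc a z ⊆ Icc a m := Icc_subset_Icc le_rfl hz'.2
    refine intervalIntegral.integral_mono_on haz.le
      (((hs.cont_g s hsT).mono hsub).intervalIntegrable_of_Icc haz.le)
      (((hs.cont_flux hsT).mono hsub).intervalIntegrable_of_Icc haz.le) fun y hy => ?_
    have hΩ := (hgood y (hsub hy) s hsT).mem
    rw [h.pde y s hΩ]
    linarith [div_nonneg hκ (h.pos y s hΩ).le]
  rw [hs.integral_flux ⟨le_rfl, ham.le⟩ hz' hsT] at hle
  have hiu : ∫ y in a..z, u y s ≤ ∫ _ in a..z, L := by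
    refine intervalIntegral.integral_mono_on hz'.1 (((hs.cont s hsT).mono
      (Icc_subset_Icc le_rfl hz'.2)).intervalIntegrable_of_Icc hz'.1)
      intervalIntegrable_const fun y hy => hup y ⟨hy.1, hy.2.trans hz'.2⟩ s hsT
  rw [intervalIntegral.integral_const, smul_eq_mul] at hiu
  have harc1 : Real.arctan (v z s) ≤ -Real.arctan (K' + 1) := by
    rw [← Real.arctan_neg]; exact Real.arctan_mono (by linarith)
  have harc2 : -Real.arctan K' ≤ Real.arctan (v a s) := by
    rw [← Real.arctan_neg]; exact Real.arctan_mono (hslope s hsT)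
  have hza : |u z s - u a s| ≤ 3 * ε₁ := by
    have h1 := abs_lt.1 (hlat s hsT)
    have h2 : u z s = u a c - ε₁ - (K' + 1) * (z - a) := by simp only [hl] at hz2; linarith
    have h3 : 0 ≤ (K' + 1) * (z - a) := mul_nonneg (by linarith) (by linarith)
    have h4 : (K' + 1) * (z - a) ≤ (K' + 1) * (m - a) :=
      mul_le_mul_of_nonneg_left (by linarith [hz'.2]) (by linarith)
    rw [h2, abs_le]; constructor <;> linarith [h1.1, h1.2]
  have hprod : -(a * (u z s - u a s)) ≤ |a| * (3 * ε₁) := by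
    refine (neg_le_abs _).trans ?_
    rw [abs_mul]
    exact mul_le_mul_of_nonneg_left hza (abs_nonneg a)
  have h5 : 0 ≤ (z - a) * u z s := mul_nonneg (by linarith) (h.pos z s hΩz).le
  have h6 : (z - a) * L ≤ L * (m - a) := by
    rw [mul_comm]; exact mul_le_mul_of_nonneg_left (by linarith [hz'.2]) hL0.le
  linarith

theorem Tame.refl {K y t : ℝ} (h : Tame Ω u g K (-y) t) :
    Tame {p | (-p.1, p.2) ∈ Ω} (fun y t => u (-y) t) (fun y t => g (-y) t) K y t := h

theorem inv_sq_lt {K : ℝ} (hK : 1 ≤ K) : (2 * K)⁻¹ < K⁻¹ :=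
  inv_strictAnti₀ (by linarith) (by linarith)

theorem Sol.end_no_slit (h : Sol κ Ω u v w g) {α a b c T K C₁ : ℝ} (hαa : α < a) (hab : a < b)
    (hcT : c < T) (hT1 : T - c ≤ 1) (hK : 1 ≤ K) (hC₁ : 0 ≤ C₁)
    (hgood : ∀ y ∈ Icc α b, ∀ t ∈ Ioo c T, LocBdd Ω g (y, t))
    (hup : ∀ y ∈ Icc α b, ∀ t ∈ Ioo c T, u y t ≤ u y c + C₁ * (t - c))
    (htame : ∀ y ∈ Icc α b, Tame Ω u g K y c) (hbot : ∀ y ∈ Ioo a b, LocBdd Ω g (y, c))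
    (hside : ∀ t ∈ Ico c T, Tame Ω u g K a t) :
    ∃ m ∈ Ioc a ((a + b) / 2), ∃ T' ∈ Ioc c T, ∀ y ∈ Icc a m, ∀ t ∈ Ioo c T',
      (2 * K)⁻¹ ^ 2 - 2 * (κ + 1) * (t - c) ≤ u y t ^ 2 := by
  have hK0 : 0 < K := by linarith
  obtain ⟨K', hK', T₁, hT₁, hslope⟩ := h.slope_bound hαa hcT hC₁ hK0.le
    (fun y hy => hgood y ⟨hy.1, hy.2.trans hab.le⟩) (fun y hy => hup y ⟨hy.1, hy.2.trans hab.le⟩)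
    hside
  obtain ⟨D, hD⟩ : ∃ D, D = Real.arctan (K' + 1) - Real.arctan K' := ⟨_, rfl⟩
  have hD0 : 0 < D := by
    rw [hD]; exact sub_pos.2 (Real.arctan_strictMono (by linarith))
  obtain ⟨L, hL⟩ : ∃ L, L = K + C₁ := ⟨_, rfl⟩
  have hL0 : 0 < L := by linarith
  have hinv : 0 < K⁻¹ := inv_pos.2 hK0
  obtain ⟨ε₁, hε₁, hε₁1, hε₁2⟩ : ∃ ε₁ > 0, ε₁ ≤ K⁻¹ / 8 ∧ ε₁ ≤ D / (4 * (|a| + 1)) :=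
    ⟨min (K⁻¹ / 8) (D / (4 * (|a| + 1))), by positivity, min_le_left _ _, min_le_right _ _⟩
  obtain ⟨d, hd, hd1, hd2, hd3⟩ : ∃ d > 0, d ≤ (b - a) / 2 ∧ d ≤ ε₁ / (K' + 1) ∧
      d ≤ D / (4 * L) :=
    ⟨min ((b - a) / 2) (min (ε₁ / (K' + 1)) (D / (4 * L))),
      lt_min (by linarith) (by positivity), min_le_left _ _,
      (min_le_right _ _).trans (min_le_left _ _), (min_le_right _ _).trans (min_le_right _ _)⟩
  rw [le_div_iff₀ (by positivity)] at hε₁2 hd2 hd3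
  have hr : (2 * K)⁻¹ = K⁻¹ / 2 := by rw [mul_inv]; ring
  have hmb : a + d ∈ Ioo a b := ⟨by linarith, by linarith⟩
  have hmr : (2 * K)⁻¹ < u (a + d) c :=
    (inv_sq_lt hK).trans_le (htame _ ⟨by linarith [hmb.1], hmb.2.le⟩).2.2.1
  have hev : ∀ᶠ t in 𝓝 c, (2 * K)⁻¹ < u (a + d) t :=
    (h.hg _ c (hbot _ hmb).mem).continuousAt.eventually (lt_mem_nhds hmr)
  obtain ⟨η, hη, hηm⟩ := Metric.eventually_nhds_iff.1 hev
  obtain ⟨T', hT', h1, h2, h3⟩ : ∃ T' > c, T' ≤ T₁ ∧ T' ≤ c + η ∧ T' ≤ c + ε₁ / K :=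
    ⟨min T₁ (min (c + η) (c + ε₁ / K)),
      lt_min hT₁.1 (lt_min (by linarith) (by linarith [div_pos hε₁ hK0])), min_le_left _ _,
      (min_le_right _ _).trans (min_le_left _ _), (min_le_right _ _).trans (min_le_right _ _)⟩
  have hTT : T' ≤ T := h1.trans hT₁.2
  refine ⟨a + d, ⟨by linarith, by linarith⟩, T', ⟨hT', hTT⟩, ?_⟩
  have hsub : ∀ y ∈ Icc a (a + d), y ∈ Icc α b := fun y hy =>
    ⟨hαa.le.trans hy.1, hy.2.trans hmb.2.le⟩
  have hau := (htame a ⟨hαa.le, hab.le⟩).2.2.1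
  refine h.corner_no_slit (K' := K') (L := L) (ε₁ := ε₁) (by linarith) (by positivity) hε₁
    (fun y hy t ht => hgood y (hsub y hy) t ⟨ht.1, ht.2.trans_le hTT⟩)
    (fun y hy => ⟨hbot y ⟨hy.1, hy.2.trans_lt hmb.2⟩,
      (inv_sq_lt hK).trans_le (htame y (hsub y ⟨hy.1.le, hy.2⟩)).2.2.1⟩)
    (fun t ht => ?_) (fun t ht => hηm ?_) (fun t ht => hslope t ⟨ht.1, ht.2.trans_le h1⟩)
    (fun y hy t ht => ?_) ?_ (by simpa [mul_comm] using hd2) hK'.le ?_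
  · refine (h.abs_sub_le_of_tame hside ⟨ht.1.le, ht.2.trans_le hTT⟩).trans_lt ?_
    have : t - c < ε₁ / K := by linarith [ht.2]
    rw [lt_div_iff₀ hK0] at this
    linarith
  · rw [Real.dist_eq, abs_of_pos (by linarith [ht.1])]; linarith [ht.2]
  · have h4 := hup y (hsub y hy) t ⟨ht.1, ht.2.trans_le hTT⟩
    have h5 := (htame y (hsub y hy)).2.2.2
    have : C₁ * (t - c) ≤ C₁ * 1 := mul_le_mul_of_nonneg_left (by linarith [ht.2]) hC₁
    linarith
  · rw [hr]; linarith
  · rw [← hD, add_sub_cancel_left]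
    nlinarith [abs_nonneg a]

theorem Sol.gap_lower (h : Sol κ Ω u v w g) {α a b β c T K C₁ : ℝ} (hαa : α < a) (hab : a < b)
    (hbβ : b < β) (hT1 : T - c ≤ 1) (hK : 1 ≤ K) (hC₁ : 0 ≤ C₁)
    (hgood : ∀ y ∈ Icc α β, ∀ t ∈ Ioo c T, LocBdd Ω g (y, t))
    (hup : ∀ y ∈ Icc α β, ∀ t ∈ Ioo c T, u y t ≤ u y c + C₁ * (t - c))
    (htame : ∀ y ∈ Icc α β, Tame Ω u g K y c) (hbot : ∀ y ∈ Ioo a b, LocBdd Ω g (y, c))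
    (hside : ∀ t ∈ Ico c T, Tame Ω u g K a t ∧ Tame Ω u g K b t)
    {y t : ℝ} (hy : y ∈ Icc a b) (ht : t ∈ Ioo c T) :
    (2 * K)⁻¹ ^ 2 - 2 * (κ + 1) * (t - c) ≤ u y t ^ 2 := by
  have hcT : c < T := ht.1.trans ht.2
  obtain ⟨m₁, hm₁, T₁, hT₁, H₁⟩ := h.end_no_slit hαa hab hcT hT1 hK hC₁
    (fun y hy => hgood y ⟨hy.1, hy.2.trans hbβ.le⟩) (fun y hy => hup y ⟨hy.1, hy.2.trans hbβ.le⟩)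
    (fun y hy => htame y ⟨hy.1, hy.2.trans hbβ.le⟩) hbot (fun t ht => (hside t ht).1)
  have hmem : ∀ y ∈ Icc (-β) (-a), -y ∈ Icc α β := fun y hy =>
    ⟨by linarith [hy.2], by linarith [hy.1]⟩
  obtain ⟨m₂, hm₂, T₂, hT₂, H₂⟩ := h.refl.end_no_slit (α := -β) (a := -b) (b := -a)
    (by linarith) (by linarith) hcT hT1 hK hC₁
    (fun y hy t ht => (hgood (-y) (hmem y hy) t ht).refl) (fun y hy => hup (-y) (hmem y hy))
    (fun y hy => (htame (-y) (hmem y hy)).refl)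
    (fun y hy => (hbot (-y) ⟨by linarith [hy.2], by linarith [hy.1]⟩).refl)
    (fun t ht => Tame.refl (by simpa using (hside t ht).2))
  have hmid : ∀ y ∈ Icc m₁ (-m₂), y ∈ Ioo a b := fun y hy =>
    ⟨hm₁.1.trans_le hy.1, by linarith [hm₂.1, hy.2]⟩
  obtain ⟨ε, hε, M, hM⟩ := exists_tube (fun y hy => hbot y (hmid y hy))
  have hK0 : 0 < K := by linarith
  have hr : (2 * K)⁻¹ < K⁻¹ := inv_sq_lt hK
  obtain ⟨T', hT', h1, h2, h3, h4⟩ : ∃ T' > c, T' ≤ T₁ ∧ T' ≤ T₂ ∧ T' ≤ c + ε ∧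
      T' ≤ c + (K⁻¹ - (2 * K)⁻¹) / (|M| + 1) :=
    ⟨min (min T₁ T₂) (min (c + ε) (c + (K⁻¹ - (2 * K)⁻¹) / (|M| + 1))),
      lt_min (lt_min hT₁.1 hT₂.1) (lt_min (by linarith)
        (by linarith [div_pos (sub_pos.2 hr) (by positivity : 0 < |M| + 1)])),
      (min_le_left _ _).trans (min_le_left _ _), (min_le_left _ _).trans (min_le_right _ _),
      (min_le_right _ _).trans (min_le_left _ _), (min_le_right _ _).trans (min_le_right _ _)⟩
  have hnear : ∀ y ∈ Icc a b, ∀ t ∈ Ioo c T',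
      (2 * K)⁻¹ ^ 2 - 2 * (κ + 1) * (t - c) ≤ u y t ^ 2 := by
    intro y hy t ht
    by_cases hy1 : y ≤ m₁
    · exact H₁ y ⟨hy.1, hy1⟩ t ⟨ht.1, ht.2.trans_le h1⟩
    by_cases hy2 : -m₂ ≤ y
    · simpa using H₂ (-y) ⟨by linarith [hy.2], by linarith⟩ t ⟨ht.1, ht.2.trans_le h2⟩
    have hym : y ∈ Icc m₁ (-m₂) := ⟨by linarith, by linarith⟩
    have hb : |u y t - u y c| ≤ |M| * |t - c| := by
      have := (convex_Icc c t).norm_image_sub_le_of_norm_hasDerivWithin_le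
        (f := fun s => u y s) (f' := fun s => g y s) (C := |M|) (x := c) (y := t)
        (fun s hs => ?_) (fun s hs => ?_) ⟨le_rfl, ht.1.le⟩ ⟨ht.1.le, le_rfl⟩
      · simpa [Real.norm_eq_abs] using this
      · exact (h.hg y s (hM y hym s
          (by rw [abs_of_nonneg (by linarith [hs.1])]; linarith [hs.2, ht.2])).1.mem
          ).hasDerivWithinAt
      · exact (hM y hym s (by rw [abs_of_nonneg (by linarith [hs.1])]
                              linarith [hs.2, ht.2])).2.trans (le_abs_self M)
    rw [abs_of_pos (sub_pos.2 ht.1)] at hb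
    have h5 : t - c ≤ (K⁻¹ - (2 * K)⁻¹) / (|M| + 1) := by linarith [ht.2]
    rw [le_div_iff₀ (by positivity)] at h5
    have h6 := (htame y ⟨by linarith [hy.1], by linarith [hy.2]⟩).2.2.1
    have h7 : (2 * K)⁻¹ ≤ u y t := by
      linarith [(abs_le.1 hb).1, ht.1]
    have h8 : (2 * K)⁻¹ ^ 2 ≤ u y t ^ 2 := pow_le_pow_left₀ (by positivity) h7 2
    have h9 : 0 ≤ 2 * (κ + 1) * (t - c) :=
      mul_nonneg (by linarith [h.κ_nonneg]) (by linarith [ht.1])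
    linarith
  rcases lt_or_ge t T' with htT | htT
  · exact hnear y hy t ⟨ht.1, htT⟩
  · have hs : (c + T') / 2 ∈ Ioo c T' := ⟨by linarith, by linarith⟩
    refine h.sq_lower_persist hs.1.le (hs.2.le.trans htT) (by positivity)
      (fun y hy t' ht' => hgood y ⟨by linarith [hy.1], by linarith [hy.2]⟩ t'
        ⟨hs.1.trans_le ht'.1, ht'.2.trans_lt ht.2⟩) (fun t' ht' => ?_)
      (fun y hy => hnear y hy _ hs) hy
    have := hside t' ⟨hs.1.le.trans ht'.1, ht'.2.trans_lt ht.2⟩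
    exact ⟨hr.trans_le this.1.2.2.1, hr.trans_le this.2.2.2.1⟩

theorem Sol.lower (h : Sol κ Ω u v w g) {α α' β' β c T K C₁ : ℝ} (hα : α < α') (hβ : β' < β)
    (hT1 : T - c ≤ 1) (hK : 1 ≤ K) (hC₁ : 0 ≤ C₁)
    (hgood : ∀ y ∈ Icc α β, ∀ t ∈ Ioo c T, LocBdd Ω g (y, t))
    (hup : ∀ y ∈ Icc α β, ∀ t ∈ Ioo c T, u y t ≤ u y c + C₁ * (t - c))
    (htame : ∀ y ∈ Icc α β, Tame Ω u g K y c)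
    (hlat : ∀ t ∈ Ico c T, Tame Ω u g K α' t ∧ Tame Ω u g K β' t)
    (hbad : ∀ y ∈ Icc α β, ¬ LocBdd Ω g (y, c) → ∀ t ∈ Ico c T, Tame Ω u g K y t)
    {y t : ℝ} (hy : y ∈ Icc α' β') (ht : t ∈ Ioo c T) :
    (2 * K)⁻¹ ^ 2 - 2 * (κ + 1) * (t - c) ≤ u y t ^ 2 := by
  set P := {y | y ∈ Icc α' β' ∧ ¬ LocBdd Ω g (y, c)} ∪ {α', β'} with hP
  have hPt : ∀ y ∈ P, ∀ t ∈ Ico c T, Tame Ω u g K y t := by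
    rintro y (hy | hy | hy) t ht
    · exact hbad y ⟨hα.le.trans hy.1.1, hy.1.2.trans hβ.le⟩ hy.2 t ht
    · rw [hy]; exact (hlat t ht).1
    · rw [hy]; exact (hlat t ht).2
  by_cases hyP : y ∈ P
  · have h1 := (hPt y hyP t ⟨ht.1.le, ht.2⟩).2.2.1
    have h8 : (2 * K)⁻¹ ^ 2 ≤ u y t ^ 2 :=
      pow_le_pow_left₀ (by positivity) ((inv_sq_lt hK).le.trans h1) 2
    have h9 : 0 ≤ 2 * (κ + 1) * (t - c) :=
      mul_nonneg (by linarith [h.κ_nonneg]) (by linarith [ht.1])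
    linarith
  obtain ⟨a, haP, b, hbP, hαa, hay, hyb, hbβ, hgap⟩ := exists_gap (isClosed_bad Ω g α' β' c)
    (by simp) (by simp) hy.1 hy.2 hyP
  exact h.gap_lower (hα.trans_le hαa) (hay.trans hyb) (hbβ.trans_lt hβ) hT1 hK hC₁ hgood hup htame
    (fun x hx => by
      by_contra hx'
      exact hgap x hx (Or.inl ⟨⟨hαa.trans hx.1.le, hx.2.le.trans hbβ⟩, hx'⟩))
    (fun t ht => ⟨hPt a haP t ht, hPt b hbP t ht⟩) ⟨hay.le, hyb.le⟩ ht

section Limit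

variable {Ω' : Set (ℝ × ℝ)} {U V W G : ℝ → ℝ → ℝ}

theorem Sol.shift (h : Sol κ Ω u v w g) (σ : ℝ) :
    Sol κ {p | (p.1, p.2 + σ) ∈ Ω} (fun y t => u y (t + σ)) (fun y t => v y (t + σ))
      (fun y t => w y (t + σ)) (fun y t => g y (t + σ)) where
  isOpen := h.isOpen.preimage (by fun_prop : Continuous fun p : ℝ × ℝ => (p.1, p.2 + σ))
  κ_nonneg := h.κ_nonneg
  pos y t hp := h.pos y _ hp
  hv y t hp := h.hv y _ hp
  hw y t hp := h.hw y _ hp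
  hg y t hp := (h.hg y (t + σ) hp).comp_add_const t σ
  cont_w y t hp := h.cont_w y _ hp
  cont_g y t hp := ContinuousAt.comp (g := fun s => g y s) (h.cont_g y (t + σ) hp)
    (by fun_prop : Continuous fun s => s + σ).continuousAt
  pde y t hp := h.pde y _ hp

theorem Sol.sub_le_exp (h : Sol κ Ω u v w g) (H : Sol κ Ω' U V W G) {a b c t₁ ℓ M : ℝ}
    (hℓ : 0 < ℓ) (hM : 0 ≤ M)
    (hΩ : ∀ y ∈ Icc a b, ∀ t ∈ Ioc c t₁, (y, t) ∈ Ω ∧ ℓ ≤ u y t)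
    (hΩ' : ∀ y ∈ Icc a b, ∀ t ∈ Ioc c t₁, (y, t) ∈ Ω' ∧ ℓ ≤ U y t)
    (hcont : ContinuousOn (fun p : ℝ × ℝ => u p.1 p.2 - U p.1 p.2) (Icc a b ×ˢ Icc c t₁))
    (hbot : ∀ y ∈ Icc a b, u y c - U y c ≤ M)
    (hside : ∀ t ∈ Icc c t₁, u a t - U a t ≤ M ∧ u b t - U b t ≤ M)
    {y t : ℝ} (hy : y ∈ Icc a b) (ht : t ∈ Icc c t₁) :
    u y t - U y t ≤ M * Real.exp ((1 + κ / ℓ ^ 2) * (t - c)) := by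
  by_contra! hlt
  obtain ⟨lam, hlam⟩ : ∃ lam, lam = 1 + κ / ℓ ^ 2 := ⟨_, rfl⟩
  have hκℓ : 0 ≤ κ / ℓ ^ 2 := div_nonneg h.κ_nonneg (by positivity)
  rw [← hlam] at hlt
  obtain ⟨⟨q, s⟩, ⟨hq, hs⟩, hmax⟩ := (isCompact_Icc.prod isCompact_Icc :
      IsCompact (Icc a b ×ˢ Icc c t₁)).exists_isMaxOn ⟨(y, t), hy, ht⟩
    (f := fun p : ℝ × ℝ => (u p.1 p.2 - U p.1 p.2) * Real.exp (-(lam * (p.2 - c))))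
    (hcont.mul (by fun_prop))
  simp only at hq hs
  replace hmax : ∀ p ∈ Icc a b ×ˢ Icc c t₁, (u p.1 p.2 - U p.1 p.2) *
      Real.exp (-(lam * (p.2 - c))) ≤ (u q s - U q s) * Real.exp (-(lam * (s - c))) :=
    fun p hp => hmax hp
  have hexp : 0 < Real.exp (-(lam * (s - c))) := Real.exp_pos _
  have h0 : M < (u q s - U q s) * Real.exp (-(lam * (s - c))) := by
    refine lt_of_lt_of_le ?_ (hmax (y, t) ⟨hy, ht⟩)
    rw [Real.exp_neg, ← div_eq_mul_inv, lt_div_iff₀ (Real.exp_pos _)]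
    exact hlt
  have hD0 : 0 < u q s - U q s := by
    by_contra! hn
    have := mul_nonpos_of_nonpos_of_nonneg hn hexp.le
    linarith
  have hDM : M < u q s - U q s := by
    refine h0.trans_le ?_
    refine mul_le_of_le_one_right hD0.le (Real.exp_le_one_iff.2 ?_)
    have : 0 ≤ lam * (s - c) := mul_nonneg (by linarith) (by linarith [hs.1])
    linarith
  have hcs : c < s := lt_of_le_of_ne hs.1 fun he => by
    have := hbot q hq; rw [he] at this; linarith
  have haq : a < q := lt_of_le_of_ne hq.1 fun he => by
    have := (hside s hs).1; rw [he] at this; linarith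
  have hqb : q < b := lt_of_le_of_ne hq.2 fun he => by
    have := (hside s hs).2; rw [← he] at this; linarith
  obtain ⟨m1, l1⟩ := hΩ q hq s ⟨hcs, hs.2⟩
  obtain ⟨m2, l2⟩ := hΩ' q hq s ⟨hcs, hs.2⟩
  have hev : ∀ᶠ x in 𝓝 q, x ∈ Icc a b := Icc_mem_nhds haq hqb
  have hloc : IsLocalMax (fun x => u x s - U x s) q := by
    filter_upwards [hev] with x hx
    have := hmax (x, s) ⟨hx, hs⟩
    exact le_of_mul_le_mul_right this hexp
  have hd : ∀ᶠ x in 𝓝 q, HasDerivAt (fun x => u x s - U x s) (v x s - V x s) x := by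
    filter_upwards [hev] with x hx
    exact (h.hv x s (hΩ x hx s ⟨hcs, hs.2⟩).1).sub (H.hv x s (hΩ' x hx s ⟨hcs, hs.2⟩).1)
  have hv0 : v q s - V q s = 0 := hloc.hasDerivAt_eq_zero hd.self_of_nhds
  have hw0 : w q s - W q s ≤ 0 := snd_deriv_nonpos hd ((h.hw q s m1).sub (H.hw q s m2)) hloc
  have hE : HasDerivAt (fun r => Real.exp (-(lam * (r - c))))
      (Real.exp (-(lam * (s - c))) * (-lam)) s :=
    ((((hasDerivAt_id s).sub_const c).const_mul lam).neg).exp.congr_deriv (by simp)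
  have hdt := deriv_nonneg_of_le_left (((h.hg q s m1).sub (H.hg q s m2)).mul hE) hcs
    (fun z hz => hmax (q, z) ⟨hq, hz.1.le, hz.2.le.trans hs.2⟩)
  have hdt' : 0 ≤ ((g q s - G q s) - lam * (u q s - U q s)) * Real.exp (-(lam * (s - c))) := by
    refine hdt.trans_eq ?_
    simp only [Pi.sub_apply]
    ring
  have hgl : lam * (u q s - U q s) ≤ g q s - G q s := by
    linarith [nonneg_of_mul_nonneg_left hdt' hexp]
  have hV : V q s = v q s := by linarith
  have p1 := h.pde q s m1
  have p2 := H.pde q s m2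
  rw [hV] at p2
  have hw1 : w q s / (1 + v q s ^ 2) ≤ W q s / (1 + v q s ^ 2) :=
    div_le_div_of_nonneg_right (by linarith) (by positivity)
  have hu0 : 0 < u q s := hℓ.trans_le l1
  have hU0 : 0 < U q s := hℓ.trans_le l2
  have hκ : κ / U q s - κ / u q s ≤ κ / ℓ ^ 2 * (u q s - U q s) := by
    rw [div_sub_div _ _ hU0.ne' hu0.ne', div_mul_eq_mul_div, ← mul_comm κ,
      ← mul_sub]
    refine div_le_div_of_nonneg_left (mul_nonneg h.κ_nonneg hD0.le) (by positivity) ?_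
    rw [pow_two]; exact mul_le_mul l2 l1 hℓ.le hU0.le
  rw [hlam] at hgl
  linarith

theorem Sol.lower_static (h : Sol κ Ω u v w g) {a b c T K ℓ : ℝ} (hab : a < b) (hK : 1 ≤ K)
    (hT1 : T - c ≤ 1) (hℓ : 0 < ℓ)
    (hgood : ∀ y ∈ Icc a b, ∀ t ∈ Ioo c T, LocBdd Ω g (y, t))
    (htame : ∀ y ∈ Icc a b, Tame Ω u g K y c)
    (hlat : ∀ t ∈ Ico c T, Tame Ω u g K a t ∧ Tame Ω u g K b t)
    (hlo : ∀ y ∈ Icc a b, ∀ t ∈ Ioo c T, ℓ ≤ u y t)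
    {y t : ℝ} (hy : y ∈ Icc a b) (ht : t ∈ Ioo c T) :
    u y c - 2 * (K + κ / ℓ + 1) * (t - c) ≤ u y t := by
  have hcT : c < T := ht.1.trans ht.2
  obtain ⟨C, hC⟩ : ∃ C, C = 2 * (K + κ / ℓ + 1) := ⟨_, rfl⟩
  have hκℓ : 0 ≤ κ / ℓ := div_nonneg h.κ_nonneg hℓ.le
  rw [← hC]
  have hs := h.strip hgood
  have hU : Strip a b c T (fun y t => u y c - C * (t - c)) (fun y _ => v y c)
      (fun y _ => w y c) (fun _ _ => -C) :=
    { deriv_t := fun y _ t _ => (((hasDerivAt_id t).sub_const c).const_mul C).const_sub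
        (u y c) |>.congr_deriv (by simp)
      cont := fun t _ => ContinuousOn.sub (fun y hy =>
        (h.hv y c (htame y hy).1).continuousAt.continuousWithinAt) continuousOn_const
      cont_g := fun t _ => continuousOn_const
      bdd := fun t _ => ⟨1, one_pos, |-C|, fun _ _ _ _ _ => le_rfl⟩
      hv := fun y hy t _ => (h.hv y c (htame y hy).1).sub_const _
      hw := fun y hy t _ => h.hw y c (htame y hy).1
      cont_w := fun t _ y hy => (h.cont_w y c (htame y hy).1).continuousWithinAt }
  refine area_comparison hab hU hs ?_ ?_ ?_ ?_ y hy t ht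
  · intro y hy t ht
    have h1 := h.pde y t (hgood y hy t ht).mem
    have h2 := h.pde y c (htame y hy).1
    have h3 : 0 ≤ κ / u y c := div_nonneg h.κ_nonneg (h.pos _ _ (htame y hy).1).le
    have h4 : κ / u y t ≤ κ / ℓ := div_le_div_of_nonneg_left h.κ_nonneg hℓ (hlo y hy t ht)
    have h5 := (abs_le.1 (htame y hy).2.1).1
    have h6 : C * (t - c) ≤ C * 1 :=
      mul_le_mul_of_nonneg_left (by linarith [ht.2]) (by linarith)
    linarith
  · intro t ht
    have := (abs_le.1 (h.abs_sub_le_of_tame (fun t ht => (hlat t ht).1) ⟨ht.1.le, ht.2⟩)).1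
    have : K * (t - c) < C * (t - c) := mul_lt_mul_of_pos_right (by linarith) (by linarith [ht.1])
    linarith
  · intro t ht
    have := (abs_le.1 (h.abs_sub_le_of_tame (fun t ht => (hlat t ht).2) ⟨ht.1.le, ht.2⟩)).1
    have : K * (t - c) < C * (t - c) := mul_lt_mul_of_pos_right (by linarith) (by linarith [ht.1])
    linarith
  intro ε hε δ hδ
  have hT : ∀ᶠ s in 𝓝[>] c, s ∈ Ioo c T := Ioo_mem_nhdsGT hcT
  have hzc : ∀ s ∈ Ioo c T, ContinuousOn (fun y => (u y c - C * (s - c)) - u y s) (Icc a b) :=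
    (hU.toTStrip.sub hs.toTStrip).cont
  have hlim := tendsto_integral_max (a := a) (b := b) (M := K)
    (z := fun y s => (u y c - C * (s - c)) - u y s) (l := 𝓝[>] c) hab.le
    (hT.mono hzc) (hT.mono fun s hs y hy => ?_) fun y hy => ?_
  · obtain ⟨s, h1, h2, h3⟩ := (hT.and ((hlim.eventually (gt_mem_nhds hε)).and
      (Ioo_mem_nhdsGT (by linarith : c < c + δ)))).exists
    exact ⟨s, h1, h3.2, fun y₁ y₂ h4 h5 h6 =>
      (integral_le_integral_max (hzc s h1) h4 h5 h6).trans h2.le⟩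
  · have hy' := Ioo_subset_Icc_self hy
    have h1 := (htame y hy').2.2.2
    have h2 := hlo y hy' s hs
    have h3 : 0 ≤ C * (s - c) := mul_nonneg (by linarith) (by linarith [hs.1])
    linarith
  · have h1 := (h.hg y c (htame y (Ioo_subset_Icc_self hy)).1).continuousAt
    have h2 : ContinuousAt (fun s => max ((u y c - C * (s - c)) - u y s) 0) c := by fun_prop
    have := h2.tendsto.mono_left (nhdsWithin_le_nhds (s := Ioi c))
    simpa using this

/-- A bound for the time derivative on a strip with controlled parabolic boundary. -/
theorem Sol.abs_g_le (h : Sol κ Ω u v w g) {a b c T K ℓ C : ℝ} (hab : a < b) (hK : 1 ≤ K)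
    (hT1 : T - c ≤ 1) (hℓ : 0 < ℓ)
    (hgood : ∀ y ∈ Icc a b, ∀ t ∈ Ioo c T, LocBdd Ω g (y, t))
    (htame : ∀ y ∈ Icc a b, Tame Ω u g K y c)
    (hlat : ∀ t ∈ Ico c T, Tame Ω u g K a t ∧ Tame Ω u g K b t)
    (hlo : ∀ y ∈ Icc a b, ∀ t ∈ Ioo c T, ℓ ≤ u y t)
    (hup : ∀ y ∈ Icc a b, ∀ t ∈ Ioo c T, u y t ≤ u y c + C * (t - c))
    (hKC : 2 * (K + κ / ℓ + 1) ≤ C)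
    {y t : ℝ} (hy : y ∈ Icc a b) (ht : t ∈ Ioo c T) :
    |g y t| ≤ C * Real.exp (1 + κ / ℓ ^ 2) := by
  have hκℓ : 0 ≤ κ / ℓ := div_nonneg h.κ_nonneg hℓ.le
  have hκℓ' : 0 ≤ κ / ℓ ^ 2 := div_nonneg h.κ_nonneg (by positivity)
  have hC0 : 0 ≤ C := by linarith
  have hbot : ∀ y ∈ Icc a b, ∀ t ∈ Ico c T, |u y t - u y c| ≤ C * (t - c) := by
    intro y hy t ht
    rcases ht.1.eq_or_lt with rfl | hct
    · simp
    have h1 := hup y hy t ⟨hct, ht.2⟩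
    have h2 := h.lower_static hab hK hT1 hℓ hgood htame hlat hlo hy ⟨hct, ht.2⟩
    have : 2 * (K + κ / ℓ + 1) * (t - c) ≤ C * (t - c) :=
      mul_le_mul_of_nonneg_right hKC (by linarith)
    rw [abs_le]; constructor <;> linarith
  have hcont : ContinuousOn (fun p : ℝ × ℝ => u p.1 p.2) (Icc a b ×ˢ Ico c T) := by
    rintro ⟨x, s⟩ ⟨hx, hs⟩
    simp only at hx hs
    rcases hs.1.eq_or_lt with rfl | hcs
    · have h1 : Tendsto (fun p : ℝ × ℝ => C * (p.2 - c) + |u p.1 c - u x c|)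
          (𝓝[Icc a b ×ˢ Ico c T] (x, c)) (𝓝 0) := by
        have h2 : ContinuousAt (fun p : ℝ × ℝ => u p.1 c) (x, c) :=
          ContinuousAt.comp (g := fun y => u y c) (h.hv x c (htame x hx).1).continuousAt
            continuous_fst.continuousAt
        have h3 : ContinuousAt (fun p : ℝ × ℝ => C * (p.2 - c) + |u p.1 c - u x c|) (x, c) :=
          (by fun_prop : ContinuousAt (fun p : ℝ × ℝ => C * (p.2 - c)) (x, c)).add
            (h2.sub continuousAt_const).abs
        simpa using h3.tendsto.mono_left nhdsWithin_le_nhds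
      refine tendsto_iff_norm_sub_tendsto_zero.2 (squeeze_zero' (.of_forall fun _ => norm_nonneg _)
        ?_ h1)
      filter_upwards [self_mem_nhdsWithin] with p hp
      rw [Real.norm_eq_abs]
      exact (abs_sub_le _ (u p.1 c) _).trans (add_le_add_left (hbot p.1 hp.1 p.2 hp.2) _)
    · exact (h.continuousAt (hgood x hx s ⟨hcs, hs.2⟩)).continuousWithinAt
  have hside : ∀ s ∈ Ico c T, ∀ s' ∈ Ico c T, |u a s - u a s'| ≤ C * |s - s'| ∧
      |u b s - u b s'| ≤ C * |s - s'| := by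
    have key : ∀ x, (∀ t ∈ Ico c T, Tame Ω u g K x t) → ∀ s ∈ Ico c T, ∀ s' ∈ Ico c T,
        |u x s - u x s'| ≤ C * |s - s'| := by
      intro x hx s hs s' hs'
      have := (convex_Ico c T).norm_image_sub_le_of_norm_hasDerivWithin_le (f := fun s => u x s)
        (f' := fun s => g x s) (C := K) (x := s') (y := s)
        (fun s hs => (h.hg x s (hx s hs).1).hasDerivWithinAt) (fun s hs => (hx s hs).2.1) hs' hs
      simp only [Real.norm_eq_abs] at this
      exact this.trans (mul_le_mul_of_nonneg_right (by linarith) (abs_nonneg _))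
    exact fun s hs s' hs' => ⟨key a (fun t ht => (hlat t ht).1) s hs s' hs',
      key b (fun t ht => (hlat t ht).2) s hs s' hs'⟩
  have hexp : ∀ r, 0 ≤ r → r ≤ 1 → Real.exp ((1 + κ / ℓ ^ 2) * r) ≤ Real.exp (1 + κ / ℓ ^ 2) :=
    fun r h0 h1 => Real.exp_le_exp.2 (mul_le_of_le_one_right (by linarith) h1)
  have hlip : ∀ s ∈ Ioo c T, ∀ σ > 0, s + σ < T →
      |u y (s + σ) - u y s| ≤ C * Real.exp (1 + κ / ℓ ^ 2) * σ := by
    intro s hs σ hσ hsσ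
    have hc1 : ContinuousOn (fun p : ℝ × ℝ => u p.1 p.2) (Icc a b ×ˢ Icc c s) :=
      hcont.mono (prod_mono le_rfl fun t ht => ⟨ht.1, ht.2.trans_lt hs.2⟩)
    have hc2 : ContinuousOn (fun p : ℝ × ℝ => u p.1 (p.2 + σ)) (Icc a b ×ˢ Icc c s) :=
      hcont.comp (f := fun p : ℝ × ℝ => (p.1, p.2 + σ)) (by fun_prop)
        fun p hp => ⟨hp.1, by linarith [hp.2.1], by linarith [hp.2.2]⟩
    have hm1 : ∀ y ∈ Icc a b, ∀ t ∈ Ioc c s, (y, t) ∈ Ω ∧ ℓ ≤ u y t := fun y hy t ht =>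
      ⟨(hgood y hy t ⟨ht.1, ht.2.trans_lt hs.2⟩).mem, hlo y hy t ⟨ht.1, ht.2.trans_lt hs.2⟩⟩
    have hm2 : ∀ y ∈ Icc a b, ∀ t ∈ Ioc c s, (y, t + σ) ∈ Ω ∧ ℓ ≤ u y (t + σ) :=
      fun y hy t ht =>
        have : t + σ ∈ Ioo c T := ⟨by linarith [ht.1], by linarith [ht.2]⟩
        ⟨(hgood y hy _ this).mem, hlo y hy _ this⟩
    have hb : ∀ y ∈ Icc a b, |u y (c + σ) - u y c| ≤ C * σ := fun y hy => by
      simpa using hbot y hy (c + σ) ⟨by linarith, by linarith [hs.1]⟩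
    have hsd : ∀ t ∈ Icc c s, |u a (t + σ) - u a t| ≤ C * σ ∧ |u b (t + σ) - u b t| ≤ C * σ :=
      fun t ht => by
        simpa [abs_of_pos hσ] using hside (t + σ) ⟨by linarith [ht.1], by linarith [ht.2]⟩ t
          ⟨ht.1, by linarith [ht.2, hs.2]⟩
    have h1 := (h.shift σ).sub_le_exp h hℓ (mul_nonneg hC0 hσ.le) hm2 hm1 (hc2.sub hc1)
      (fun y hy => (abs_le.1 (hb y hy)).2)
      (fun t ht => ⟨(abs_le.1 (hsd t ht).1).2, (abs_le.1 (hsd t ht).2).2⟩) hy ⟨hs.1.le, le_rfl⟩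
    have h2 := h.sub_le_exp (h.shift σ) hℓ (mul_nonneg hC0 hσ.le) hm1 hm2 (hc1.sub hc2)
      (fun y hy => by linarith [(abs_le.1 (hb y hy)).1])
      (fun t ht => ⟨by linarith [(abs_le.1 (hsd t ht).1).1],
        by linarith [(abs_le.1 (hsd t ht).2).1]⟩) hy ⟨hs.1.le, le_rfl⟩
    have h3 := mul_le_mul_of_nonneg_left (hexp (s - c) (by linarith [hs.1]) (by linarith [hs.2]))
      (mul_nonneg hC0 hσ.le)
    rw [abs_le]
    constructor <;> linarith
  have hd := h.hg y t (hgood y hy t ht).mem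
  refine hd.le_of_lip' (by positivity) ?_
  filter_upwards [Ioo_mem_nhds ht.1 ht.2] with s hs
  rw [Real.norm_eq_abs, Real.norm_eq_abs]
  rcases lt_trichotomy s t with hst | rfl | hst
  · have := hlip s hs (t - s) (by linarith) (by linarith [ht.2])
    rw [add_sub_cancel] at this
    rwa [abs_sub_comm, abs_sub_comm s t, abs_of_pos (sub_pos.2 hst)]
  · simp
  · have := hlip t ht (s - t) (by linarith) (by linarith [hs.2])
    rw [add_sub_cancel] at this
    rwa [abs_of_pos (sub_pos.2 hst)]

end Limit

section Measure

open MeasureTheory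

/-! ### A profile for the weighted area functional -/

theorem hasDerivAt_max_zero_pow (n : ℕ) (x : ℝ) :
    HasDerivAt (fun x : ℝ => max x 0 ^ (n + 2)) ((n + 2) * max x 0 ^ (n + 1)) x := by
  have hne : ∀ y : ℝ, y ≠ 0 →
      HasDerivAt (fun x : ℝ => max x 0 ^ (n + 2)) ((n + 2) * max y 0 ^ (n + 1)) y := by
    intro y hy
    rcases hy.lt_or_gt with h | h
    · refine ((hasDerivAt_const y (0 : ℝ)).congr_of_eventuallyEq ?_).congr_deriv ?_
      · filter_upwards [Iio_mem_nhds h] with x hx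
        rw [max_eq_right (le_of_lt hx)]; simp
      · rw [max_eq_right h.le]; simp
    · refine ((hasDerivAt_pow (n + 2) y).congr_of_eventuallyEq ?_).congr_deriv ?_
      · filter_upwards [Ioi_mem_nhds h] with x hx
        rw [max_eq_left (le_of_lt hx)]
      · rw [max_eq_left h.le]; push_cast; simp
  rcases eq_or_ne x 0 with rfl | hx
  · exact hasDerivAt_of_hasDerivAt_of_ne (g := fun y => ((n : ℝ) + 2) * max y 0 ^ (n + 1))
      hne (by fun_prop) (by fun_prop)
  · exact hne x hx

/-- The profile, positive exactly on `(-∞, 1)`. -/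
noncomputable def prof (x : ℝ) : ℝ :=
  3 / 10 - (max x 0 ^ 3 - max x 0 ^ 4 + 3 / 10 * max x 0 ^ 5)

/-- Minus the derivative of the profile. -/
noncomputable def prof₁ (x : ℝ) : ℝ := 3 * max x 0 ^ 2 - 4 * max x 0 ^ 3 + 3 / 2 * max x 0 ^ 4

/-- Minus the second derivative of the profile. -/
noncomputable def prof₂ (x : ℝ) : ℝ := 6 * max x 0 * (1 - max x 0) ^ 2

theorem hasDerivAt_prof (x : ℝ) : HasDerivAt prof (-prof₁ x) x := by
  have h1 := hasDerivAt_max_zero_pow 1 x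
  have h2 := hasDerivAt_max_zero_pow 2 x
  have h3 := hasDerivAt_max_zero_pow 3 x
  refine (((h1.sub h2).add (h3.const_mul (3 / 10))).const_sub (3 / 10)).congr_deriv ?_
  rw [prof₁]; push_cast; ring

theorem hasDerivAt_prof₁ (x : ℝ) : HasDerivAt prof₁ (prof₂ x) x := by
  have h1 := hasDerivAt_max_zero_pow 0 x
  have h2 := hasDerivAt_max_zero_pow 1 x
  have h3 := hasDerivAt_max_zero_pow 2 x
  refine (((h1.const_mul 3).sub (h2.const_mul 4)).add (h3.const_mul (3 / 2))).congr_deriv ?_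
  rw [prof₂]; push_cast; ring

theorem continuous_prof : Continuous prof :=
  continuous_iff_continuousAt.2 fun x => (hasDerivAt_prof x).continuousAt

theorem continuous_prof₁ : Continuous prof₁ :=
  continuous_iff_continuousAt.2 fun x => (hasDerivAt_prof₁ x).continuousAt

theorem continuous_prof₂ : Continuous prof₂ := by unfold prof₂; fun_prop

theorem prof₁_nonneg (x : ℝ) : 0 ≤ prof₁ x := by
  rw [prof₁]
  have : 0 ≤ max x 0 ^ 2 * ((max x 0 - 4 / 3) ^ 2 * (3 / 2) + 1 / 3) := by positivity
  linarith

theorem prof₂_nonneg (x : ℝ) : 0 ≤ prof₂ x := by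
  rw [prof₂]
  have := le_max_right x 0
  positivity

theorem prof_eq (x : ℝ) : prof x = (1 - max x 0) * (3 / 10 + 3 / 10 * max x 0 + 3 / 10 * max x 0 ^ 2
    - 7 / 10 * max x 0 ^ 3 + 3 / 10 * max x 0 ^ 4) := by
  rw [prof]; ring

theorem prof_factor_pos {p : ℝ} (hp : 0 ≤ p) :
    0 < 3 / 10 + 3 / 10 * p + 3 / 10 * p ^ 2 - 7 / 10 * p ^ 3 + 3 / 10 * p ^ 4 := by
  nlinarith [mul_nonneg hp (sq_nonneg (p - 1)), sq_nonneg (p * (p - 7 / 6)), sq_nonneg p]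

theorem prof_one : prof 1 = 0 := by rw [prof_eq]; simp

theorem prof₁_one : prof₁ 1 = 1 / 2 := by rw [prof₁]; norm_num

theorem prof₁_of_nonpos {x : ℝ} (hx : x ≤ 0) : prof₁ x = 0 := by
  rw [prof₁, max_eq_right hx]; simp

theorem prof_neg {x : ℝ} (hx : 1 < x) : prof x < 0 := by
  rw [prof_eq, max_eq_left (by linarith)]
  exact mul_neg_of_neg_of_pos (by linarith) (prof_factor_pos (by linarith))

theorem prof_pos {x : ℝ} (hx : x < 1) : 0 < prof x := by
  rw [prof_eq]
  exact mul_pos (sub_pos.2 (max_lt hx one_pos)) (prof_factor_pos (le_max_right _ _))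

theorem eq_one_of_prof_eq_zero {x : ℝ} (hx : prof x = 0) : x = 1 := by
  rcases lt_trichotomy x 1 with h | h | h
  · exact absurd hx (prof_pos h).ne'
  · exact h
  · exact absurd hx (prof_neg h).ne

theorem prof_antitone : Antitone prof :=
  antitone_of_hasDerivAt_nonpos hasDerivAt_prof fun x => neg_nonpos.2 (prof₁_nonneg x)

theorem prof_le (x : ℝ) : prof x ≤ 3 / 10 := by
  rcases le_total x 0 with h | h
  · rw [prof, max_eq_right h]; norm_num
  · exact (prof_antitone h).trans (by rw [prof]; simp)

theorem prof₂_le {x : ℝ} (hx : x ≤ 1) : prof₂ x ≤ 20 * prof x := by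
  rw [prof₂, prof]
  obtain ⟨p, hp⟩ : ∃ p, p = max x 0 := ⟨_, rfl⟩
  have h0 : 0 ≤ p := hp ▸ le_max_right _ _
  have h1 : p ≤ 1 := hp ▸ max_le hx zero_le_one
  rw [← hp]
  have : 0 ≤ (1 - p) * (6 + p ^ 2 * (6 * (p - 7 / 6) ^ 2 + 23 / 6)) :=
    mul_nonneg (by linarith) (by positivity)
  nlinarith

theorem le_mul_arctan (v : ℝ) : Real.pi / 2 * |v| - 1 ≤ v * Real.arctan v := by
  have key : ∀ v : ℝ, 0 < v → Real.pi / 2 * v - 1 ≤ v * Real.arctan v := by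
    intro v hv
    have h1 := Real.arctan_inv_of_pos hv
    have h2 : Real.arctan v⁻¹ ≤ v⁻¹ := by
      have := Real.le_tan (x := Real.arctan v⁻¹) (Real.arctan_nonneg.2 (by positivity))
        (Real.arctan_lt_pi_div_two _)
      rwa [Real.tan_arctan] at this
    have h3 : Real.arctan v = Real.pi / 2 - Real.arctan v⁻¹ := by linarith
    have h4 : v * Real.arctan v⁻¹ ≤ v * v⁻¹ := mul_le_mul_of_nonneg_left h2 hv.le
    rw [mul_inv_cancel₀ hv.ne'] at h4
    rw [h3]; linarith
  rcases lt_trichotomy v 0 with h | h | h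
  · have := key (-v) (by linarith)
    rw [Real.arctan_neg] at this
    rw [abs_of_neg h]; linarith
  · subst h; simp
  · rw [abs_of_pos h]; exact key v h

theorem mul_arctan_nonneg (v : ℝ) : 0 ≤ v * Real.arctan v := by
  rcases le_total 0 v with h | h
  · exact mul_nonneg h (Real.arctan_nonneg.2 h)
  · exact mul_nonneg_of_nonpos_of_nonpos h (by simpa using Real.arctan_strictMono.monotone h)

theorem exists_exit {X : ℝ → ℝ} {z y : ℝ} (hzy : z ≤ y) (hX : ContinuousOn X (Icc z y))
    (hz : X z ≤ 0) (hy : X y = 1) : ∃ e ∈ Icc z y, X e = 1 ∧ ∀ x ∈ Icc z e, X x ≤ 1 := by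
  have hc : IsCompact (Icc z y ∩ X ⁻¹' {1}) :=
    isCompact_Icc.of_isClosed_subset (hX.preimage_isClosed_of_isClosed isClosed_Icc
      isClosed_singleton) inter_subset_left
  obtain ⟨e, he, hmin⟩ := hc.exists_isLeast ⟨y, ⟨hzy, le_rfl⟩, hy⟩
  refine ⟨e, he.1, he.2, fun x hx => ?_⟩
  by_contra! h1
  obtain ⟨q, hq, hq1⟩ := intermediate_value_Icc hx.1
    (hX.mono (Icc_subset_Icc le_rfl (hx.2.trans he.1.2))) (show (1 : ℝ) ∈ Icc (X z) (X x) from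
      ⟨by linarith, h1.le⟩)
  have h2 := hmin (show q ∈ Icc z y ∩ X ⁻¹' {1} from
    ⟨⟨hq.1, hq.2.trans (hx.2.trans he.1.2)⟩, hq1⟩)
  have : x = q := le_antisymm (hx.2.trans h2) hq.2
  rw [this, hq1] at h1
  exact h1.false

theorem half_excursion {X v : ℝ → ℝ} {p z y : ℝ} (hp : 0 < p) (hzy : z ≤ y)
    (hX : ∀ x ∈ Icc z y, HasDerivAt X (p * v x) x) (hv : ContinuousOn v (Icc z y))
    (hz : X z ≤ 0) (hy : X y = 1) (hmax : ∀ x ∈ Icc z y, 0 ≤ ∫ t in x..y, prof (X t)) :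
    Real.pi / 4 - 20 * p * ∫ t in z..y, prof (X t) ≤
      p * ∫ t in z..y, prof₂ (X t) * (v t * Real.arctan (v t)) := by
  have hXc : ContinuousOn X (Icc z y) := fun x hx => (hX x hx).continuousAt.continuousWithinAt
  obtain ⟨e, he, heX, hle⟩ := exists_exit hzy hXc hz hy
  have hc1 : ContinuousOn (fun t => prof (X t)) (Icc z y) := continuous_prof.comp_continuousOn hXc
  have hc2 : ContinuousOn (fun t => prof₂ (X t)) (Icc z y) := continuous_prof₂.comp_continuousOn hXc
  have hc3 : ContinuousOn (fun t => prof₂ (X t) * (v t * Real.arctan (v t))) (Icc z y) :=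
    hc2.mul (hv.mul (Real.continuous_arctan.comp_continuousOn hv))
  have hsub1 : Icc z e ⊆ Icc z y := Icc_subset_Icc le_rfl he.2
  have hsub2 : Icc e y ⊆ Icc z y := Icc_subset_Icc he.1 le_rfl
  have i1 : ∀ {f : ℝ → ℝ}, ContinuousOn f (Icc z y) → IntervalIntegrable f volume z e :=
    fun hf => (hf.mono hsub1).intervalIntegrable_of_Icc he.1
  have i2 : ∀ {f : ℝ → ℝ}, ContinuousOn f (Icc z y) → IntervalIntegrable f volume e y :=
    fun hf => (hf.mono hsub2).intervalIntegrable_of_Icc he.2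
  have hcv : ContinuousOn (fun t => prof₂ (X t) * (p * v t)) (Icc z y) := hc2.mul (hv.const_mul p)
  have hcv' : ContinuousOn (fun t => Real.pi / 2 * (prof₂ (X t) * (p * v t))) (Icc z y) :=
    hcv.const_mul _
  have hcp : ContinuousOn (fun t => 20 * p * prof (X t)) (Icc z y) := hc1.const_mul _
  have hFTC : ∫ t in z..e, prof₂ (X t) * (p * v t) = 1 / 2 := by
    rw [intervalIntegral.integral_eq_sub_of_hasDerivAt (f := fun t => prof₁ (X t))
      (fun t ht => ?_) (i1 hcv)]
    · rw [heX, prof₁_one, prof₁_of_nonpos hz]; ring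
    · rw [uIcc_of_le he.1] at ht
      exact (hasDerivAt_prof₁ (X t)).comp t (hX t (hsub1 ht))
  have h1 : Real.pi / 2 * (∫ t in z..e, prof₂ (X t) * (p * v t)) -
      20 * p * ∫ t in z..e, prof (X t) ≤
      p * ∫ t in z..e, prof₂ (X t) * (v t * Real.arctan (v t)) := by
    rw [← intervalIntegral.integral_const_mul, ← intervalIntegral.integral_const_mul,
      ← intervalIntegral.integral_const_mul, ← intervalIntegral.integral_sub
        (i1 hcv') (i1 hcp)]
    refine intervalIntegral.integral_mono_on he.1
      (i1 (hcv'.sub hcp)) (i1 (hc3.const_mul p)) fun t ht => ?_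
    have h2 := prof₂_le (hle t ht)
    have h3 := le_mul_arctan (v t)
    have h4 : Real.pi / 2 * v t ≤ Real.pi / 2 * |v t| :=
      mul_le_mul_of_nonneg_left (le_abs_self _) (by positivity)
    have h5 : prof₂ (X t) * (Real.pi / 2 * v t - 1) ≤ prof₂ (X t) * (v t * Real.arctan (v t)) :=
      mul_le_mul_of_nonneg_left (by linarith) (prof₂_nonneg _)
    have h6 := mul_le_mul_of_nonneg_left h5 hp.le
    have h7 := mul_le_mul_of_nonneg_left h2 hp.le
    linarith
  have h2 : 0 ≤ ∫ t in e..y, prof₂ (X t) * (v t * Real.arctan (v t)) :=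
    intervalIntegral.integral_nonneg he.2 fun t _ =>
      mul_nonneg (prof₂_nonneg _) (mul_arctan_nonneg _)
  have h3 := hmax e he
  rw [← intervalIntegral.integral_add_adjacent_intervals (i1 hc1) (i2 hc1),
    ← intervalIntegral.integral_add_adjacent_intervals (i1 hc3) (i2 hc3)]
  rw [hFTC] at h1
  have h4 := mul_nonneg hp.le h2
  have h5 := mul_nonneg hp.le h3
  linarith

/-- The dissipation inequality for the weighted area at a maximal interval. -/
theorem excursion_le {u v w : ℝ → ℝ} {p q κ y₁ z y₂ : ℝ} (hp : 0 < p) (hκ : 0 ≤ κ)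
    (h1 : y₁ ≤ z) (h2 : z ≤ y₂)
    (hu : ∀ x ∈ Icc y₁ y₂, HasDerivAt u (v x) x) (hv : ∀ x ∈ Icc y₁ y₂, HasDerivAt v (w x) x)
    (hw : ContinuousOn w (Icc y₁ y₂)) (hpos : ∀ x ∈ Icc y₁ y₂, 0 < u x)
    (hz : p * u z - q ≤ 0) (hy₁ : p * u y₁ - q = 1) (hy₂ : p * u y₂ - q = 1)
    (hmax₁ : ∀ x ∈ Icc y₁ z, 0 ≤ ∫ t in y₁..x, prof (p * u t - q))
    (hmax₂ : ∀ x ∈ Icc z y₂, 0 ≤ ∫ t in x..y₂, prof (p * u t - q)) :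
    ∫ y in y₁..y₂, prof₁ (p * u y - q) * (p * (w y / (1 + v y ^ 2) - y / 2 * v y - κ / u y)) ≤
      (20 * p ^ 2 - 1 / 2) * ∫ y in y₁..y₂, prof (p * u y - q) := by
  have h12 := h1.trans h2
  obtain ⟨X, hXd⟩ : ∃ X : ℝ → ℝ, X = fun y => p * u y - q := ⟨_, rfl⟩
  have hX : ∀ x ∈ Icc y₁ y₂, HasDerivAt X (p * v x) x := fun x hx => by
    rw [hXd]; exact ((hu x hx).const_mul p).sub_const q
  have hXe : ∀ y, p * u y - q = X y := fun y => by rw [hXd]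
  simp only [hXe] at *
  have huc : ContinuousOn u (Icc y₁ y₂) := fun x hx => (hu x hx).continuousAt.continuousWithinAt
  have hvc : ContinuousOn v (Icc y₁ y₂) := fun x hx => (hv x hx).continuousAt.continuousWithinAt
  have hXc : ContinuousOn X (Icc y₁ y₂) := fun x hx => (hX x hx).continuousAt.continuousWithinAt
  have hc0 : ContinuousOn (fun t => prof (X t)) (Icc y₁ y₂) := continuous_prof.comp_continuousOn hXc
  have hc1 : ContinuousOn (fun t => prof₁ (X t)) (Icc y₁ y₂) :=
    continuous_prof₁.comp_continuousOn hXc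
  have hc2 : ContinuousOn (fun t => prof₂ (X t)) (Icc y₁ y₂) :=
    continuous_prof₂.comp_continuousOn hXc
  have hca : ContinuousOn (fun t => Real.arctan (v t)) (Icc y₁ y₂) :=
    Real.continuous_arctan.comp_continuousOn hvc
  have hc3 : ContinuousOn (fun t => prof₂ (X t) * (v t * Real.arctan (v t))) (Icc y₁ y₂) :=
    hc2.mul (hvc.mul hca)
  have hcw : ContinuousOn (fun t => w t / (1 + v t ^ 2)) (Icc y₁ y₂) :=
    hw.div (by fun_prop) fun y _ => by positivity
  have hcy : ContinuousOn (fun y : ℝ => y / 2) (Icc y₁ y₂) := by fun_prop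
  have hck : ContinuousOn (fun y => κ / u y) (Icc y₁ y₂) :=
    continuousOn_const.div huc fun y hy => (hpos y hy).ne'
  have hct : ContinuousOn (fun y => y / 2 * (prof₁ (X y) * (p * v y))) (Icc y₁ y₂) :=
    hcy.mul (hc1.mul (hvc.const_mul p))
  have hcc : ContinuousOn (fun y => prof₁ (X y) * (w y / (1 + v y ^ 2))) (Icc y₁ y₂) := hc1.mul hcw
  have hcc' : ContinuousOn (fun y => p * (prof₁ (X y) * (w y / (1 + v y ^ 2)))) (Icc y₁ y₂) :=
    hcc.const_mul p
  have hc3' : ContinuousOn (fun t => p * (prof₂ (X t) * (v t * Real.arctan (v t)))) (Icc y₁ y₂) :=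
    hc3.const_mul p
  have hch : ContinuousOn (fun y => prof (X y) / 2) (Icc y₁ y₂) := hc0.div_const 2
  have hcT : ContinuousOn (fun y => prof (X y) / 2 - y / 2 * (prof₁ (X y) * (p * v y)))
      (Icc y₁ y₂) := hch.sub hct
  have hcA : ContinuousOn (fun y => prof₂ (X y) * (p * v y) * Real.arctan (v y) +
      prof₁ (X y) * (w y / (1 + v y ^ 2))) (Icc y₁ y₂) :=
    ((hc2.mul (hvc.const_mul p)).mul hca).add hcc
  have ii : ∀ {f : ℝ → ℝ}, ContinuousOn f (Icc y₁ y₂) → IntervalIntegrable f volume y₁ y₂ :=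
    fun hf => hf.intervalIntegrable_of_Icc h12
  have il : ∀ {f : ℝ → ℝ}, ContinuousOn f (Icc y₁ y₂) → IntervalIntegrable f volume y₁ z :=
    fun hf => (hf.mono (Icc_subset_Icc le_rfl h2)).intervalIntegrable_of_Icc h1
  have ir : ∀ {f : ℝ → ℝ}, ContinuousOn f (Icc y₁ y₂) → IntervalIntegrable f volume z y₂ :=
    fun hf => (hf.mono (Icc_subset_Icc h1 le_rfl)).intervalIntegrable_of_Icc h2
  -- the transport term
  have hT : ∫ y in y₁..y₂, (prof (X y) / 2 - y / 2 * (prof₁ (X y) * (p * v y))) = 0 := by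
    rw [intervalIntegral.integral_eq_sub_of_hasDerivAt (f := fun y => y / 2 * prof (X y))
      (fun y hy => ?_) (ii hcT)]
    · rw [hy₁, hy₂, prof_one]; ring
    · rw [uIcc_of_le h12] at hy
      exact (((hasDerivAt_id y).div_const 2).mul ((hasDerivAt_prof (X y)).comp y
        (hX y hy))).congr_deriv (by simp only [id_eq, Function.comp]; ring)
  -- the curvature term
  have hA : ∫ y in y₁..y₂, (prof₂ (X y) * (p * v y) * Real.arctan (v y) +
      prof₁ (X y) * (w y / (1 + v y ^ 2))) = (Real.arctan (v y₂) - Real.arctan (v y₁)) / 2 := by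
    rw [intervalIntegral.integral_eq_sub_of_hasDerivAt
      (f := fun y => prof₁ (X y) * Real.arctan (v y)) (fun y hy => ?_)
      (ii hcA)]
    · rw [hy₁, hy₂, prof₁_one]; ring
    · rw [uIcc_of_le h12] at hy
      exact (((hasDerivAt_prof₁ (X y)).comp y (hX y hy)).mul (hv y hy).arctan).congr_deriv
        (by simp only [Function.comp]; ring)
  have hR := half_excursion hp h2 (fun x hx => hX x ⟨h1.trans hx.1, hx.2⟩)
    (hvc.mono (Icc_subset_Icc h1 le_rfl)) hz hy₂ hmax₂
  have hL := half_excursion (X := fun y => X (-y)) (v := fun y => -v (-y)) (z := -z) (y := -y₁) hp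
    (by linarith)
    (fun x hx => ((hX (-x) ⟨by linarith [hx.2], by linarith [hx.1]⟩).comp x
      (hasDerivAt_neg x)).congr_deriv (by ring))
    ((hvc.comp continuousOn_neg fun x hx => ⟨by linarith [hx.2], by linarith [hx.1]⟩).neg)
    (by simpa using hz) (by simpa using hy₁) fun x hx => by
      rw [intervalIntegral.integral_comp_neg fun t => prof (X t), neg_neg]
      exact hmax₁ (-x) ⟨by linarith [hx.2], by linarith [hx.1]⟩
  simp only [Real.arctan_neg, neg_mul_neg] at hL
  rw [intervalIntegral.integral_comp_neg fun t => prof (X t),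
    intervalIntegral.integral_comp_neg fun t => prof₂ (X t) * (v t * Real.arctan (v t)),
    neg_neg, neg_neg] at hL
  have e0 := intervalIntegral.integral_add_adjacent_intervals (il hc0) (ir hc0)
  have e3 := intervalIntegral.integral_add_adjacent_intervals (il hc3) (ir hc3)
  have hA' : p * (∫ y in y₁..y₂, prof₂ (X y) * (v y * Real.arctan (v y))) +
      ∫ y in y₁..y₂, prof₁ (X y) * (w y / (1 + v y ^ 2)) =
      (Real.arctan (v y₂) - Real.arctan (v y₁)) / 2 := by
    rw [← hA, ← intervalIntegral.integral_const_mul, ← intervalIntegral.integral_add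
      (ii hc3') (ii hcc)]
    refine intervalIntegral.integral_congr fun y _ => ?_
    ring
  have hT' : (∫ y in y₁..y₂, prof (X y)) / 2 -
      ∫ y in y₁..y₂, y / 2 * (prof₁ (X y) * (p * v y)) = 0 := by
    rw [← hT, ← intervalIntegral.integral_div, ← intervalIntegral.integral_sub
      (ii hch) (ii hct)]
  have hI : ∫ y in y₁..y₂, prof₁ (X y) * (p * (w y / (1 + v y ^ 2) - y / 2 * v y - κ / u y)) ≤
      p * (∫ y in y₁..y₂, prof₁ (X y) * (w y / (1 + v y ^ 2))) -
      ∫ y in y₁..y₂, y / 2 * (prof₁ (X y) * (p * v y)) := by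
    rw [← intervalIntegral.integral_const_mul, ← intervalIntegral.integral_sub
      (ii hcc') (ii hct)]
    refine intervalIntegral.integral_mono_on h12
      (ii (hc1.mul (((hcw.sub (hcy.mul hvc)).sub hck).const_mul p)))
      (ii (hcc'.sub hct)) fun y hy => ?_
    have : 0 ≤ prof₁ (X y) * (p * (κ / u y)) :=
      mul_nonneg (prof₁_nonneg _) (mul_nonneg hp.le (div_nonneg hκ (hpos y hy).le))
    linarith
  have ha1 := Real.arctan_lt_pi_div_two (v y₂)
  have ha2 := Real.neg_pi_div_two_lt_arctan (v y₁)
  have hfin : ∫ y in y₁..y₂, prof₁ (X y) * (w y / (1 + v y ^ 2)) ≤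
      20 * p * ∫ y in y₁..y₂, prof (X y) := by
    rw [← e0]; rw [← e3] at hA'
    linarith
  have := mul_le_mul_of_nonneg_left hfin hp.le
  linarith

/-! ### Thin necks far from the lateral boundary cannot appear out of nothing -/

/-- The scaling factor compensating the zeroth order term `u / 2`. -/
noncomputable def scale (P s₀ s : ℝ) : ℝ := P * Real.exp (-(s - s₀) / 2)

theorem scale_pos {P : ℝ} (hP : 0 < P) (s₀ s : ℝ) : 0 < scale P s₀ s := by
  unfold scale; positivity

theorem scale_le {P : ℝ} (hP : 0 < P) {s₀ s : ℝ} (h : s₀ ≤ s) : scale P s₀ s ≤ P := by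
  unfold scale
  exact mul_le_of_le_one_right hP.le (Real.exp_le_one_iff.2 (by linarith))

theorem hasDerivAt_scale (P s₀ s : ℝ) : HasDerivAt (scale P s₀) (-(scale P s₀ s) / 2) s := by
  have h1 : HasDerivAt (fun s : ℝ => -(s - s₀) / 2) (-1 / 2) s :=
    (((hasDerivAt_id s).sub_const s₀).neg.div_const 2)
  refine (h1.exp.const_mul P).congr_deriv ?_
  unfold scale; ring

theorem Sol.profStrip (h : Sol κ Ω u v w g) {a b c T L P s₀ : ℝ} (hP : 0 < P)
    (hgood : ∀ y ∈ Icc a b, ∀ t ∈ Ioo c T, LocBdd Ω g (y, t))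
    (hL : ∀ y ∈ Icc a b, ∀ t ∈ Ioo c T, u y t ≤ L) :
    TStrip a b c T (fun y s => prof (scale P s₀ s * u y s - 1))
      (fun y s => -prof₁ (scale P s₀ s * u y s - 1) * (scale P s₀ s * (g y s - u y s / 2))) where
  deriv_t y hy t ht := by
    have h1 := ((hasDerivAt_scale P s₀ t).mul (h.hg y t (hgood y hy t ht).mem)).sub_const 1
    refine ((hasDerivAt_prof _).comp t h1).congr_deriv ?_
    simp only [Pi.mul_apply]
    ring
  cont t ht := by
    have := (h.strip hgood).cont t ht
    exact continuous_prof.comp_continuousOn (f := fun y => scale P s₀ t * u y t - 1)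
      (by fun_prop)
  cont_g t ht := by
    have h1 := (h.strip hgood).cont t ht
    have h2 := (h.strip hgood).cont_g t ht
    have h3 := continuous_prof₁.comp_continuousOn (s := Icc a b)
      (f := fun y => scale P s₀ t * u y t - 1) (by fun_prop)
    exact h3.neg.mul (by fun_prop : ContinuousOn (fun y => scale P s₀ t * (g y t - u y t / 2)) _)
  bdd t ht := by
    obtain ⟨ε, hε, K, hK⟩ := (h.strip hgood).bdd t ht
    obtain ⟨M, hM⟩ :=
      (isCompact_Icc (a := (-1 : ℝ)) (b := scale P s₀ c * L)).exists_bound_of_continuousOn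
      continuous_prof₁.continuousOn
    refine ⟨ε, hε, |M| * (scale P s₀ c * (K + L / 2)), fun s hs hst y hy => ?_⟩
    have hu := h.pos y s (hgood y hy s hs).mem
    have hu' := hL y hy s hs
    have hsc : scale P s₀ s ≤ scale P s₀ c := by
      unfold scale
      gcongr
      linarith [hs.1]
    have hs0 := scale_pos hP s₀ s
    have hb : |prof₁ (scale P s₀ s * u y s - 1)| ≤ |M| :=
      (hM _ ⟨by linarith [mul_pos hs0 hu], by
        have := mul_le_mul hsc hu' hu.le (hs0.le.trans hsc); linarith⟩).trans (le_abs_self M)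
    rw [abs_mul, abs_neg, abs_mul, abs_of_pos hs0]
    have hc0 := scale_pos hP s₀ c
    have hg : |g y s - u y s / 2| ≤ K + L / 2 := by
      refine (abs_sub _ _).trans (add_le_add (hK s hs hst y hy) ?_)
      rw [abs_of_pos (by positivity)]; linarith
    gcongr

theorem Sol.excursion_persist (h : Sol κ Ω u v w g) {a b c T L P s₀ s' s₁ A C z y₁ y₂ : ℝ}
    (hP : 0 < P) (hgood : ∀ y ∈ Icc a b, ∀ t ∈ Ioo c T, LocBdd Ω g (y, t))
    (hL : ∀ y ∈ Icc a b, ∀ t ∈ Ioo c T, u y t ≤ L) (hcs : c < s') (hss : s' ≤ s₁) (hsT : s₁ < T)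
    (hz : z ∈ Icc a b) (hslit : ∀ s ∈ Icc s' s₁, scale P s₀ s * u z s - 1 ≤ 0)
    (hside : ∀ s ∈ Icc s' s₁, 1 < scale P s₀ s * u a s - 1 ∧ 1 < scale P s₀ s * u b s - 1)
    (hC : ∀ s ∈ Icc s' s₁, 20 * scale P s₀ s ^ 2 - 1 / 2 < C) (hA : 0 ≤ A)
    (hy₁ : y₁ ∈ Icc a z) (hy₂ : y₂ ∈ Icc z b)
    (hlt : A < (∫ y in y₁..y₂, prof (scale P s₀ s' * u y s' - 1)) * Real.exp (C * s')) :
    ∃ y₁ ∈ Icc a z, ∃ y₂ ∈ Icc z b,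
      A < (∫ y in y₁..y₂, prof (scale P s₀ s₁ * u y s₁ - 1)) * Real.exp (C * s₁) := by
  have hs := h.strip hgood
  have hZ := h.profStrip (s₀ := s₀) hP hgood hL
  obtain ⟨Z, hZdef⟩ : ∃ Z : ℝ → ℝ → ℝ, Z = fun y s => prof (scale P s₀ s * u y s - 1) := ⟨_, rfl⟩
  have hZa : ∀ y s, prof (scale P s₀ s * u y s - 1) = Z y s := fun y s => by rw [hZdef]
  simp only [hZa] at hZ hlt ⊢
  have hab : a ≤ b := hz.1.trans hz.2
  have sub1 : Icc a z ⊆ Icc a b := Icc_subset_Icc_right hz.2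
  have sub2 : Icc z b ⊆ Icc a b := Icc_subset_Icc_left hz.1
  have hInt : ∀ s ∈ Icc s' s₁, ∀ x ∈ Icc a b, ∀ x' ∈ Icc a b,
      IntervalIntegrable (fun y => Z y s) volume x x' := fun s hs x hx x' hx' =>
    ((hZ.cont s ⟨hcs.trans_le hs.1, hs.2.trans_lt hsT⟩).mono
      (uIcc_subset_Icc hx hx')).intervalIntegrable
  have hF := hZ.continuousOn_integral hab hcs hss hsT
  have hsplit : ∀ s ∈ Icc s' s₁, ∀ x ∈ Icc a b, ∀ x' ∈ Icc a b, ∫ y in x..x', Z y s =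
      (∫ y in a..x', Z y s) - ∫ y in a..x, Z y s := fun s hs x hx x' hx' =>
    (intervalIntegral.integral_interval_sub_left (hInt s hs a ⟨le_rfl, hab⟩ x' hx')
      (hInt s hs a ⟨le_rfl, hab⟩ x hx)).symm
  obtain ⟨⟨x₁, x₂, s⟩, ⟨hx₁, hx₂, hsI⟩, hmax⟩ := (isCompact_Icc.prod
      (isCompact_Icc.prod isCompact_Icc) :
      IsCompact (Icc a z ×ˢ Icc z b ×ˢ Icc s' s₁)).exists_isMaxOn
    ⟨(y₁, y₂, s'), hy₁, hy₂, le_rfl, hss⟩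
    (f := fun p : ℝ × ℝ × ℝ => ((∫ y in a..p.2.1, Z y p.2.2) - ∫ y in a..p.1, Z y p.2.2) *
      Real.exp (C * p.2.2))
    (ContinuousOn.mul (ContinuousOn.sub
      (hF.comp (f := fun p : ℝ × ℝ × ℝ => (p.2.1, p.2.2)) (by fun_prop)
        fun p hp => ⟨sub2 hp.2.1, hp.2.2⟩)
      (hF.comp (f := fun p : ℝ × ℝ × ℝ => (p.1, p.2.2)) (by fun_prop)
        fun p hp => ⟨sub1 hp.1, hp.2.2⟩)) (by fun_prop))
  simp only at hx₁ hx₂ hsI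
  replace hmax : ∀ q₁ ∈ Icc a z, ∀ q₂ ∈ Icc z b, ∀ r ∈ Icc s' s₁,
      (∫ y in q₁..q₂, Z y r) * Real.exp (C * r) ≤ (∫ y in x₁..x₂, Z y s) * Real.exp (C * s) := by
    intro q₁ hq₁ q₂ hq₂ r hr
    rw [hsplit r hr q₁ (sub1 hq₁) q₂ (sub2 hq₂), hsplit s hsI x₁ (sub1 hx₁) x₂ (sub2 hx₂)]
    exact hmax (show (q₁, q₂, r) ∈ Icc a z ×ˢ Icc z b ×ˢ Icc s' s₁ from ⟨hq₁, hq₂, hr⟩)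
  have hval := hlt.trans_le (hmax y₁ hy₁ y₂ hy₂ s' ⟨le_rfl, hss⟩)
  rcases hsI.2.eq_or_lt with hs1 | hs1
  · exact ⟨x₁, hx₁, x₂, hx₂, by rwa [hs1] at hval⟩
  exfalso
  have hK : 0 < ∫ y in x₁..x₂, Z y s := pos_of_mul_pos_left (hA.trans_lt hval) (Real.exp_pos _).le
  have hsT' : s ∈ Ioo c T := ⟨hcs.trans_le hsI.1, hs1.trans hsT⟩
  have hmaxy : ∀ q₁ ∈ Icc a z, ∀ q₂ ∈ Icc z b, ∫ y in q₁..q₂, Z y s ≤ ∫ y in x₁..x₂, Z y s :=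
    fun q₁ hq₁ q₂ hq₂ => le_of_mul_le_mul_right (hmax q₁ hq₁ q₂ hq₂ s hsI) (Real.exp_pos _)
  have hadd : ∀ q ∈ Icc a b, ∀ q' ∈ Icc a b, ∀ q'' ∈ Icc a b,
      (∫ y in q..q', Z y s) + ∫ y in q'..q'', Z y s = ∫ y in q..q'', Z y s :=
    fun q hq q' hq' q'' hq'' => intervalIntegral.integral_add_adjacent_intervals
      (hInt s hsI q hq q' hq') (hInt s hsI q' hq' q'' hq'')
  have hmaxr : ∀ q ∈ Icc z b, ∫ y in z..q, Z y s ≤ ∫ y in z..x₂, Z y s := fun q hq => by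
    have := hmaxy x₁ hx₁ q hq
    rw [← hadd x₁ (sub1 hx₁) z hz q (sub2 hq), ← hadd x₁ (sub1 hx₁) z hz x₂ (sub2 hx₂)] at this
    linarith
  have hmaxl : ∀ q ∈ Icc a z, ∫ y in q..z, Z y s ≤ ∫ y in x₁..z, Z y s := fun q hq => by
    have := hmaxy q hq x₂ hx₂
    rw [← hadd x₁ (sub1 hx₁) z hz x₂ (sub2 hx₂), ← hadd q (sub1 hq) z hz x₂ (sub2 hx₂)] at this
    linarith
  have hZz : 0 < Z z s := by
    rw [← hZa]; exact prof_pos (by linarith [hslit s hsI])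
  have hZa' : Z a s < 0 := by rw [← hZa]; exact prof_neg (hside s hsI).1
  have hZb' : Z b s < 0 := by rw [← hZa]; exact prof_neg (hside s hsI).2
  have haz : a < z := lt_of_le_of_ne hz.1 fun e => by rw [← e] at hZz; linarith
  have hzb : z < b := lt_of_le_of_ne hz.2 fun e => by rw [e] at hZz; linarith
  have hprim := hZ.hasDerivAt_primitive ⟨haz, hzb⟩ hsT'
  have hzx₂ : z < x₂ := by
    refine lt_of_le_of_ne hx₂.1 fun e => ?_
    have := deriv_nonpos_of_le_right hprim hzb fun q hq => by
      have := hmaxr q ⟨hq.1.le, hq.2.le⟩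
      rw [← e, intervalIntegral.integral_same,
        hsplit s hsI z hz q ⟨hz.1.trans hq.1.le, hq.2.le⟩] at this
      linarith
    linarith
  have hx₁z : x₁ < z := by
    refine lt_of_le_of_ne hx₁.2 fun e => ?_
    have := deriv_nonneg_of_le_left hprim.neg haz fun q hq => by
      have := hmaxl q ⟨hq.1.le, hq.2.le⟩
      rw [e, intervalIntegral.integral_same,
        hsplit s hsI q ⟨hq.1.le, hq.2.le.trans hz.2⟩ z hz] at this
      simp only [Pi.neg_apply]
      linarith
    linarith
  have hZd : ∀ y ∈ Icc a b, HasDerivAt (fun y => Z y s)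
      (-prof₁ (scale P s₀ s * u y s - 1) * (scale P s₀ s * v y s)) y := fun y hy => by
    rw [hZdef]
    exact (hasDerivAt_prof _).comp y (((hs.hv y hy s hsT').const_mul _).sub_const 1)
  obtain ⟨-, hz2, -⟩ := integral_max_right ((hZ.cont s hsT').mono sub2) le_rfl hzx₂ hx₂.2 hZb'
    (hZd x₂ (sub2 hx₂)) fun q hq hq' => hmaxr q ⟨hq, hq'⟩
  obtain ⟨-, hz1, -⟩ := integral_max_left ((hZ.cont s hsT').mono sub1) hx₁.1 hx₁z le_rfl hZa'
    (hZd x₁ (sub1 hx₁)) fun q hq hq' => hmaxl q ⟨hq, hq'⟩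
  rw [← hZa] at hz1 hz2
  have sub3 : Icc x₁ x₂ ⊆ Icc a b := Icc_subset_Icc hx₁.1 hx₂.2
  have hexc := excursion_le (u := fun y => u y s) (v := fun y => v y s) (w := fun y => w y s)
    (q := 1) (scale_pos hP s₀ s) h.κ_nonneg hx₁z.le hzx₂.le
    (fun x hx => hs.hv x (sub3 hx) s hsT') (fun x hx => hs.hw x (sub3 hx) s hsT')
    ((hs.cont_w s hsT').mono sub3) (fun x hx => h.pos x s (hgood x (sub3 hx) s hsT').mem)
    (hslit s hsI) (eq_one_of_prof_eq_zero hz1) (eq_one_of_prof_eq_zero hz2)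
    (fun q hq => by
      simp only [hZa]
      have hq' : q ∈ Icc a z := ⟨hx₁.1.trans hq.1, hq.2⟩
      have := hmaxy q hq' x₂ hx₂
      rw [← hadd x₁ (sub1 hx₁) q (sub1 hq') x₂ (sub2 hx₂)] at this
      linarith)
    (fun q hq => by
      simp only [hZa]
      have hq' : q ∈ Icc z b := ⟨hq.1, hq.2.trans hx₂.2⟩
      have := hmaxy x₁ hx₁ q hq'
      rw [← hadd x₁ (sub1 hx₁) q (sub2 hq') x₂ (sub2 hx₂)] at this
      linarith)
  simp only [hZa] at hexc
  have hdK := hZ.hasDerivAt_integral (sub1 hx₁) (sub2 hx₂) hsT'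
  have hexp : HasDerivAt (fun s : ℝ => Real.exp (C * s)) (Real.exp (C * s) * C) s := by
    simpa using ((hasDerivAt_id s).const_mul C).exp
  have hd := deriv_nonpos_of_le_right (hdK.mul hexp) hs1 fun r hr =>
    hmax x₁ hx₁ x₂ hx₂ r ⟨hsI.1.trans hr.1.le, hr.2.le⟩
  have hG : ∫ y in x₁..x₂, -prof₁ (scale P s₀ s * u y s - 1) * (scale P s₀ s * (g y s - u y s / 2))
      = -∫ y in x₁..x₂, prof₁ (scale P s₀ s * u y s - 1) *
        (scale P s₀ s * (w y s / (1 + v y s ^ 2) - y / 2 * v y s - κ / u y s)) := by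
    rw [← intervalIntegral.integral_neg]
    refine intervalIntegral.integral_congr fun y hy => ?_
    rw [uIcc_of_le (hx₁z.trans hzx₂).le] at hy
    rw [h.pde y s (hgood y (sub3 hy) s hsT').mem]
    ring
  rw [hG] at hd
  have hCs := hC s hsI
  have hpos := Real.exp_pos (C * s)
  have : (∫ y in x₁..x₂, Z y s) * C - (20 * scale P s₀ s ^ 2 - 1 / 2) *
      (∫ y in x₁..x₂, Z y s) ≤ 0 := by
    by_contra! hcon
    have := mul_pos hcon hpos
    have h3 := mul_le_mul_of_nonneg_right hexc hpos.le
    linarith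
  nlinarith

theorem half_lt_exp_neg_half {x : ℝ} (hx : x ≤ 1) : 1 / 2 < Real.exp (-x / 2) := by
  rcases eq_or_ne x 0 with rfl | h0
  · norm_num
  · linarith [Real.add_one_lt_exp (div_ne_zero (neg_ne_zero.2 h0) two_ne_zero)]

/-- A thin neck at time `t₁` comes from a thin neck at the earlier time `s₀`, around which the
weighted area is controlled by the one at time `t₁`. -/
theorem Sol.slit_transport (h : Sol κ Ω u v w g) {a b c T L r s₀ t₁ B z : ℝ} (hr : 0 < r)
    (hgood : ∀ y ∈ Icc a b, ∀ t ∈ Ioo c T, LocBdd Ω g (y, t))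
    (hL : ∀ y ∈ Icc a b, ∀ t ∈ Ioo c T, u y t ≤ L) (hcs : c < s₀) (hst : s₀ ≤ t₁) (htT : t₁ < T)
    (h1 : t₁ - s₀ ≤ 1) (h2 : 2 * (κ + 1) * (t₁ - s₀) ≤ r ^ 2 / 32)
    (hside : ∀ s ∈ Icc s₀ t₁, r ≤ u a s ∧ r ≤ u b s) (hB0 : 0 ≤ B)
    (hB : ∀ y₁ y₂, a ≤ y₁ → y₁ ≤ y₂ → y₂ ≤ b →
      ∫ y in y₁..y₂, prof (scale (4 / r) s₀ t₁ * u y t₁ - 1) ≤ B)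
    (hz : z ∈ Icc a b) (hzt : u z t₁ ≤ r / 6) :
    ∃ z₀ ∈ Icc a b, u z₀ s₀ ≤ r / 4 ∧ ∀ y₂ ∈ Icc z₀ b,
      ∫ y in z₀..y₂, prof (4 / r * u y s₀ - 1) ≤ B * Real.exp (20 * (4 / r) ^ 2) := by
  have hκ := h.κ_nonneg
  have hP : 0 < 4 / r := by positivity
  have hs := h.strip hgood
  have hZ := h.profStrip (s₀ := s₀) hP hgood hL
  obtain ⟨C, hC⟩ : ∃ C, C = 20 * (4 / r) ^ 2 := ⟨_, rfl⟩
  have hC0 : 0 ≤ C := by rw [hC]; positivity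
  obtain ⟨Z, hZdef⟩ : ∃ Z : ℝ → ℝ → ℝ, Z = fun y s => prof (scale (4 / r) s₀ s * u y s - 1) :=
    ⟨_, rfl⟩
  have hZa : ∀ y s, prof (scale (4 / r) s₀ s * u y s - 1) = Z y s := fun y s => by rw [hZdef]
  simp only [hZa] at hZ hB
  have hab : a ≤ b := hz.1.trans hz.2
  have hIoo : ∀ s ∈ Icc s₀ t₁, s ∈ Ioo c T := fun s hs => ⟨hcs.trans_le hs.1, hs.2.trans_lt htT⟩
  have hInt : ∀ s ∈ Icc s₀ t₁, ∀ x ∈ Icc a b, ∀ x' ∈ Icc a b,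
      IntervalIntegrable (fun y => Z y s) volume x x' := fun s hs x hx x' hx' =>
    ((hZ.cont s (hIoo s hs)).mono (uIcc_subset_Icc hx hx')).intervalIntegrable
  have hF := hZ.continuousOn_integral hab hcs hst htT
  have ha : a ∈ Icc a b := ⟨le_rfl, hab⟩
  have hsplit : ∀ s ∈ Icc s₀ t₁, ∀ x ∈ Icc a b, ∀ x' ∈ Icc a b, ∫ y in x..x', Z y s =
      (∫ y in a..x', Z y s) - ∫ y in a..x, Z y s := fun s hs x hx x' hx' =>
    (intervalIntegral.integral_interval_sub_left (hInt s hs a ha x' hx')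
      (hInt s hs a ha x hx)).symm
  obtain ⟨A, hA⟩ : ∃ A, A = B * Real.exp (C * t₁) := ⟨_, rfl⟩
  have hA0 : 0 ≤ A := by rw [hA]; positivity
  have hthin : ∀ z ∈ Icc a b, ∀ s ∈ Icc s₀ t₁,
      u z s ^ 2 - ((r / 6) ^ 2 - 2 * (κ + 1) * (s - t₁)) ≤ 0 → u z s ≤ r / 4 := by
    intro z hz s hs hzs
    have : 2 * (κ + 1) * (t₁ - s) ≤ 2 * (κ + 1) * (t₁ - s₀) := by
      gcongr; exact hs.1
    refine abs_le_of_sq_le_sq' (by nlinarith [sq_nonneg r]) (by positivity) |>.2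
  have hslit : ∀ z ∈ Icc a b, ∀ s ∈ Icc s₀ t₁, u z s ≤ r / 4 →
      scale (4 / r) s₀ s * u z s - 1 ≤ 0 := by
    intro z hz s hs hzs
    have hu := h.pos z s (hgood z hz s (hIoo s hs)).mem
    have : scale (4 / r) s₀ s * u z s ≤ 4 / r * (r / 4) :=
      mul_le_mul (scale_le hP hs.1) hzs hu.le hP.le
    have h3 : 4 / r * (r / 4) = 1 := by field_simp
    linarith
  have hfat : ∀ s ∈ Icc s₀ t₁, ∀ x, r ≤ x → 1 < scale (4 / r) s₀ s * x - 1 := by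
    intro s hs x hx
    have hθ := half_lt_exp_neg_half (x := s - s₀) (by linarith [hs.2])
    unfold scale
    have h3 : 4 / r * Real.exp (-(s - s₀) / 2) * r ≤ 4 / r * Real.exp (-(s - s₀) / 2) * x := by
      gcongr
    have h4 : 4 / r * Real.exp (-(s - s₀) / 2) * r = 4 * Real.exp (-(s - s₀) / 2) := by
      field_simp
    linarith
  -- the compact set of admissible necks
  obtain ⟨W, hW⟩ : ∃ W : Set (ℝ × ℝ), W = {p | p ∈ Icc a b ×ˢ Icc s₀ t₁ ∧
      u p.1 p.2 ^ 2 - ((r / 6) ^ 2 - 2 * (κ + 1) * (p.2 - t₁)) ≤ 0 ∧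
      ∀ x₁ ∈ Icc a b, ∀ x₂ ∈ Icc a b, ((∫ y in a..max x₂ p.1, Z y p.2) -
        ∫ y in a..min x₁ p.1, Z y p.2) * Real.exp (C * p.2) ≤ A} := ⟨_, rfl⟩
  have hDc : IsCompact (Icc a b ×ˢ Icc s₀ t₁) := isCompact_Icc.prod isCompact_Icc
  have hDcl := hDc.isClosed
  have huc : ContinuousOn (fun p : ℝ × ℝ => u p.1 p.2) (Icc a b ×ˢ Icc s₀ t₁) :=
    hs.continuousOn.mono (prod_mono le_rfl fun s hs => hIoo s hs)
  have hWc : IsCompact W := by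
    refine hDc.of_isClosed_subset ?_ (by rw [hW]; exact fun p hp => hp.1)
    have hWi : W = (Icc a b ×ˢ Icc s₀ t₁) ∩ (fun p : ℝ × ℝ => u p.1 p.2 ^ 2 -
        ((r / 6) ^ 2 - 2 * (κ + 1) * (p.2 - t₁))) ⁻¹' Iic 0 ∩
        ⋂ x₁ ∈ Icc a b, ⋂ x₂ ∈ Icc a b, ((Icc a b ×ˢ Icc s₀ t₁) ∩ (fun p : ℝ × ℝ =>
          ((∫ y in a..max x₂ p.1, Z y p.2) - ∫ y in a..min x₁ p.1, Z y p.2) *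
            Real.exp (C * p.2)) ⁻¹' Iic A) := by
      rw [hW]
      ext p
      simp only [mem_ofPred_eq, mem_inter_iff, mem_preimage, mem_Iic, mem_iInter]
      constructor
      · rintro ⟨hD, hp, hx⟩
        exact ⟨⟨hD, hp⟩, fun x₁ hx₁ x₂ hx₂ => ⟨hD, hx x₁ hx₁ x₂ hx₂⟩⟩
      · rintro ⟨⟨hD, hp⟩, hx⟩
        exact ⟨hD, hp, fun x₁ hx₁ x₂ hx₂ => (hx x₁ hx₁ x₂ hx₂).2⟩
    rw [hWi]
    refine IsClosed.inter ?_ (isClosed_biInter fun x₁ hx₁ => isClosed_biInter fun x₂ hx₂ => ?_)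
    · refine ContinuousOn.preimage_isClosed_of_isClosed ?_ hDcl isClosed_Iic
      exact (huc.pow 2).sub (by fun_prop)
    · refine ContinuousOn.preimage_isClosed_of_isClosed ?_ hDcl isClosed_Iic
      refine ContinuousOn.mul (ContinuousOn.sub
        (hF.comp (f := fun p : ℝ × ℝ => (max x₂ p.1, p.2)) (by fun_prop) fun p hp => ?_)
        (hF.comp (f := fun p : ℝ × ℝ => (min x₁ p.1, p.2)) (by fun_prop) fun p hp => ?_))
        (by fun_prop)
      · exact ⟨⟨hx₂.1.trans (le_max_left _ _), max_le hx₂.2 hp.1.2⟩, hp.2⟩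
      · exact ⟨⟨le_min hx₁.1 hp.1.1, (min_le_left _ _).trans hx₁.2⟩, hp.2⟩
  have hWmem : ∀ z s, (z, s) ∈ W ↔ z ∈ Icc a b ∧ s ∈ Icc s₀ t₁ ∧
      u z s ^ 2 - ((r / 6) ^ 2 - 2 * (κ + 1) * (s - t₁)) ≤ 0 ∧
      ∀ y₁ ∈ Icc a z, ∀ y₂ ∈ Icc z b, (∫ y in y₁..y₂, Z y s) * Real.exp (C * s) ≤ A := by
    intro z s
    rw [hW]
    simp only [mem_ofPred_eq, mem_prod]
    constructor
    · rintro ⟨⟨hz, hs⟩, hp, hx⟩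
      refine ⟨hz, hs, hp, fun y₁ hy₁ y₂ hy₂ => ?_⟩
      have hy₁' : y₁ ∈ Icc a b := ⟨hy₁.1, hy₁.2.trans hz.2⟩
      have hy₂' : y₂ ∈ Icc a b := ⟨hz.1.trans hy₂.1, hy₂.2⟩
      have := hx y₁ hy₁' y₂ hy₂'
      rwa [max_eq_left hy₂.1, min_eq_left hy₁.2, ← hsplit s hs y₁ hy₁' y₂ hy₂'] at this
    · rintro ⟨hz, hs, hp, hx⟩
      refine ⟨⟨hz, hs⟩, hp, fun x₁ hx₁ x₂ hx₂ => ?_⟩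
      have hy₁ : min x₁ z ∈ Icc a z := ⟨le_min hx₁.1 hz.1, min_le_right _ _⟩
      have hy₂ : max x₂ z ∈ Icc z b := ⟨le_max_right _ _, max_le hx₂.2 hz.2⟩
      have := hx _ hy₁ _ hy₂
      rwa [hsplit s hs _ ⟨hy₁.1, hy₁.2.trans hz.2⟩ _ ⟨hz.1.trans hy₂.1, hy₂.2⟩] at this
  have hWne : W.Nonempty := by
    refine ⟨(z, t₁), (hWmem z t₁).2 ⟨hz, ⟨hst, le_rfl⟩, ?_, fun y₁ hy₁ y₂ hy₂ => ?_⟩⟩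
    · have := h.pos z t₁ (hgood z hz t₁ (hIoo t₁ ⟨hst, le_rfl⟩)).mem
      nlinarith
    · rw [hA]
      gcongr
      exact hB y₁ y₂ hy₁.1 (hy₁.2.trans hy₂.1) hy₂.2
  obtain ⟨⟨z', s⟩, hz', hsmin⟩ := hWc.exists_isMinOn hWne (f := Prod.snd) continuousOn_snd
  replace hsmin : ∀ x t, (x, t) ∈ W → s ≤ t := fun x t hx => hsmin hx
  obtain ⟨-, hsI, -, -⟩ := (hWmem z' s).1 hz'
  rcases hsI.1.eq_or_lt with hs0 | hs0
  · obtain ⟨hz'1, -, hz'2, hz'3⟩ := (hWmem z' s).1 hz'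
    rw [← hs0] at hz'2 hz'3
    have hs0I : s₀ ∈ Icc s₀ t₁ := ⟨le_rfl, hst⟩
    refine ⟨z', hz'1, hthin z' hz'1 s₀ hs0I hz'2, fun y₂ hy₂ => ?_⟩
    have := hz'3 z' ⟨hz'1.1, le_rfl⟩ y₂ hy₂
    have hsc : scale (4 / r) s₀ s₀ = 4 / r := by simp [scale]
    simp only [← hZa, hsc] at this
    rw [hA, ← le_div_iff₀ (Real.exp_pos _), mul_div_assoc, ← Real.exp_sub] at this
    refine this.trans ?_
    rw [← hC]
    gcongr
    nlinarith
  exfalso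
  -- among the necks at the minimal time, take the thinnest
  have hsT := hIoo s hsI
  obtain ⟨⟨q, s'⟩, ⟨hqW, hs'⟩, hqmin⟩ := (hWc.inter_right
      (isClosed_singleton.preimage continuous_snd : IsClosed (Prod.snd ⁻¹' {s}))).exists_isMinOn
    ⟨(z', s), hz', rfl⟩ (f := fun p => u p.1 p.2)
    (huc.mono fun p hp => by
      have := hp.1
      rw [hW] at this
      exact this.1)
  obtain rfl : s' = s := hs'
  replace hqmin : ∀ x, (x, s') ∈ W → u q s' ≤ u x s' := fun x hx =>
    hqmin (show (x, s') ∈ W ∩ Prod.snd ⁻¹' {s'} from ⟨hx, rfl⟩)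
  obtain ⟨hq, -, hq2, hq3⟩ := (hWmem q s').1 hqW
  have hqthin := hthin q hq s' hsI hq2
  have hqs := hside s' hsI
  have haq : a < q := lt_of_le_of_ne hq.1 fun e => by rw [← e] at hqthin; linarith
  have hqb : q < b := lt_of_le_of_ne hq.2 fun e => by rw [e] at hqthin; linarith
  have hΩ := (hgood q hq s' hsT).mem
  have hZq : 0 < Z q s' := by
    rw [← hZa]; exact prof_pos (by linarith [hslit q hq s' hsI hqthin])
  have hlocmin : IsLocalMin (fun y => u y s') q := by
    have hZc : ContinuousAt (fun y => Z y s') q :=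
      (hZ.cont s' hsT).continuousAt (Icc_mem_nhds haq hqb)
    obtain ⟨ε, hε, hεZ⟩ := Metric.eventually_nhds_iff.1 ((hZc.eventually (lt_mem_nhds hZq)).and
      (Icc_mem_nhds haq hqb))
    have hεZ' : ∀ y, |y - q| < ε → 0 < Z y s' ∧ y ∈ Icc a b := fun y hy => hεZ hy
    refine Metric.eventually_nhds_iff.2 ⟨ε, hε, fun x hx => ?_⟩
    by_contra! hlt
    rw [Real.dist_eq] at hx
    have hxI := (hεZ' x hx).2
    have hux := h.pos x s' (hgood x hxI s' hsT).mem
    refine (hqmin x ((hWmem x s').2 ⟨hxI, hsI, ?_, fun y₁ hy₁ y₂ hy₂ => ?_⟩)).not_gt hlt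
    · nlinarith
    · have hy₁' : y₁ ∈ Icc a b := ⟨hy₁.1, hy₁.2.trans hxI.2⟩
      have hy₂' : y₂ ∈ Icc a b := ⟨hxI.1.trans hy₂.1, hy₂.2⟩
      have hnn : ∀ p p', q - ε < p → p ≤ p' → p' < q + ε → 0 ≤ ∫ y in p..p', Z y s' :=
        fun p p' h3 h4 h5 => intervalIntegral.integral_nonneg h4 fun y hy =>
          (hεZ' y (abs_lt.2 ⟨by linarith [hy.1], by linarith [hy.2]⟩)).1.le
      rw [abs_lt] at hx
      rcases le_or_gt y₁ q with hc1 | hc1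
      · rcases le_or_gt q y₂ with hc2 | hc2
        · exact hq3 y₁ ⟨hy₁.1, hc1⟩ y₂ ⟨hc2, hy₂.2⟩
        · refine le_trans ?_ (hq3 y₁ ⟨hy₁.1, hc1⟩ q ⟨le_rfl, hq.2⟩)
          gcongr
          rw [← intervalIntegral.integral_add_adjacent_intervals (hInt s' hsI y₁ hy₁' y₂ hy₂')
            (hInt s' hsI y₂ hy₂' q hq)]
          linarith [hnn y₂ q (by linarith [hy₂.1]) hc2.le (by linarith)]
      · have hc2 : q ≤ y₂ := hc1.le.trans (hy₁.2.trans hy₂.1)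
        refine le_trans ?_ (hq3 q ⟨hq.1, le_rfl⟩ y₂ ⟨hc2, hy₂.2⟩)
        gcongr
        rw [← intervalIntegral.integral_add_adjacent_intervals (hInt s' hsI q hq y₁ hy₁')
          (hInt s' hsI y₁ hy₁' y₂ hy₂')]
        linarith [hnn q y₁ (by linarith) hc1.le (by linarith [hy₁.2])]
  obtain ⟨η, hη, hηlt⟩ := exists_lt_left (h.hasDerivAt_sq_sub (c := t₁) (r := r / 6) hΩ)
    (h.deriv_sq_at_min hΩ hlocmin)
  obtain ⟨s₂, hs₂, hs₂'⟩ : ∃ s₂, max s₀ (s' - η) < s₂ ∧ s₂ < s' :=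
    exists_between (max_lt hs0 (by linarith))
  rw [max_lt_iff] at hs₂
  have hsub : ∀ t ∈ Icc s₂ s', t ∈ Icc s₀ t₁ := fun t ht =>
    ⟨hs₂.1.le.trans ht.1, ht.2.trans hsI.2⟩
  have hneck : ∀ t ∈ Icc s₂ s', u q t ^ 2 - ((r / 6) ^ 2 - 2 * (κ + 1) * (t - t₁)) ≤ 0 := by
    intro t ht
    rcases ht.2.eq_or_lt with rfl | hlt
    · exact hq2
    · exact ((hηlt t ⟨hs₂.2.trans_le ht.1, hlt⟩).trans_le hq2).le
  have hnotW : (q, s₂) ∉ W := fun hmem => (hsmin q s₂ hmem).not_gt hs₂'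
  rw [hWmem] at hnotW
  push Not at hnotW
  obtain ⟨y₁, hy₁, y₂, hy₂, hlt⟩ := hnotW hq (hsub s₂ ⟨le_rfl, hs₂'.le⟩)
    (hneck s₂ ⟨le_rfl, hs₂'.le⟩)
  obtain ⟨x₁, hx₁, x₂, hx₂, hlt'⟩ := h.excursion_persist (s₀ := s₀) (s₁ := s') (C := C) hP hgood hL
    (hcs.trans hs₂.1) hs₂'.le hsT.2 hq
    (fun t ht => hslit q hq t (hsub t ht) (hthin q hq t (hsub t ht) (hneck t ht)))
    (fun t ht => ⟨hfat t (hsub t ht) _ (hside t (hsub t ht)).1,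
      hfat t (hsub t ht) _ (hside t (hsub t ht)).2⟩)
    (fun t ht => by
      have h3 := scale_le hP (hsub t ht).1
      have h4 := scale_pos hP s₀ t
      have : scale (4 / r) s₀ t ^ 2 ≤ (4 / r) ^ 2 := by gcongr
      rw [hC]; linarith) hA0 hy₁ hy₂ (by simpa only [hZa] using hlt)
  simp only [hZa] at hlt'
  exact (hq3 x₁ hx₁ x₂ hx₂).not_gt hlt'

/-- The solution cannot pinch at the top of a strip when its final values are positive. -/
theorem Sol.lower_closing (h : Sol κ Ω u v w g) {a b c T L r : ℝ} (hab : a ≤ b) (hcT : c < T)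
    (hr : 0 < r) (hgood : ∀ y ∈ Icc a b, ∀ t ∈ Ico c T, LocBdd Ω g (y, t))
    (hL : ∀ y ∈ Icc a b, ∀ t ∈ Ioo c T, u y t ≤ L)
    (htop : ∀ y ∈ Icc a b, (y, T) ∈ Ω ∧ r ≤ u y T)
    (hside : ∀ t ∈ Ico c T, r ≤ u a t ∧ r ≤ u b t) :
    ∃ ℓ > 0, ∀ y ∈ Icc a b, ∀ t ∈ Ico c T, ℓ ≤ u y t := by
  have hκ := h.κ_nonneg
  have hP : 0 < 4 / r := by positivity
  have hgood' : ∀ y ∈ Icc a b, ∀ t ∈ Ioo c T, LocBdd Ω g (y, t) :=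
    fun y hy t ht => hgood y hy t (Ioo_subset_Ico_self ht)
  have hs := h.strip hgood'
  obtain ⟨s₀, hs₀, hs₀T⟩ : ∃ s₀, max c (T - min 1 (r ^ 2 / (64 * (κ + 1)))) < s₀ ∧ s₀ < T :=
    exists_between (max_lt hcT (sub_lt_self _ (lt_min one_pos (by positivity))))
  rw [max_lt_iff] at hs₀
  have hm1 : T - s₀ ≤ 1 := by linarith [min_le_left 1 (r ^ 2 / (64 * (κ + 1)))]
  have hm2 : 2 * (κ + 1) * (T - s₀) ≤ r ^ 2 / 32 := by
    have : T - s₀ ≤ r ^ 2 / (64 * (κ + 1)) := by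
      linarith [min_le_right 1 (r ^ 2 / (64 * (κ + 1)))]
    calc 2 * (κ + 1) * (T - s₀) ≤ 2 * (κ + 1) * (r ^ 2 / (64 * (κ + 1))) := by gcongr
      _ = r ^ 2 / 32 := by field_simp; norm_num
  have hcs := hs₀.1
  have hev : ∀ᶠ t in 𝓝[<] T, t ∈ Ioo s₀ T := Ioo_mem_nhdsLT hs₀T
  have hZ := h.profStrip (s₀ := s₀) hP hgood' hL
  have hB := tendsto_integral_max (l := 𝓝[<] T) (M := 3 / 10) hab
    (hev.mono fun t ht => hZ.cont t ⟨hcs.trans ht.1, ht.2⟩)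
    (Eventually.of_forall fun t y _ => prof_le _) fun y hy => by
      have hyT := htop y (Ioo_subset_Icc_self hy)
      have h1 := (((hasDerivAt_scale (4 / r) s₀ T).continuousAt.mul
        (h.hg y T hyT.1).continuousAt).tendsto.mono_left (nhdsWithin_le_nhds (s := Iio T)))
      have h2 : 2 < scale (4 / r) s₀ T * u y T := by
        have hθ := half_lt_exp_neg_half hm1
        unfold scale
        calc (2 : ℝ) = 4 / r * (1 / 2) * r := by field_simp; norm_num
          _ < 4 / r * Real.exp (-(T - s₀) / 2) * r := by gcongr
          _ ≤ 4 / r * Real.exp (-(T - s₀) / 2) * u y T := by gcongr; exact hyT.2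
      refine tendsto_const_nhds.congr' ?_
      filter_upwards [h1.eventually (lt_mem_nhds h2)] with t ht
      simp only [Pi.mul_apply] at ht
      exact (max_eq_right (prof_neg (by linarith)).le).symm
  have hs₀I : s₀ ∈ Ioo c T := ⟨hcs, hs₀T⟩
  obtain ⟨δ, hδ, hδu⟩ := Metric.uniformContinuousOn_iff.1
    (isCompact_Icc.uniformContinuousOn_of_continuous (hs.cont s₀ hs₀I)) (r / 8) (by positivity)
  have hφ : 0 < prof (1 / 2) := prof_pos (by norm_num)
  obtain ⟨E, hE⟩ : ∃ E, E = Real.exp (20 * (4 / r) ^ 2) := ⟨_, rfl⟩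
  have hE0 : 0 < E := hE ▸ Real.exp_pos _
  have hsmall := hB.eventually (gt_mem_nhds (by positivity : 0 < prof (1 / 2) * (δ / 2) / E))
  have hno : ∀ᶠ t in 𝓝[<] T, ∀ z ∈ Icc a b, r / 6 < u z t := by
    filter_upwards [hev, hsmall] with t₁ ht₁ hBt z hz
    by_contra! hzt
    have ht₁' : t₁ ∈ Ioo c T := ⟨hcs.trans ht₁.1, ht₁.2⟩
    have hsub : ∀ t ∈ Icc s₀ t₁, t ∈ Ico c T := fun t ht =>
      ⟨hcs.le.trans ht.1, ht.2.trans_lt ht₁.2⟩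
    obtain ⟨z₀, hz₀, hthin, hInt⟩ := h.slit_transport hr hgood' hL hcs ht₁.1.le ht₁.2
      (by linarith [ht₁.2]) (le_trans (by gcongr; exact ht₁.2.le) hm2)
      (fun t ht => hside t (hsub t ht))
      (intervalIntegral.integral_nonneg hab fun y _ => le_max_right _ _)
      (fun y₁ y₂ h1 h2 h3 => integral_le_integral_max (hZ.cont t₁ ht₁') h1 h2 h3) hz hzt
    have hnear : ∀ y ∈ Icc a b, |y - z₀| < δ → u y s₀ < 3 / 8 * r := fun y hy hyz => by
      have := hδu y hy z₀ hz₀ hyz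
      rw [Real.dist_eq, abs_lt] at this
      linarith [this.2]
    have hzb : z₀ + δ / 2 ≤ b := by
      by_contra! hlt
      have := hnear b ⟨hab, le_rfl⟩ (abs_lt.2 ⟨by linarith [hz₀.2], by linarith⟩)
      linarith [(hside s₀ ⟨hcs.le, hs₀T⟩).2]
    have h1 := hInt (z₀ + δ / 2) ⟨by linarith, hzb⟩
    have h2 : prof (1 / 2) * (δ / 2) ≤ ∫ y in z₀..(z₀ + δ / 2), prof (4 / r * u y s₀ - 1) := by
      have h3 : ∫ _ in z₀..(z₀ + δ / 2), prof (1 / 2) = prof (1 / 2) * (δ / 2) := by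
        rw [intervalIntegral.integral_const, smul_eq_mul]; ring
      rw [← h3]
      have hsub : Icc z₀ (z₀ + δ / 2) ⊆ Icc a b := Icc_subset_Icc hz₀.1 hzb
      refine intervalIntegral.integral_mono_on (by linarith) intervalIntegrable_const
        (ContinuousOn.intervalIntegrable_of_Icc (by linarith) ?_) fun y hy => prof_antitone ?_
      · have := (hs.cont s₀ hs₀I).mono hsub
        exact continuous_prof.comp_continuousOn (f := fun y => 4 / r * u y s₀ - 1) (by fun_prop)
      · have := hnear y (hsub hy) (abs_lt.2 ⟨by linarith [hy.1], by linarith [hy.2]⟩)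
        have h4 : 4 / r * u y s₀ ≤ 4 / r * (3 / 8 * r) := by gcongr
        have h5 : 4 / r * (3 / 8 * r) = 3 / 2 := by field_simp; norm_num
        linarith
    rw [lt_div_iff₀ hE0] at hBt
    rw [← hE] at h1
    linarith
  obtain ⟨t', ht', hno'⟩ := (mem_nhdsLT_iff_exists_mem_Ico_Ioo_subset hcT).1 hno
  obtain ⟨t₂, ht₂, ht₂T⟩ := exists_between ht'.2
  obtain ⟨⟨y', s'⟩, hys, hmin⟩ := (isCompact_Icc.prod isCompact_Icc :
      IsCompact (Icc a b ×ˢ Icc c t₂)).exists_isMinOn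
    ⟨(a, c), ⟨le_rfl, hab⟩, le_rfl, ht'.1.trans ht₂.le⟩ (f := fun p : ℝ × ℝ => u p.1 p.2)
    fun p hp => (h.continuousAt (hgood p.1 hp.1 p.2
      ⟨hp.2.1, hp.2.2.trans_lt ht₂T⟩)).continuousWithinAt
  refine ⟨min (r / 6) (u y' s'), lt_min (by positivity)
    (h.pos y' s' (hgood y' hys.1 s' ⟨hys.2.1, hys.2.2.trans_lt ht₂T⟩).mem), fun y hy t ht => ?_⟩
  rcases le_total t t₂ with hle | hle
  · exact (min_le_right _ _).trans
      (hmin (show (y, t) ∈ Icc a b ×ˢ Icc c t₂ from ⟨hy, ht.1, hle⟩))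
  · exact (min_le_left _ _).trans (hno' ⟨ht₂.trans_le hle, ht.2⟩ y hy).le

end Measure

/-! ### Uniform bounds above a well-behaved horizontal line -/

theorem Tame.mono {K K' y t : ℝ} (h : Tame Ω u g K y t) (hK : 0 < K) (hKK : K ≤ K') :
    Tame Ω u g K' y t :=
  ⟨h.1, h.2.1.trans hKK, (inv_anti₀ hK hKK).trans h.2.2.1, h.2.2.2.trans hKK⟩

theorem exists_bounds {f p : ℝ → ℝ} {a b : ℝ} (hf : ContinuousOn f (Icc a b))
    (hp : ContinuousOn p (Icc a b)) (hpos : ∀ x ∈ Icc a b, 0 < p x) :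
    ∃ K ≥ 1, ∀ x ∈ Icc a b, |f x| ≤ K ∧ K⁻¹ ≤ p x ∧ p x ≤ K := by
  obtain ⟨K₁, hK₁⟩ := isCompact_Icc.exists_bound_of_continuousOn hf
  obtain ⟨K₂, hK₂⟩ := isCompact_Icc.exists_bound_of_continuousOn hp
  obtain ⟨K₃, hK₃⟩ := isCompact_Icc.exists_bound_of_continuousOn
    (hp.inv₀ fun x hx => (hpos x hx).ne')
  refine ⟨max (max K₁ K₂) (max K₃ 1), le_max_of_le_right (le_max_right _ _), fun x hx => ?_⟩
  have h3 := (le_abs_self _).trans (hK₃ x hx)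
  refine ⟨(hK₁ x hx).trans (le_max_of_le_left (le_max_left _ _)), ?_,
    ((le_abs_self _).trans (hK₂ x hx)).trans (le_max_of_le_left (le_max_right _ _))⟩
  have : (p x)⁻¹ ≤ max (max K₁ K₂) (max K₃ 1) := h3.trans (le_max_of_le_right (le_max_left _ _))
  exact inv_le_of_inv_le₀ (hpos x hx) this

theorem Sol.exists_tame_t (h : Sol κ Ω u v w g) {y a b : ℝ}
    (hΩ : ∀ t ∈ Icc a b, (y, t) ∈ Ω) : ∃ K ≥ 1, ∀ t ∈ Icc a b, Tame Ω u g K y t := by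
  obtain ⟨K, hK, hb⟩ := exists_bounds (f := fun t => g y t) (p := fun t => u y t) (a := a) (b := b)
    (fun t ht => (h.cont_g y t (hΩ t ht)).continuousWithinAt)
    (fun t ht => (h.hg y t (hΩ t ht)).continuousAt.continuousWithinAt)
    (fun t ht => h.pos y t (hΩ t ht))
  exact ⟨K, hK, fun t ht => ⟨hΩ t ht, hb t ht⟩⟩

theorem Sol.exists_tame_y (h : Sol κ Ω u v w g) {t a b : ℝ}
    (hΩ : ∀ y ∈ Icc a b, (y, t) ∈ Ω) : ∃ K ≥ 1, ∀ y ∈ Icc a b, Tame Ω u g K y t := by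
  obtain ⟨K, hK, hb⟩ := exists_bounds (f := fun y => g y t) (p := fun y => u y t) (a := a) (b := b)
    (fun y hy => (h.cont_g_y (hΩ y hy)).continuousWithinAt)
    (fun y hy => (h.hv y t (hΩ y hy)).continuousAt.continuousWithinAt)
    (fun y hy => h.pos y t (hΩ y hy))
  exact ⟨K, hK, fun y hy => ⟨hΩ y hy, hb y hy⟩⟩

/-- Above a well-behaved line, with well-behaved lateral sides and well-behaved vertical lines
through the bad points, `g` is bounded by a universal constant for a short time. -/
theorem Sol.strip_bound (h : Sol κ Ω u v w g) {α α' β' β c T K : ℝ} (hα : α < α') (hαβ : α' < β')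
    (hβ : β' < β) (hK : 1 ≤ K) (hT1 : T - c ≤ 1) (hTκ : 2 * (κ + 1) * (T - c) ≤ (2 * K)⁻¹ ^ 2 / 2)
    (hgood : ∀ y ∈ Icc α β, ∀ t ∈ Ioo c T, LocBdd Ω g (y, t))
    (htame : ∀ y ∈ Icc α β, Tame Ω u g K y c)
    (hlat : ∀ t ∈ Ico c T, Tame Ω u g K α t ∧ Tame Ω u g K β t)
    (hlat' : ∀ t ∈ Ico c T, Tame Ω u g K α' t ∧ Tame Ω u g K β' t)
    (hbad : ∀ y ∈ Icc α β, ¬ LocBdd Ω g (y, c) → ∀ t ∈ Ico c T, Tame Ω u g K y t)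
    {y t : ℝ} (hy : y ∈ Icc α' β') (ht : t ∈ Ioo c T) :
    |g y t| ≤ 2 * (K + κ / (4 * K)⁻¹ + 1) * Real.exp (1 + κ / (4 * K)⁻¹ ^ 2) := by
  have hκ := h.κ_nonneg
  have hK0 : 0 < K := by linarith
  have hdiv : κ / (4 * K)⁻¹ = 4 * (κ * K) := by rw [div_inv_eq_mul]; ring
  have hκK : 0 ≤ κ * K := by positivity
  have hsub : Icc α' β' ⊆ Icc α β := Icc_subset_Icc hα.le hβ.le
  have hup : ∀ y ∈ Icc α β, ∀ t ∈ Ioo c T,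
      u y t ≤ u y c + 2 * (K + κ / (4 * K)⁻¹ + 1) * (t - c) := by
    intro y hy t ht
    refine (h.upper hK hT1 hgood htame hlat hbad hy ht).trans ?_
    have : 0 ≤ t - c := by linarith [ht.1]
    gcongr
    rw [hdiv]; linarith
  refine h.abs_g_le hαβ hK hT1 (ℓ := (4 * K)⁻¹) (by positivity)
    (fun y hy => hgood y (hsub hy)) (fun y hy => htame y (hsub hy)) hlat'
    (fun y hy t ht => ?_) (fun y hy => hup y (hsub hy)) le_rfl hy ht
  have h1 := h.lower hα hβ hT1 hK (by positivity) hgood hup htame hlat' hbad hy ht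
  have h2 : 2 * (κ + 1) * (t - c) ≤ 2 * (κ + 1) * (T - c) := by
    gcongr; exact ht.2.le
  have h3 : (4 * K)⁻¹ ^ 2 = (2 * K)⁻¹ ^ 2 / 4 := by
    field_simp; norm_num
  have hu := h.pos y t (hgood y (hsub hy) t ht).mem
  refine abs_le_of_sq_le_sq' ?_ hu.le |>.2
  nlinarith [sq_nonneg (2 * K)⁻¹]

/-- Below the first time at which bad points appear, `g` stays bounded. -/
theorem Sol.first_strip_bound (h : Sol κ Ω u v w g) {α β c T K : ℝ} (hαβ : α < β) (hcT : c < T)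
    (hK : 1 ≤ K) (hT1 : T - c ≤ 1) (hgood : ∀ y ∈ Icc α β, ∀ t ∈ Ico c T, LocBdd Ω g (y, t))
    (hlat : ∀ t ∈ Ico c T, Tame Ω u g K α t ∧ Tame Ω u g K β t)
    (htop : ∀ y ∈ Icc α β, Tame Ω u g K y T) :
    ∃ G, ∀ y ∈ Icc α β, ∀ t ∈ Ioo c T, |g y t| ≤ G := by
  have hκ := h.κ_nonneg
  have hgood' : ∀ y ∈ Icc α β, ∀ t ∈ Ioo c T, LocBdd Ω g (y, t) :=
    fun y hy t ht => hgood y hy t (Ioo_subset_Ico_self ht)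
  obtain ⟨K₁, hK₁, htame₁⟩ := h.exists_tame_y (t := c) (a := α) (b := β)
    fun y hy => (hgood y hy c ⟨le_rfl, hcT⟩).mem
  obtain ⟨M, hM⟩ : ∃ M, M = max K K₁ := ⟨_, rfl⟩
  have hKM : K ≤ M := hM ▸ le_max_left _ _
  have hM1 : 1 ≤ M := hK.trans hKM
  have hM0 : 0 < M := by linarith
  have htame : ∀ y ∈ Icc α β, Tame Ω u g M y c := fun y hy =>
    (htame₁ y hy).mono (by linarith) (hM ▸ le_max_right _ _)
  have hlatM : ∀ t ∈ Ico c T, Tame Ω u g M α t ∧ Tame Ω u g M β t := fun t ht =>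
    ⟨(hlat t ht).1.mono (by linarith) hKM, (hlat t ht).2.mono (by linarith) hKM⟩
  have hup := fun y hy t ht => h.upper (y := y) (t := t) hM1 hT1 hgood' htame hlatM
    (fun y hy hn => absurd (hgood y hy c ⟨le_rfl, hcT⟩) hn) hy ht
  have hκM : 0 ≤ κ * M := by positivity
  obtain ⟨ℓ, hℓ, hlo⟩ := h.lower_closing (r := M⁻¹) (L := M + 2 * (M + κ * M + 1) * (T - c))
    hαβ.le hcT (by positivity) hgood
    (fun y hy t ht => (hup y hy t ht).trans (add_le_add (htame y hy).2.2.2 (by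
      gcongr; exact ht.2.le)))
    (fun y hy => ⟨(htop y hy).1, ((htop y hy).mono (by linarith) hKM).2.2.1⟩)
    (fun t ht => ⟨(hlatM t ht).1.2.2.1, (hlatM t ht).2.2.2.1⟩)
  have hκℓ : 0 ≤ κ / ℓ := by positivity
  refine ⟨2 * (M + κ * M + κ / ℓ + 1) * Real.exp (1 + κ / ℓ ^ 2), fun y hy t ht => ?_⟩
  refine h.abs_g_le hαβ hM1 hT1 hℓ hgood' htame hlatM
    (fun y hy t ht => hlo y hy t (Ioo_subset_Ico_self ht)) (fun y hy t ht => ?_) (by linarith) hy ht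
  refine (hup y hy t ht).trans ?_
  have : 0 ≤ t - c := by linarith [ht.1]
  have := mul_nonneg hκℓ this
  linarith

/-- Bad points cannot have uniform bounds on the lines through them. -/
theorem Sol.locBdd_of_uniform (h : Sol κ Ω u v w g) {y₀ τ₀ r k : ℝ} (hr : 0 < r) (hk : 0 < k)
    (hbox : ∀ y ∈ Icc (y₀ - r) (y₀ + r), ∀ t ∈ Icc (τ₀ - r) (τ₀ + r), (y, t) ∈ Ω)
    (hbad : ∀ y ∈ Icc (y₀ - r) (y₀ + r), ∀ t ∈ Icc (τ₀ - r) (τ₀ + r), ¬ LocBdd Ω g (y, t) →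
      (∀ t ∈ Icc (τ₀ - r) (τ₀ + r), Tame Ω u g k y t) ∧
      ∀ y ∈ Icc (y₀ - r) (y₀ + r), Tame Ω u g k y t) :
    LocBdd Ω g (y₀, τ₀) := by
  by_contra hp₀
  have hκ := h.κ_nonneg
  obtain ⟨K₁, hK₁, ht₁⟩ := h.exists_tame_t fun t ht => hbox (y₀ - r) ⟨by linarith, by linarith⟩ t ht
  obtain ⟨K₂, hK₂, ht₂⟩ := h.exists_tame_t fun t ht => hbox (y₀ + r) ⟨by linarith, by linarith⟩ t ht
  obtain ⟨K₃, hK₃, ht₃⟩ := h.exists_tame_t fun t ht =>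
    hbox (y₀ - r / 2) ⟨by linarith, by linarith⟩ t ht
  obtain ⟨K₄, hK₄, ht₄⟩ := h.exists_tame_t fun t ht =>
    hbox (y₀ + r / 2) ⟨by linarith, by linarith⟩ t ht
  obtain ⟨K, hK⟩ : ∃ K, K = K₁ + K₂ + K₃ + K₄ + k := ⟨_, rfl⟩
  have hK1 : 1 ≤ K := by linarith
  have hK0 : 0 < K := by linarith
  have hkK : k ≤ K := by linarith
  obtain ⟨ρ, hρ, hρr, hρ1, hρκ⟩ : ∃ ρ > 0, ρ ≤ r ∧ 2 * ρ ≤ 1 ∧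
      2 * (κ + 1) * (2 * ρ) ≤ (2 * K)⁻¹ ^ 2 / 2 := by
    refine ⟨min r (min (1 / 2) ((2 * K)⁻¹ ^ 2 / (8 * (κ + 1)))), by positivity, min_le_left _ _,
      ?_, ?_⟩
    · linarith [(min_le_right r (min (1 / 2) ((2 * K)⁻¹ ^ 2 / (8 * (κ + 1))))).trans
        (min_le_left _ _)]
    · calc 2 * (κ + 1) * (2 * min r (min (1 / 2) ((2 * K)⁻¹ ^ 2 / (8 * (κ + 1)))))
          ≤ 2 * (κ + 1) * (2 * ((2 * K)⁻¹ ^ 2 / (8 * (κ + 1)))) := by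
            gcongr
            exact (min_le_right _ _).trans (min_le_right _ _)
        _ = (2 * K)⁻¹ ^ 2 / 2 := by field_simp; norm_num
  have hwin : Icc (τ₀ - ρ) (τ₀ + ρ) ⊆ Icc (τ₀ - r) (τ₀ + r) :=
    Icc_subset_Icc (by linarith) (by linarith)
  have hlat : ∀ t ∈ Icc (τ₀ - ρ) (τ₀ + ρ), Tame Ω u g K (y₀ - r) t ∧ Tame Ω u g K (y₀ + r) t :=
    fun t ht => ⟨(ht₁ t (hwin ht)).mono (by linarith) (by linarith),
      (ht₂ t (hwin ht)).mono (by linarith) (by linarith)⟩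
  have hlat' : ∀ t ∈ Icc (τ₀ - ρ) (τ₀ + ρ),
      Tame Ω u g K (y₀ - r / 2) t ∧ Tame Ω u g K (y₀ + r / 2) t :=
    fun t ht => ⟨(ht₃ t (hwin ht)).mono (by linarith) (by linarith),
      (ht₄ t (hwin ht)).mono (by linarith) (by linarith)⟩
  -- the set of bad times
  obtain ⟨B, hB⟩ : ∃ B : Set ℝ, B = {t | t ∈ Icc (τ₀ - ρ) (τ₀ + ρ) ∧
      ∃ y ∈ Icc (y₀ - r) (y₀ + r), ¬ LocBdd Ω g (y, t)} := ⟨_, rfl⟩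
  have hBmem : ∀ t, t ∈ B ↔ t ∈ Icc (τ₀ - ρ) (τ₀ + ρ) ∧
      ∃ y ∈ Icc (y₀ - r) (y₀ + r), ¬ LocBdd Ω g (y, t) := fun t => by rw [hB]; rfl
  have hBc : IsCompact B := by
    have h1 : IsCompact ((Icc (y₀ - r) (y₀ + r) ×ˢ Icc (τ₀ - ρ) (τ₀ + ρ)) ∩
        {p | LocBdd Ω g p}ᶜ) :=
      (isCompact_Icc.prod isCompact_Icc).inter_right (isOpen_locBdd Ω g).isClosed_compl
    convert h1.image continuous_snd using 1
    ext t
    rw [hBmem]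
    constructor
    · rintro ⟨ht, y, hy, hn⟩
      exact ⟨(y, t), ⟨⟨hy, ht⟩, hn⟩, rfl⟩
    · rintro ⟨⟨y, s⟩, ⟨⟨hy, ht⟩, hn⟩, rfl⟩
      exact ⟨ht, y, hy, hn⟩
  have hτB : τ₀ ∈ B := (hBmem τ₀).2 ⟨⟨by linarith, by linarith⟩, y₀,
    ⟨by linarith, by linarith⟩, hp₀⟩
  have hBtame : ∀ t ∈ B, ∀ y ∈ Icc (y₀ - r) (y₀ + r), Tame Ω u g K y t := by
    intro t ht y hy
    obtain ⟨htI, x, hx, hn⟩ := (hBmem t).1 ht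
    exact ((hbad x hx t (hwin htI) hn).2 y hy).mono hk hkK
  have hnB : ∀ t ∈ Icc (τ₀ - ρ) (τ₀ + ρ), t ∉ B → ∀ y ∈ Icc (y₀ - r) (y₀ + r),
      LocBdd Ω g (y, t) := fun t ht hn y hy => by
    by_contra hb
    exact hn ((hBmem t).2 ⟨ht, y, hy, hb⟩)
  obtain ⟨c₁, hc₁B, hc₁⟩ := hBc.exists_isLeast ⟨τ₀, hτB⟩
  have hc₁I := ((hBmem c₁).1 hc₁B).1
  obtain ⟨G, hG⟩ : ∃ G, ∀ y ∈ Icc (y₀ - r / 2) (y₀ + r / 2), ∀ t ∈ Ioo (τ₀ - ρ) c₁,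
      |g y t| ≤ G := by
    rcases hc₁I.1.eq_or_lt with he | hlt
    · exact ⟨0, fun y _ t ht => absurd (ht.1.trans ht.2) (by rw [he]; exact lt_irrefl _)⟩
    have hI : ∀ t ∈ Ico (τ₀ - ρ) c₁, t ∈ Icc (τ₀ - ρ) (τ₀ + ρ) := fun t ht =>
      ⟨ht.1, ht.2.le.trans hc₁I.2⟩
    obtain ⟨G, hG⟩ := h.first_strip_bound (α := y₀ - r) (β := y₀ + r) (by linarith) hlt hK1
      (by linarith [hc₁I.2]) (fun y hy t ht => hnB t (hI t ht) (fun hb => (hc₁ hb).not_gt ht.2)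
        y hy)
      (fun t ht => hlat t (hI t ht)) (fun y hy => hBtame c₁ hc₁B y hy)
    exact ⟨G, fun y hy => hG y ⟨by linarith [hy.1], by linarith [hy.2]⟩⟩
  obtain ⟨H, hH⟩ : ∃ H, H = 2 * (K + κ / (4 * K)⁻¹ + 1) *
      Real.exp (1 + κ / (4 * K)⁻¹ ^ 2) := ⟨_, rfl⟩
  have hmain : ∀ y ∈ Icc (y₀ - r / 2) (y₀ + r / 2), ∀ t ∈ Ioo (τ₀ - ρ) (τ₀ + ρ),
      |g y t| ≤ max K (max G H) := by
    intro y hy t ht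
    have hy' : y ∈ Icc (y₀ - r) (y₀ + r) := ⟨by linarith [hy.1], by linarith [hy.2]⟩
    by_cases htB : t ∈ B
    · exact (hBtame t htB y hy').2.1.trans (le_max_left _ _)
    rcases lt_or_ge t c₁ with htc | htc
    · exact (hG y hy t ⟨ht.1, htc⟩).trans (le_max_of_le_right (le_max_left _ _))
    refine le_trans ?_ (le_max_of_le_right (le_max_right _ _))
    obtain ⟨c, ⟨hcB, hct⟩, hcmax⟩ := (hBc.inter_right (isClosed_Iic (a := t))).exists_isGreatest
      ⟨c₁, hc₁B, htc⟩
    have hct' : c < t := lt_of_le_of_ne hct fun e => htB (e ▸ hcB)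
    have hcI := ((hBmem c).1 hcB).1
    obtain ⟨ε, hε, hεB⟩ := Metric.isOpen_iff.1 hBc.isClosed.isOpen_compl t htB
    obtain ⟨T, htT, hT⟩ : ∃ T, t < T ∧ T < min (t + ε) (τ₀ + ρ) :=
      exists_between (lt_min (by linarith) ht.2)
    rw [lt_min_iff] at hT
    have hI : ∀ s ∈ Ico c T, s ∈ Icc (τ₀ - ρ) (τ₀ + ρ) := fun s hs =>
      ⟨hcI.1.trans hs.1, hs.2.le.trans hT.2.le⟩
    rw [hH]
    refine h.strip_bound (c := c) (T := T) (α := y₀ - r) (β := y₀ + r) (by linarith) (by linarith)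
      (by linarith) hK1 (by linarith [hcI.1]) (le_trans ?_ hρκ) (fun y hy s hs => ?_)
      (hBtame c hcB) (fun s hs => hlat s (hI s hs)) (fun s hs => hlat' s (hI s hs))
      (fun y hy hn s hs => ?_) hy ⟨hct', htT⟩
    · gcongr
      linarith [hcI.1]
    · refine hnB s (hI s (Ioo_subset_Ico_self hs)) (fun hsB => ?_) y hy
      rcases le_or_gt s t with hst | hst
      · exact (hcmax ⟨hsB, hst⟩).not_gt hs.1
      · exact hεB (show s ∈ Metric.ball t ε by
          rw [Metric.mem_ball, Real.dist_eq, abs_lt]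
          constructor <;> linarith [hs.2]) hsB
    · exact ((hbad y hy c (hwin hcI) hn).1 s (hwin (hI s hs))).mono hk hkK
  refine hp₀ ⟨min (r / 2) ρ, by positivity, max K (max G H), fun y t hy ht => ?_⟩
  simp only [lt_min_iff, abs_lt] at hy ht
  exact ⟨hbox y ⟨by linarith, by linarith⟩ t ⟨by linarith, by linarith⟩,
    hmain y ⟨by linarith, by linarith⟩ t ⟨by linarith, by linarith⟩⟩

/-! ### Local boundedness of the time derivative -/

theorem isClosed_tame {X : Type*} [TopologicalSpace X] {U G : X → ℝ} (hU : Continuous U)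
    (hG : Continuous G) (K : ℝ) : IsClosed {x | |G x| ≤ K ∧ K⁻¹ ≤ U x ∧ U x ≤ K} :=
  (isClosed_le hG.abs continuous_const).inter
    ((isClosed_le continuous_const hU).inter (isClosed_le hU continuous_const))

theorem mem_ball_prod {p q : ℝ × ℝ} {R : ℝ} :
    p ∈ Metric.ball q R ↔ |p.1 - q.1| < R ∧ |p.2 - q.2| < R := by
  rw [Metric.mem_ball, Prod.dist_eq, max_lt_iff, Real.dist_eq, Real.dist_eq]

theorem Sol.locBdd (h : Sol κ Ω u v w g) {p : ℝ × ℝ} (hp : p ∈ Ω) : LocBdd Ω g p := by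
  by_contra hn
  obtain ⟨R, hR, hRΩ⟩ := Metric.isOpen_iff.1 h.isOpen p hp
  obtain ⟨X, hX⟩ : ∃ X : Set (ℝ × ℝ), X = Metric.ball p (R / 2) ∩ {p | LocBdd Ω g p}ᶜ := ⟨_, rfl⟩
  have hlc : IsLocallyClosed X := hX ▸
    Metric.isOpen_ball.isLocallyClosed.inter (isOpen_locBdd Ω g).isClosed_compl.isLocallyClosed
  have : LocallyCompactSpace X := hlc.locallyCompactSpace
  have : Nonempty X := ⟨⟨p, by rw [hX]; exact ⟨Metric.mem_ball_self (by positivity), hn⟩⟩⟩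
  obtain ⟨I, hI⟩ : ∃ I, I = Icc (p.1 - R / 2) (p.1 + R / 2) := ⟨_, rfl⟩
  obtain ⟨J, hJ⟩ : ∃ J, J = Icc (p.2 - R / 2) (p.2 + R / 2) := ⟨_, rfl⟩
  have hIJ : ∀ y ∈ I, ∀ t ∈ J, (y, t) ∈ Ω := fun y hy t ht => hRΩ (mem_ball_prod.2 (by
    rw [hI] at hy; rw [hJ] at ht
    simp only [abs_lt]
    constructor <;> constructor <;> linarith [hy.1, hy.2, ht.1, ht.2]))
  have hXI : ∀ q ∈ X, q.1 ∈ I ∧ q.2 ∈ J := fun q hq => by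
    rw [hX] at hq
    have := mem_ball_prod.1 hq.1
    simp only [abs_lt] at this
    rw [hI, hJ]
    constructor <;> constructor <;> linarith [this.1.1, this.1.2, this.2.1, this.2.2]
  obtain ⟨k, q₀, hq₀⟩ := nonempty_interior_of_iUnion_of_closed (X := X)
    (f := fun k : ℕ => {q : X | (∀ t ∈ J, Tame Ω u g (k + 1) q.1.1 t) ∧
      ∀ y ∈ I, Tame Ω u g (k + 1) y q.1.2}) (fun k => by
      have h1 : ∀ t ∈ J, IsClosed {q : X | Tame Ω u g (k + 1) q.1.1 t} := fun t ht => by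
        have hΩ : ∀ q : X, (q.1.1, t) ∈ Ω := fun q => hIJ _ (hXI q q.2).1 t ht
        convert isClosed_tame (X := X) (U := fun q => u q.1.1 t) (G := fun q => g q.1.1 t) ?_ ?_
          ((k : ℝ) + 1) using 1
        · ext q
          exact ⟨fun hq => hq.2, fun hq => ⟨hΩ q, hq⟩⟩
        · refine continuous_iff_continuousAt.2 fun q => ?_
          exact ContinuousAt.comp (g := fun y => u y t) (h.hv _ _ (hΩ q)).continuousAt
            (by fun_prop : ContinuousAt (fun q : X => q.1.1) q)
        · refine continuous_iff_continuousAt.2 fun q => ?_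
          exact ContinuousAt.comp (g := fun y => g y t) (h.cont_g_y (hΩ q))
            (by fun_prop : ContinuousAt (fun q : X => q.1.1) q)
      have h2 : ∀ y ∈ I, IsClosed {q : X | Tame Ω u g (k + 1) y q.1.2} := fun y hy => by
        have hΩ : ∀ q : X, (y, q.1.2) ∈ Ω := fun q => hIJ y hy _ (hXI q q.2).2
        convert isClosed_tame (X := X) (U := fun q => u y q.1.2) (G := fun q => g y q.1.2) ?_ ?_
          ((k : ℝ) + 1) using 1
        · ext q
          exact ⟨fun hq => hq.2, fun hq => ⟨hΩ q, hq⟩⟩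
        · refine continuous_iff_continuousAt.2 fun q => ?_
          exact ContinuousAt.comp (g := fun t => u y t) (h.hg _ _ (hΩ q)).continuousAt
            (by fun_prop : ContinuousAt (fun q : X => q.1.2) q)
        · refine continuous_iff_continuousAt.2 fun q => ?_
          exact ContinuousAt.comp (g := fun t => g y t) (h.cont_g _ _ (hΩ q))
            (by fun_prop : ContinuousAt (fun q : X => q.1.2) q)
      convert (isClosed_biInter h1).inter (isClosed_biInter h2) using 1
      ext q
      simp only [mem_ofPred_eq, mem_inter_iff, mem_iInter])
    (by
      refine eq_univ_of_forall fun q => mem_iUnion.2 ?_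
      obtain ⟨hqI, hqJ⟩ := hXI q q.2
      obtain ⟨K₁, hK₁, h1⟩ := h.exists_tame_t (y := q.1.1) (a := p.2 - R / 2) (b := p.2 + R / 2)
        fun t ht => hIJ _ hqI t (hJ ▸ ht)
      obtain ⟨K₂, hK₂, h2⟩ := h.exists_tame_y (t := q.1.2) (a := p.1 - R / 2) (b := p.1 + R / 2)
        fun y hy => hIJ y (hI ▸ hy) _ hqJ
      obtain ⟨k, hk⟩ := exists_nat_ge (max K₁ K₂)
      have hk1 := (le_max_left _ _).trans hk
      have hk2 := (le_max_right _ _).trans hk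
      exact ⟨k, fun t ht => (h1 t (hJ ▸ ht)).mono (by linarith) (by linarith),
        fun y hy => (h2 y (hI ▸ hy)).mono (by linarith) (by linarith)⟩)
  obtain ⟨V, hVsub, hVo, hqV⟩ := mem_interior.1 hq₀
  obtain ⟨V', hV'o, rfl⟩ := isOpen_induced_iff.1 hVo
  have hq₀X := hX.subset q₀.2
  obtain ⟨ε, hε, hεV⟩ := Metric.isOpen_iff.1 (hV'o.inter Metric.isOpen_ball) q₀.1 ⟨hqV, hq₀X.1⟩
  have hbox : ∀ y ∈ Icc (q₀.1.1 - ε / 2) (q₀.1.1 + ε / 2),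
      ∀ t ∈ Icc (q₀.1.2 - ε / 2) (q₀.1.2 + ε / 2), (y, t) ∈ V' ∩ Metric.ball p (R / 2) :=
    fun y hy t ht => hεV (mem_ball_prod.2 (by
      simp only [abs_lt]
      constructor <;> constructor <;> linarith [hy.1, hy.2, ht.1, ht.2]))
  have hboxIJ : ∀ y ∈ Icc (q₀.1.1 - ε / 2) (q₀.1.1 + ε / 2),
      ∀ t ∈ Icc (q₀.1.2 - ε / 2) (q₀.1.2 + ε / 2), y ∈ I ∧ t ∈ J := fun y hy t ht => by
    have := mem_ball_prod.1 (hbox y hy t ht).2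
    simp only [abs_lt] at this
    rw [hI, hJ]
    constructor <;> constructor <;> linarith [this.1.1, this.1.2, this.2.1, this.2.2]
  refine hq₀X.2 (h.locBdd_of_uniform (y₀ := q₀.1.1) (τ₀ := q₀.1.2) (r := ε / 2) (k := k + 1)
    (by positivity) (by positivity) (fun y hy t ht => ?_) fun y hy t ht hb => ?_)
  · exact hIJ y (hboxIJ y hy t ht).1 t (hboxIJ y hy t ht).2
  · have hXm : (y, t) ∈ X := by rw [hX]; exact ⟨(hbox y hy t ht).2, hb⟩
    have := @hVsub ⟨(y, t), hXm⟩ (hbox y hy t ht).1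
    exact ⟨fun s hs => this.1 s (hboxIJ y hy s hs).2, fun x hx => this.2 x (hboxIJ x hx t ht).1⟩

/-! ### Joint continuity of the slope and the chain rule -/

theorem Sol.hasDerivAt_arctan_sub (h : Sol κ Ω u v w g) {y t : ℝ} (hp : (y, t) ∈ Ω) :
    HasDerivAt (fun x => Real.arctan (v x t) - x * u x t / 2) (g y t + κ / u y t - u y t) y := by
  refine ((h.hw y t hp).arctan.sub
    (((hasDerivAt_id y).mul (h.hv y t hp)).div_const 2)).congr_deriv ?_
  simp only [id_eq]
  rw [h.pde y t hp]
  ring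

theorem Sol.exists_arctan_lipschitz (h : Sol κ Ω u v w g) {p : ℝ × ℝ} (hp : p ∈ Ω) :
    ∃ R > 0, Metric.ball p R ⊆ Ω ∧ ∃ C, ∀ x y t, |x - p.1| < R → |y - p.1| < R → |t - p.2| < R →
      |(Real.arctan (v y t) - y * u y t / 2) - (Real.arctan (v x t) - x * u x t / 2)|
        ≤ C * |y - x| := by
  have hb := h.locBdd hp
  have hu := h.continuousAt hb
  have hup := h.pos _ _ hp
  obtain ⟨ε, hε, K, hK⟩ := hb
  obtain ⟨ε', hε', hu'⟩ := Metric.mem_nhds_iff.1 (hu.eventually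
    (Icc_mem_nhds (by linarith : u p.1 p.2 / 2 < u p.1 p.2)
      (by linarith : u p.1 p.2 < 2 * u p.1 p.2)))
  refine ⟨min ε ε', lt_min hε hε', fun q hq => ?_, K + κ / (u p.1 p.2 / 2) + 2 * u p.1 p.2,
    fun x y t hx hy ht => ?_⟩
  · have := mem_ball_prod.1 hq
    exact (hK q.1 q.2 (this.1.trans_le (min_le_left _ _)) (this.2.trans_le (min_le_left _ _))).1
  · have hB : ∀ z ∈ Metric.ball p.1 (min ε ε'), ((z, t) ∈ Ω ∧ |g z t| ≤ K) ∧
        u p.1 p.2 / 2 ≤ u z t ∧ u z t ≤ 2 * u p.1 p.2 := fun z hz => by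
      rw [Metric.mem_ball, Real.dist_eq] at hz
      refine ⟨hK z t (hz.trans_le (min_le_left _ _)) (ht.trans_le (min_le_left _ _)), ?_⟩
      exact hu' (a := (z, t)) (mem_ball_prod.2
        ⟨hz.trans_le (min_le_right _ _), ht.trans_le (min_le_right _ _)⟩)
    have := (convex_ball p.1 (min ε ε')).norm_image_sub_le_of_norm_hasDerivWithin_le
      (f := fun x => Real.arctan (v x t) - x * u x t / 2)
      (f' := fun z => g z t + κ / u z t - u z t)
      (C := K + κ / (u p.1 p.2 / 2) + 2 * u p.1 p.2) (x := x) (y := y)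
      (fun z hz => (h.hasDerivAt_arctan_sub (hB z hz).1.1).hasDerivWithinAt)
      (fun z hz => ?_) (by rwa [Metric.mem_ball, Real.dist_eq])
      (by rwa [Metric.mem_ball, Real.dist_eq])
    · simpa [Real.norm_eq_abs] using this
    · obtain ⟨⟨hzΩ, hg⟩, h1, h2⟩ := hB z hz
      have hz0 := h.pos z t hzΩ
      have h3 : κ / u z t ≤ κ / (u p.1 p.2 / 2) :=
        div_le_div_of_nonneg_left h.κ_nonneg (by linarith) h1
      have h4 : 0 ≤ κ / u z t := div_nonneg h.κ_nonneg hz0.le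
      rw [abs_le] at hg
      rw [Real.norm_eq_abs, abs_le]
      constructor <;> linarith [hg.1, hg.2]

theorem Sol.continuousAt_slope (h : Sol κ Ω u v w g) {p : ℝ × ℝ} (hp : p ∈ Ω) :
    ContinuousAt (fun q : ℝ × ℝ => v q.1 q.2) p := by
  suffices hA : ContinuousAt (fun q : ℝ × ℝ => Real.arctan (v q.1 q.2)) p by
    have := ContinuousAt.comp (g := Real.tan) (f := fun q : ℝ × ℝ => Real.arctan (v q.1 q.2))
      (Real.continuousAt_tan.2 (Real.cos_arctan_pos (v p.1 p.2)).ne') hA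
    simpa [Function.comp_def, Real.tan_arctan] using this
  obtain ⟨R, hR, hRΩ, C, hC⟩ := h.exists_arctan_lipschitz hp
  have hC0 : 0 ≤ C := by
    have := hC p.1 (p.1 + R / 2) p.2 (by simpa using hR) (by
      rw [add_sub_cancel_left, abs_of_pos (by positivity)]; linarith) (by simpa using hR)
    rw [add_sub_cancel_left, abs_of_pos (by positivity : 0 < R / 2)] at this
    exact nonneg_of_mul_nonneg_left ((abs_nonneg _).trans this) (by positivity)
  have hu := h.continuousAt (h.locBdd hp)
  rw [Metric.continuousAt_iff']
  intro η hη
  have hf : ContinuousAt (fun q : ℝ × ℝ => q.1 * u q.1 q.2 / 2) p :=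
    (continuousAt_fst.mul hu).div_const 2
  obtain ⟨r₁, hr₁, hf⟩ := Metric.continuousAt_iff.1 hf (η / 8) (by positivity)
  -- the difference quotient at time `p.2`
  have hq : ∀ᶠ x in 𝓝[>] p.1, |Real.arctan (slope (fun x => u x p.2) p.1 x) -
      Real.arctan (v p.1 p.2)| < η / 8 := by
    have h1 : Tendsto (slope (fun x => u x p.2) p.1) (𝓝[>] p.1) (𝓝 (v p.1 p.2)) :=
      (hasDerivAt_iff_tendsto_slope.1 (h.hv _ _ hp)).mono_left
        (nhdsWithin_mono _ fun z hz => ne_of_gt hz)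
    have h2 := (Real.continuous_arctan.tendsto _).comp h1
    exact (Metric.tendsto_nhds.1 h2 (η / 8) (by positivity)).mono fun x hx => by
      simpa [Real.dist_eq] using hx
  obtain ⟨ρ, hρ, hρR, hρr, hρC⟩ : ∃ ρ > 0, ρ ≤ R ∧ ρ ≤ r₁ ∧ C * (2 * ρ) ≤ η / 8 := by
    refine ⟨min (min R r₁) (η / 8 / (2 * (C + 1))), by positivity,
      (min_le_left _ _).trans (min_le_left _ _), (min_le_left _ _).trans (min_le_right _ _), ?_⟩
    have := min_le_right (min R r₁) (η / 8 / (2 * (C + 1)))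
    rw [le_div_iff₀ (by positivity)] at this
    have h0 : 0 < min (min R r₁) (η / 8 / (2 * (C + 1))) := by positivity
    nlinarith
  obtain ⟨x₁, hx₁, hx₁'⟩ := (hq.and (Ioo_mem_nhdsGT (by linarith : p.1 < p.1 + ρ))).exists
  have hxΩ : (x₁, p.2) ∈ Ω := hRΩ (mem_ball_prod.2 ⟨by
    simp only [abs_lt]; constructor <;> linarith [hx₁'.1, hx₁'.2], by simpa using hR⟩)
  have hqt : ∀ᶠ t in 𝓝 p.2, |Real.arctan (slope (fun x => u x t) p.1 x₁) -
      Real.arctan (slope (fun x => u x p.2) p.1 x₁)| < η / 8 := by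
    have h1 : ContinuousAt (fun t => Real.arctan (slope (fun x => u x t) p.1 x₁)) p.2 := by
      simp only [slope_def_field]
      exact Real.continuous_arctan.continuousAt.comp
        (((h.hg _ _ hxΩ).continuousAt.sub (h.hg _ _ hp).continuousAt).div_const _)
    exact (Metric.tendsto_nhds.1 h1 (η / 8) (by positivity)).mono fun x hx => by
      simpa [Real.dist_eq] using hx
  filter_upwards [Metric.ball_mem_nhds p hρ, continuousAt_snd.eventually hqt] with q hqρ hqq
  obtain ⟨hq1, hq2⟩ := mem_ball_prod.1 hqρ
  have hseg : ∀ z ∈ Icc p.1 x₁, |z - p.1| < ρ := fun z hz => by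
    rw [abs_of_nonneg (by linarith [hz.1])]; linarith [hz.2, hx₁'.2]
  have hsegΩ : ∀ z ∈ Icc p.1 x₁, (z, q.2) ∈ Ω := fun z hz =>
    hRΩ (mem_ball_prod.2 ⟨(hseg z hz).trans_le hρR, hq2.trans_le hρR⟩)
  obtain ⟨ξ, hξ, hξ'⟩ := exists_hasDerivAt_eq_slope (fun x => u x q.2) (fun x => v x q.2) hx₁'.1
    (fun z hz => (h.hv z q.2 (hsegΩ z hz)).continuousAt.continuousWithinAt)
    (fun z hz => h.hv z q.2 (hsegΩ z (Ioo_subset_Icc_self hz)))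
  have hξρ := hseg ξ (Ioo_subset_Icc_self hξ)
  have h1 := hC ξ q.1 q.2 (hξρ.trans_le hρR) (hq1.trans_le hρR) (hq2.trans_le hρR)
  have h2 : |q.1 - ξ| ≤ 2 * ρ := by
    calc |q.1 - ξ| ≤ |q.1 - p.1| + |p.1 - ξ| := abs_sub_le _ _ _
      _ ≤ 2 * ρ := by rw [abs_sub_comm p.1 ξ]; linarith
  have h3 := h1.trans ((mul_le_mul_of_nonneg_left h2 hC0).trans hρC)
  have h4 := hf (x := q) (mem_ball_prod.2 ⟨hq1.trans_le hρr, hq2.trans_le hρr⟩)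
  have h5 := hf (x := (ξ, q.2)) (mem_ball_prod.2 ⟨hξρ.trans_le hρr, hq2.trans_le hρr⟩)
  rw [Real.dist_eq] at h4 h5 ⊢
  rw [slope_def_field, ← hξ'] at hqq
  simp only [abs_lt, abs_le] at h3 h4 h5 hqq hx₁ ⊢
  constructor <;> linarith [h3.1, h3.2, h4.1, h4.2, h5.1, h5.2, hqq.1, hqq.2, hx₁.1, hx₁.2]

theorem Sol.hasDerivAt_comp (h : Sol κ Ω u v w g) {Y s : ℝ → ℝ} {Y' s' τ : ℝ}
    (hp : (Y τ, s τ) ∈ Ω) (hY : HasDerivAt Y Y' τ) (hs : HasDerivAt s s' τ) :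
    HasDerivAt (fun σ => u (Y σ) (s σ)) (v (Y τ) (s τ) * Y' + g (Y τ) (s τ) * s') τ := by
  have h1 : HasDerivAt (fun σ => u (Y τ) (s σ)) (g (Y τ) (s τ) * s') τ :=
    HasDerivAt.comp (h₂ := fun r => u (Y τ) r) τ (h.hg _ _ hp) hs
  have h2 : (fun σ => u (Y σ) (s σ) - u (Y τ) (s σ) - v (Y τ) (s τ) * (Y σ - Y τ)) =o[𝓝 τ]
      fun σ => Y σ - Y τ := by
    rw [Asymptotics.isLittleO_iff]
    intro c hc
    obtain ⟨r, hr, hv⟩ := Metric.mem_nhds_iff.1 (((h.continuousAt_slope hp).eventually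
      (Metric.closedBall_mem_nhds _ hc)).and (h.isOpen.mem_nhds hp))
    filter_upwards [hY.continuousAt.eventually (Metric.ball_mem_nhds _ hr),
      hs.continuousAt.eventually (Metric.ball_mem_nhds _ hr)] with σ hσ hσ'
    have hz : ∀ z ∈ Metric.ball (Y τ) r,
        dist (v z (s σ)) (v (Y τ) (s τ)) ≤ c ∧ (z, s σ) ∈ Ω := fun z hz => by
      have := hv (a := (z, s σ)) (mem_ball_prod.2 ⟨hz, hσ'⟩)
      exact this
    have := (convex_ball (Y τ) r).norm_image_sub_le_of_norm_hasDerivWithin_le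
      (f := fun z => u z (s σ) - v (Y τ) (s τ) * z)
      (f' := fun z => v z (s σ) - v (Y τ) (s τ) * 1) (C := c) (x := Y τ) (y := Y σ)
      (fun z hz' => ((h.hv z (s σ) (hz z hz').2).sub
        ((hasDerivAt_id z).const_mul _)).hasDerivWithinAt)
      (fun z hz' => by simpa [Real.dist_eq] using (hz z hz').1) (Metric.mem_ball_self hr) hσ
    refine le_of_eq_of_le ?_ this
    congr 1
    ring
  have h3 : HasDerivAt (fun σ => u (Y σ) (s σ) - u (Y τ) (s σ)) (v (Y τ) (s τ) * Y') τ := by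
    rw [hasDerivAt_iff_isLittleO]
    have h4 := h2.trans_isBigO hY.isBigO_sub
    have h5 := (hasDerivAt_iff_isLittleO.1 hY).const_mul_left (v (Y τ) (s τ))
    refine (h4.add h5).congr_left fun σ => ?_
    simp only [smul_eq_mul]
    ring
  exact (h3.add h1).congr_of_eventuallyEq (Eventually.of_forall fun σ => by simp)

/-! ### The transformed profile -/

theorem sol_of_contDiffOn {n : ℕ} (hn : 2 ≤ n) {Ω : Set (ℝ × ℝ)} (hΩ : IsOpen Ω)
    {u : ℝ → ℝ → ℝ} (hpos : ∀ p ∈ Ω, 0 < u p.1 p.2)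
    (hCy : ∀ τ : ℝ, ContDiffOn ℝ 2 (fun y => u y τ) {y | (y, τ) ∈ Ω})
    (hCτ : ∀ y : ℝ, ContDiffOn ℝ 1 (fun τ => u y τ) {τ | (y, τ) ∈ Ω})
    (hPDE : ∀ p ∈ Ω, SatisfiesRescaledMCF n u p.1 p.2) :
    Sol ((n : ℝ) - 1) Ω u (fun y t => deriv (fun x => u x t) y)
      (fun y t => deriv (deriv fun x => u x t) y) (fun y t => deriv (fun s => u y s) t) := by
  have ho1 : ∀ t, IsOpen {y | (y, t) ∈ Ω} := fun t => hΩ.preimage (by fun_prop)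
  have ho2 : ∀ y, IsOpen {t | (y, t) ∈ Ω} := fun y => hΩ.preimage (by fun_prop)
  have hd : ∀ t, ContDiffOn ℝ 1 (deriv fun x => u x t) {y | (y, t) ∈ Ω} := fun t =>
    (hCy t).deriv_of_isOpen (ho1 t) (by norm_num)
  refine ⟨hΩ, ?_, fun y t hp => hpos (y, t) hp, fun y t hp => ?_, fun y t hp => ?_,
    fun y t hp => ?_, fun y t hp => ?_, fun y t hp => ?_, fun y t hp => hPDE (y, t) hp⟩
  · have : (2 : ℝ) ≤ n := by exact_mod_cast hn
    linarith
  · exact (((hCy t).differentiableOn (by norm_num)).differentiableAt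
      ((ho1 t).mem_nhds hp)).hasDerivAt
  · exact (((hd t).differentiableOn (by norm_num)).differentiableAt
      ((ho1 t).mem_nhds hp)).hasDerivAt
  · exact (((hCτ y).differentiableOn (by norm_num)).differentiableAt
      ((ho2 y).mem_nhds hp)).hasDerivAt
  · exact ((hd t).continuousOn_deriv_of_isOpen (ho1 t) le_rfl).continuousAt ((ho1 t).mem_nhds hp)
  · exact ((hCτ y).continuousOn_deriv_of_isOpen (ho2 y) le_rfl).continuousAt
      ((ho2 y).mem_nhds hp)


theorem Sol.satisfies_uabg {n : ℕ} (h : Sol ((n : ℝ) - 1) Ω u v w g) {α β γ y τ : ℝ}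
    (hE : 0 < 1 + β * Real.exp τ)
    (hp : ((y - α * Real.exp (τ / 2)) / Real.sqrt (1 + β * Real.exp τ),
      τ + γ - Real.log (1 + β * Real.exp τ)) ∈ Ω) :
    SatisfiesRescaledMCF n (uabg α β γ u) y τ := by
  have hS : 0 < √(1 + β * Real.exp τ) := Real.sqrt_pos.2 hE
  have hSS : √(1 + β * Real.exp τ) ^ 2 = 1 + β * Real.exp τ := Real.sq_sqrt hE.le
  have hE' : HasDerivAt (fun σ => 1 + β * Real.exp σ) (β * Real.exp τ) τ :=
    ((Real.hasDerivAt_exp τ).const_mul β).const_add 1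
  have hS' := hE'.sqrt hE.ne'
  have hx' : HasDerivAt (fun σ => y - α * Real.exp (σ / 2))
      (-(α * (Real.exp (τ / 2) * (1 / 2)))) τ :=
    ((((hasDerivAt_id τ).div_const 2).exp.const_mul α).const_sub y)
  have hY' := hx'.div hS' hS.ne'
  have hs' := ((hasDerivAt_id τ).add_const γ).sub (hE'.log hE.ne')
  have hτ := hS'.mul (h.hasDerivAt_comp
    (Y := fun σ => (y - α * Real.exp (σ / 2)) / √(1 + β * Real.exp σ))
    (s := fun σ => σ + γ - Real.log (1 + β * Real.exp σ)) hp hY' hs')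
  have hYy : ∀ x, HasDerivAt (fun x => (x - α * Real.exp (τ / 2)) / √(1 + β * Real.exp τ))
      (1 / √(1 + β * Real.exp τ)) x := fun x =>
    ((hasDerivAt_id x).sub_const _).div_const _
  have hy : ∀ᶠ x in 𝓝 y, HasDerivAt (fun x => uabg α β γ u x τ)
      (v ((x - α * Real.exp (τ / 2)) / √(1 + β * Real.exp τ))
        (τ + γ - Real.log (1 + β * Real.exp τ))) x := by
    filter_upwards [(hYy y).continuousAt.eventually (h.mem_nhds_y hp)] with x hx
    refine ((HasDerivAt.comp (h₂ := fun z => u z (τ + γ - Real.log (1 + β * Real.exp τ))) x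
      (h.hv _ _ hx) (hYy x)).const_mul (√(1 + β * Real.exp τ))).congr_deriv ?_
    field_simp
  have hyy : HasDerivAt (deriv fun x => uabg α β γ u x τ)
      (w ((y - α * Real.exp (τ / 2)) / √(1 + β * Real.exp τ))
        (τ + γ - Real.log (1 + β * Real.exp τ)) * (1 / √(1 + β * Real.exp τ))) y :=
    (HasDerivAt.comp (h₂ := fun z => v z (τ + γ - Real.log (1 + β * Real.exp τ))) y
      (h.hw _ _ hp) (hYy y)).congr_of_eventuallyEq (hy.mono fun x hx => hx.deriv)
  have hpde := h.pde _ _ hp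
  have hu := h.pos _ _ hp
  unfold SatisfiesRescaledMCF
  rw [hyy.deriv, hy.self_of_nhds.deriv]
  have hτ' : deriv (fun σ => uabg α β γ u y σ) τ = _ := hτ.deriv
  rw [hτ']
  simp only [uabg]
  rw [hpde]
  generalize hU : u ((y - α * Real.exp (τ / 2)) / √(1 + β * Real.exp τ))
    (τ + γ - Real.log (1 + β * Real.exp τ)) = U at hu ⊢
  generalize v ((y - α * Real.exp (τ / 2)) / √(1 + β * Real.exp τ))
    (τ + γ - Real.log (1 + β * Real.exp τ)) = V
  generalize w ((y - α * Real.exp (τ / 2)) / √(1 + β * Real.exp τ))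
    (τ + γ - Real.log (1 + β * Real.exp τ)) = W
  have hb : β * Real.exp τ = √(1 + β * Real.exp τ) ^ 2 - 1 := by rw [hSS]; ring
  generalize √(1 + β * Real.exp τ) = S at hS hb ⊢
  rw [hb]
  have hV : (1 : ℝ) + V ^ 2 ≠ 0 := by positivity
  have h1 : 1 + (S ^ 2 - 1) = S ^ 2 := by ring
  rw [h1]
  field_simp
  ring

end RescaledMCF

/-- The rescaled MCF profile equation is invariant under the three-parameter
family of transformations `u ↦ u^{αβγ}` coming from translations in space and
time and parabolic dilations of the original flow. -/
theorem uabg_satisfies_rescaled_equation (n : ℕ) (hn : 2 ≤ n)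
    (Ω : Set (ℝ × ℝ)) (hΩ : IsOpen Ω)
    (u : ℝ → ℝ → ℝ)
    (hpos : ∀ p ∈ Ω, 0 < u p.1 p.2)
    (hCy : ∀ τ : ℝ, ContDiffOn ℝ 2 (fun y => u y τ) {y | (y, τ) ∈ Ω})
    (hCτ : ∀ y : ℝ, ContDiffOn ℝ 1 (fun τ => u y τ) {τ | (y, τ) ∈ Ω})
    (hPDE : ∀ p ∈ Ω, SatisfiesRescaledMCF n u p.1 p.2)
    (α β γ : ℝ) :
    ∀ y τ : ℝ, 0 < 1 + β * Real.exp τ →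
      ((y - α * Real.exp (τ / 2)) / Real.sqrt (1 + β * Real.exp τ),
        τ + γ - Real.log (1 + β * Real.exp τ)) ∈ Ω →
      SatisfiesRescaledMCF n (uabg α β γ u) y τ := by
  intro y τ hE hp
  exact (RescaledMCF.sol_of_contDiffOn hn hΩ hpos hCy hCτ hPDE).satisfies_uabg hE hp
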